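/- Let u be a Lipschitz solution of the thin obstacle problem in B₁ with F, F₀ satisfying (H0) and (H1), and let z₀ ∈ Γ(u). If t_k ↓ 0 and the rescalings u_k(x) := u(z₀ + t_k x)/t_k converge uniformly on B₁ to a function u_∞ (a blowup of u at z₀), then u_∞ is linear in the normal direction: u_∞(x) = a·x_{n+1} for some a ∈ ℝ. -/

import Mathlib

open MeasureTheory Metric Filter
open scoped InnerProductSpace NNReal ENNReal Topology

noncomputable section

/-- Euclidean space `ℝ^{n+1}`. -/
abbrev Eucl (n : ℕ) : Type := EuclideanSpace ℝ (Fin (n + 1))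

namespace TOP

variable {n : ℕ}

/-- The `(n+1)`-st standard basis vector `e_{n+1}`. -/
def eLast (n : ℕ) : Eucl n := EuclideanSpace.single (Fin.last n) 1

/-- Open upper half ball `B_r⁺(x₀)`. -/
def hBall (x₀ : Eucl n) (r : ℝ) : Set (Eucl n) :=
  Metric.ball x₀ r ∩ {x : Eucl n | 0 < x (Fin.last n)}

/-- Open lower half ball `B_r⁻(x₀)`. -/
def hBallNeg (x₀ : Eucl n) (r : ℝ) : Set (Eucl n) :=
  Metric.ball x₀ r ∩ {x : Eucl n | x (Fin.last n) < 0}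

/-- Thin ball `B_r'(x₀)`. -/
def tBall (x₀ : Eucl n) (r : ℝ) : Set (Eucl n) :=
  Metric.ball x₀ r ∩ {x : Eucl n | x (Fin.last n) = 0}

/-- (H0): `F` and `F₀` are of class `C¹` on `B₁ × ℝ × ℝ^{n+1}`. -/
def H0 (F : Eucl n → ℝ → Eucl n → Eucl n) (F₀ : Eucl n → ℝ → Eucl n → ℝ) : Prop :=
  ContDiffOn ℝ 1 (fun q : Eucl n × ℝ × Eucl n => F q.1 q.2.1 q.2.2)
      (Metric.ball (0 : Eucl n) 1 ×ˢ (Set.univ : Set ℝ) ×ˢ (Set.univ : Set (Eucl n))) ∧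
    ContDiffOn ℝ 1 (fun q : Eucl n × ℝ × Eucl n => F₀ q.1 q.2.1 q.2.2)
      (Metric.ball (0 : Eucl n) 1 ×ˢ (Set.univ : Set ℝ) ×ˢ (Set.univ : Set (Eucl n)))

/-- (H1): uniform ellipticity of `D_pF` on compact subsets. -/
def H1 (F : Eucl n → ℝ → Eucl n → Eucl n) : Prop :=
  ∀ M : ℝ, 0 < M → ∃ lam : ℝ, 0 < lam ∧
    ∀ x ∈ Metric.ball (0 : Eucl n) 1, ∀ z : ℝ, |z| ≤ M → ∀ p : Eucl n, ‖p‖ ≤ M →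
      ∀ ξ : Eucl n, lam * ‖ξ‖ ^ 2 ≤ ⟪fderiv ℝ (F x z) p ξ, ξ⟫_ℝ

/-- (H1) with a prescribed ellipticity function `lam : M ↦ λ(M)`. -/
def H1With (lam : ℝ → ℝ) (F : Eucl n → ℝ → Eucl n → Eucl n) : Prop :=
  ∀ M : ℝ, 0 < M → 0 < lam M ∧
    ∀ x ∈ Metric.ball (0 : Eucl n) 1, ∀ z : ℝ, |z| ≤ M → ∀ p : Eucl n, ‖p‖ ≤ M →
      ∀ ξ : Eucl n, lam M * ‖ξ‖ ^ 2 ≤ ⟪fderiv ℝ (F x z) p ξ, ξ⟫_ℝ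

/-- `div_x F (x, z, p) = ∑ᵢ ∂_{xᵢ} Fᵢ (x, z, p)`. -/
def divx (F : Eucl n → ℝ → Eucl n → Eucl n) (x : Eucl n) (z : ℝ) (p : Eucl n) : ℝ :=
  ∑ i : Fin (n + 1), fderiv ℝ (fun y : Eucl n => F y z p i) x (EuclideanSpace.single i 1)

/-- `(F, F₀)` is `t`-rescaled with bound function `L : M ↦ L(M)`. -/
def Rescaled (t : ℝ) (L : ℝ → ℝ) (F : Eucl n → ℝ → Eucl n → Eucl n)
    (F₀ : Eucl n → ℝ → Eucl n → ℝ) : Prop :=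
  ∀ M : ℝ, 0 < M → ∀ x ∈ Metric.ball (0 : Eucl n) 1, ∀ z : ℝ, |z| ≤ M →
    ∀ p : Eucl n, ‖p‖ ≤ M →
      |(- divx F x z p - ⟪deriv (fun s : ℝ => F x s p) z, p⟫_ℝ + F₀ x z p)| ≤ t * L M ∧
        ‖fderiv ℝ (F x z) p‖ ≤ L M

/-- The operator `H_t` acting classically on a `C²` function `φ`:
`H_t(φ)(x) = −div_x F − ⟨∂_z F, ∇φ⟩ − tr(D_pF · D²φ) + F₀`, all evaluated at
`(x, φ(x), ∇φ(x))`. -/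
def Hop (F : Eucl n → ℝ → Eucl n → Eucl n) (F₀ : Eucl n → ℝ → Eucl n → ℝ)
    (φ : Eucl n → ℝ) (x : Eucl n) : ℝ :=
  - divx F x (φ x) (gradient φ x)
    - ⟪deriv (fun s : ℝ => F x s (gradient φ x)) (φ x), gradient φ x⟫_ℝ
    - ∑ i : Fin (n + 1),
        ⟪fderiv ℝ (F x (φ x)) (gradient φ x)
          (fderiv ℝ (gradient φ) x (EuclideanSpace.single i 1)), EuclideanSpace.single i 1⟫_ℝ
    + F₀ x (φ x) (gradient φ x)

/-- The admissible class `A_g` for the thin obstacle problem: `W^{1,∞}(B₁)` functions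
with boundary value `g` on `∂B₁` which are nonnegative on `B₁'`. -/
def AdmissibleThin (g v : Eucl n → ℝ) : Prop :=
  (∃ C : ℝ≥0, LipschitzOnWith C v (Metric.closedBall (0 : Eucl n) 1)) ∧
    (∀ x ∈ Metric.sphere (0 : Eucl n) 1, v x = g x) ∧
    ∀ x ∈ tBall (0 : Eucl n) 1, 0 ≤ v x

/-- A (Lipschitz) solution of the thin obstacle problem in `B₁`. -/
def ThinSolution (F : Eucl n → ℝ → Eucl n → Eucl n) (F₀ : Eucl n → ℝ → Eucl n → ℝ)
    (g u : Eucl n → ℝ) : Prop :=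
  AdmissibleThin g u ∧
    ∀ v : Eucl n → ℝ, AdmissibleThin g v →
      0 ≤ ∫ x in Metric.ball (0 : Eucl n) 1,
        (⟪F x (u x) (gradient u x), gradient v x - gradient u x⟫_ℝ +
          F₀ x (u x) (gradient u x) * (v x - u x))

/-- The admissible class `A_g` for the boundary (Signorini) obstacle problem:
`W^{1,∞}(B₁⁺)` functions with boundary value `g` on `∂B₁⁺ ∖ B₁'` which are
nonnegative on `B₁'`. -/
def AdmissibleBdry (g v : Eucl n → ℝ) : Prop :=
  (∃ C : ℝ≥0, LipschitzOnWith C v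
      (Metric.closedBall (0 : Eucl n) 1 ∩ {x : Eucl n | 0 ≤ x (Fin.last n)})) ∧
    (∀ x : Eucl n, ‖x‖ = 1 → 0 ≤ x (Fin.last n) → v x = g x) ∧
    ∀ x ∈ tBall (0 : Eucl n) 1, 0 ≤ v x

/-- A (Lipschitz) solution of the boundary (Signorini) obstacle problem in `B₁⁺`. -/
def BdrySolution (F : Eucl n → ℝ → Eucl n → Eucl n) (F₀ : Eucl n → ℝ → Eucl n → ℝ)
    (g u : Eucl n → ℝ) : Prop :=
  AdmissibleBdry g u ∧
    ∀ v : Eucl n → ℝ, AdmissibleBdry g v →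
      0 ≤ ∫ x in hBall (0 : Eucl n) 1,
        (⟪F x (u x) (gradient u x), gradient v x - gradient u x⟫_ℝ +
          F₀ x (u x) (gradient u x) * (v x - u x))

/-- The coincidence set `Λ(u) = {x ∈ B₁' : u(x) = 0}`. -/
def coincidenceSet (u : Eucl n → ℝ) : Set (Eucl n) :=
  {x ∈ tBall (0 : Eucl n) 1 | u x = 0}

/-- The free boundary `Γ(u)`: the boundary of `Λ(u)` in the relative topology of `B₁'`. -/
def freeBoundary (u : Eucl n → ℝ) : Set (Eucl n) :=
  {x ∈ coincidenceSet u |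
    ∀ r : ℝ, 0 < r → ∃ y ∈ tBall (0 : Eucl n) 1, y ∈ Metric.ball x r ∧ 0 < u y}

/-- `w` satisfies the Caccioppoli inequality with constant `Q` at `x₀ ∈ B₁'`. -/
def CaccAt (w : Eucl n → ℝ) (Q : ℝ) (x₀ : Eucl n) : Prop :=
  ∀ k : ℝ, 0 ≤ k → ∀ r R : ℝ, 0 < r → r < R → R < 1 - ‖x₀‖ →
    (∫ x in ({x : Eucl n | k ≤ w x} ∩ hBall x₀ r), ‖gradient w x‖ ^ 2) ≤
      Q / (R - r) ^ 2 * (∫ x in ({x : Eucl n | k ≤ w x} ∩ hBall x₀ R), (w x - k) ^ 2) +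
        Q * (volume ({x : Eucl n | k ≤ w x} ∩ hBall x₀ R)).toReal

/-- Difference quotient `D_e^h w (x) = (w(x + h e) − w(x))/h`. -/
def diffQuot (h : ℝ) (e : Eucl n) (w : Eucl n → ℝ) (x : Eucl n) : ℝ :=
  (w (x + h • e) - w x) / h

/-- The barrier function `η(x) = t(|x' − x₀'|² − K x_{n+1}²) + m x_{n+1} + γ`. -/
def etaFn (x₀ : Eucl n) (t K m γ : ℝ) (x : Eucl n) : ℝ :=
  t * ((∑ i : Fin n, (x i.castSucc - x₀ i.castSucc) ^ 2) - K * (x (Fin.last n)) ^ 2) +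
    m * x (Fin.last n) + γ

end TOP

namespace TOP

variable {n : ℕ}

/-! ### Gradients of Lipschitz functions -/

lemma norm_gradient (f : Eucl n → ℝ) (x : Eucl n) : ‖gradient f x‖ = ‖fderiv ℝ f x‖ := by
  simp [gradient]

lemma norm_gradient_le {f : Eucl n → ℝ} {K : ℝ≥0} (hf : LipschitzWith K f) (x : Eucl n) :
    ‖gradient f x‖ ≤ K := by
  rw [norm_gradient]
  exact norm_fderiv_le_of_lipschitz ℝ hf

lemma measurable_gradient (f : Eucl n → ℝ) : Measurable (gradient f) :=
  (InnerProductSpace.toDual ℝ (Eucl n)).symm.continuous.measurable.comp (measurable_fderiv ℝ f)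

lemma gradient_eq_zero_of_isLocalMin {f : Eucl n → ℝ} {x : Eucl n} (h : IsLocalMin f x) :
    gradient f x = 0 := by
  simp [gradient, h.fderiv_eq_zero]

lemma gradient_eq_zero_of_nonneg {f : Eucl n → ℝ} {x : Eucl n} (h : ∀ y, 0 ≤ f y)
    (hx : f x = 0) : gradient f x = 0 :=
  gradient_eq_zero_of_isLocalMin (.of_forall fun y => hx ▸ h y)

lemma gradient_eq_zero_of_isLocalMax {f : Eucl n → ℝ} {x : Eucl n} (h : IsLocalMax f x) :
    gradient f x = 0 := by
  simp [gradient, h.fderiv_eq_zero]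

lemma gradient_sub {f g : Eucl n → ℝ} {x : Eucl n} (hf : DifferentiableAt ℝ f x)
    (hg : DifferentiableAt ℝ g x) :
    gradient (fun y => f y - g y) x = gradient f x - gradient g x := by
  simp [gradient, fderiv_fun_sub hf hg]

lemma gradient_add {f g : Eucl n → ℝ} {x : Eucl n} (hf : DifferentiableAt ℝ f x)
    (hg : DifferentiableAt ℝ g x) :
    gradient (fun y => f y + g y) x = gradient f x + gradient g x := by
  simp [gradient, fderiv_fun_add hf hg]

lemma gradient_const_mul {f : Eucl n → ℝ} {x : Eucl n} (c : ℝ) :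
    gradient (fun y => c * f y) x = c • gradient f x := by
  have := congrFun (fderiv_const_smul_field (𝕜 := ℝ) (f := f) c) x
  simp only [gradient]
  rw [show (fun y => c * f y) = c • f from rfl, this]
  simp

lemma gradient_mul {f g : Eucl n → ℝ} {x : Eucl n} (hf : DifferentiableAt ℝ f x)
    (hg : DifferentiableAt ℝ g x) :
    gradient (fun y => f y * g y) x = f x • gradient g x + g x • gradient f x := by
  simp [gradient, fderiv_fun_mul hf hg]

lemma gradient_sub_const {f : Eucl n → ℝ} {x : Eucl n} (c : ℝ) :
    gradient (fun y => f y - c) x = gradient f x := by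
  simp only [gradient, fderiv_sub_const]

lemma gradient_comp_add_right {f : Eucl n → ℝ} (x c : Eucl n) :
    gradient (fun y => f (y + c)) x = gradient f (x + c) := by
  simp [gradient, fderiv_comp_add_right]

/-- The gradient of the positive part of `f` is that of `f` where `f` is positive. -/
lemma gradient_posPart_of_pos {f : Eucl n → ℝ} (hf : Continuous f) {x : Eucl n}
    (hx : 0 < f x) : gradient (fun y => max (f y) 0) x = gradient f x := by
  apply Filter.EventuallyEq.gradient_eq
  filter_upwards [hf.continuousAt.eventually (lt_mem_nhds hx)] with y hy
  exact max_eq_left hy.le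

/-! ### Translations of Lipschitz functions -/

lemma integrableOn_of_bounded {α : Type*} [MeasurableSpace α] {μ : Measure α} {s : Set α}
    (hs : μ s ≠ ⊤) {f : α → ℝ} (hf : AEStronglyMeasurable f (μ.restrict s)) {C : ℝ}
    (hC : ∀ᵐ x ∂μ.restrict s, |f x| ≤ C) : IntegrableOn f s μ :=
  Integrable.mono' (integrableOn_const hs (C := C)) hf hC

lemma setIntegral_translate_le_mul {f : Eucl n → ℝ} {K : ℝ≥0} (hf : LipschitzWith K f)
    {B : Set (Eucl n)} (hB : Convex ℝ B) (hBm : MeasurableSet B) (hfin : volume B ≠ ⊤)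
    (y : Eucl n) {m : ℕ} (hm : 0 < m) :
    ∫ x in B ∩ {x | x + y ∈ B}, |f (x + y) - f x| ≤
      ∫ z in B, m * |f (z + (m : ℝ)⁻¹ • y) - f z| := by
  have hm' : (0 : ℝ) < m := by exact_mod_cast hm
  have hmeas : ∀ c d : Eucl n, Continuous fun x => |f (x + c) - f (x + d)| := fun c d =>
    ((hf.continuous.comp (continuous_add_const c)).sub
      (hf.continuous.comp (continuous_add_const d))).abs
  have hbd : ∀ c d x : Eucl n, |f (x + c) - f (x + d)| ≤ K * ‖c - d‖ := fun c d x => by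
    simpa [Real.norm_eq_abs] using hf.norm_sub_le (x + c) (x + d)
  have hInt : ∀ (c d : Eucl n) (s : Set (Eucl n)), volume s ≠ ⊤ →
      IntegrableOn (fun x => |f (x + c) - f (x + d)|) s volume := fun c d s hs =>
    integrableOn_of_bounded hs (hmeas c d).aestronglyMeasurable (C := K * ‖c - d‖)
      (.of_forall fun x => by simpa using hbd c d x)
  set C : Set (Eucl n) := B ∩ {x | x + y ∈ B} with hC
  have hCm : MeasurableSet C := hBm.inter (measurable_add_const y hBm)
  have hCfin : volume C ≠ ⊤ := measure_ne_top_of_subset Set.inter_subset_left hfin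
  let p : ℕ → Eucl n := fun i => ((i : ℝ) / m) • y
  have hp0 : p 0 = 0 := by simp [p]
  have hpm : p m = y := by simp [p, hm'.ne']
  have hstep : ∀ i, p (i + 1) = p i + (m : ℝ)⁻¹ • y := fun i => by
    simp only [p, ← add_smul]; congr 1; push_cast; ring
  have key : ∀ i ∈ Finset.range m,
      ∫ x in C, |f (x + p (i + 1)) - f (x + p i)| ≤ ∫ z in B, |f (z + (m : ℝ)⁻¹ • y) - f z| := by
    intro i hi
    have hsub : C ⊆ (fun x => x + p i) ⁻¹' B := by
      rintro x ⟨hx, hxy⟩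
      have : x + p i = (1 - (i : ℝ) / m) • x + ((i : ℝ) / m) • (x + y) := by
        simp only [p]; module
      rw [Set.mem_preimage, this]
      have hi' : (i : ℝ) / m ≤ 1 := by
        rw [div_le_one hm']; exact_mod_cast (Finset.mem_range.1 hi).le
      exact hB hx hxy (by linarith) (by positivity) (by ring)
    have hmp : MeasurePreserving (fun x : Eucl n => x + p i) volume volume :=
      measurePreserving_add_right volume _
    have h1 := hmp.setIntegral_preimage_emb (MeasurableEquiv.addRight (p i)).measurableEmbedding
      (fun z => |f (z + (m : ℝ)⁻¹ • y) - f z|) B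
    rw [← h1]
    have hpf : volume ((fun x => x + p i) ⁻¹' B) ≠ ⊤ := by
      rwa [hmp.measure_preimage hBm.nullMeasurableSet]
    refine (setIntegral_mono_set (s := C) (t := (fun x => x + p i) ⁻¹' B)
      (hInt (p (i+1)) (p i) _ hpf) (.of_forall fun x => abs_nonneg _)
      hsub.eventuallyLE).trans (le_of_eq ?_)
    simp only [hstep, add_assoc]
  calc ∫ x in C, |f (x + y) - f x|
      ≤ ∫ x in C, ∑ i ∈ Finset.range m, |f (x + p (i + 1)) - f (x + p i)| := by
        refine integral_mono ?_ (integrable_finsetSum _ fun i _ => hInt _ _ _ hCfin) fun x => ?_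
        · have := hInt y 0 C hCfin
          simp only [add_zero] at this
          exact this
        · have := Finset.sum_range_sub (fun i => f (x + p i)) m
          simp only [hp0, hpm, add_zero] at this
          dsimp only
          rw [← this]
          exact Finset.abs_sum_le_sum_abs _ _
    _ = ∑ i ∈ Finset.range m, ∫ x in C, |f (x + p (i + 1)) - f (x + p i)| :=
        integral_finsetSum _ fun i _ => hInt _ _ _ hCfin
    _ ≤ ∑ i ∈ Finset.range m, ∫ z in B, |f (z + (m : ℝ)⁻¹ • y) - f z| := Finset.sum_le_sum key
    _ = ∫ z in B, m * |f (z + (m : ℝ)⁻¹ • y) - f z| := by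
        rw [integral_const_mul]; simp

/-- The `L¹` norm of a translation difference is controlled by the `L¹` norm of the gradient. -/
lemma setIntegral_translate_le {f : Eucl n → ℝ} {K : ℝ≥0} (hf : LipschitzWith K f)
    {B : Set (Eucl n)} (hB : Convex ℝ B) (hBm : MeasurableSet B) (hfin : volume B ≠ ⊤)
    (y : Eucl n) :
    ∫ x in B ∩ {x | x + y ∈ B}, |f (x + y) - f x| ≤ ‖y‖ * ∫ x in B, ‖gradient f x‖ := by
  have hlim : Tendsto (fun m : ℕ => ∫ z in B, m * |f (z + (m : ℝ)⁻¹ • y) - f z|) atTop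
      (𝓝 (∫ z in B, |fderiv ℝ f z y|)) := by
    apply tendsto_integral_of_dominated_convergence (fun _ => K * ‖y‖)
    · intro m
      exact (continuous_const.mul ((hf.continuous.comp (continuous_add_const _)).sub
        hf.continuous).abs).aestronglyMeasurable
    · exact integrableOn_const hfin
    · intro m
      refine .of_forall fun z => ?_
      have h := hf.norm_sub_le (z + (m : ℝ)⁻¹ • y) z
      rw [add_sub_cancel_left, norm_smul, Real.norm_eq_abs, Real.norm_eq_abs, abs_inv,
        Nat.abs_cast] at h
      rw [Real.norm_eq_abs, abs_mul, Nat.abs_cast, abs_abs]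
      rcases Nat.eq_zero_or_pos m with rfl | hm
      · simp; positivity
      · have hm' : (0 : ℝ) < m := by exact_mod_cast hm
        calc (m : ℝ) * |f (z + (m : ℝ)⁻¹ • y) - f z| ≤ m * (K * ((m : ℝ)⁻¹ * ‖y‖)) := by gcongr
          _ = K * ‖y‖ := by field_simp
    · filter_upwards [ae_restrict_of_ae (hf.ae_differentiableAt (μ := volume))] with z hz
      have h := (hz.hasFDerivAt.hasLineDerivAt y).tendsto_slope_zero_right
      have h2 : Tendsto (fun m : ℕ => (m : ℝ)⁻¹) atTop (𝓝[>] 0) :=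
        tendsto_inv_atTop_nhdsGT_zero.comp tendsto_natCast_atTop_atTop
      have h3 := (h.comp h2).abs
      refine h3.congr fun m => ?_
      simp [abs_mul]
  have h1 : ∫ z in B, |fderiv ℝ f z y| ≤ ∫ z in B, ‖y‖ * ‖gradient f z‖ := by
    refine integral_mono_of_nonneg (.of_forall fun z => abs_nonneg _) ?_ (.of_forall fun z => ?_)
    · refine integrableOn_of_bounded hfin
        ((measurable_gradient f).norm.const_mul _).aestronglyMeasurable (C := ‖y‖ * K)
        (.of_forall fun x => ?_)
      rw [abs_of_nonneg (by positivity)]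
      gcongr
      exact norm_gradient_le hf x
    · dsimp only
      rw [norm_gradient, mul_comm]
      exact (fderiv ℝ f z).le_opNorm y
  rw [integral_const_mul] at h1
  refine le_trans (ge_of_tendsto hlim ?_) h1
  filter_upwards [eventually_gt_atTop 0] with m hm
  exact setIntegral_translate_le_mul hf hB hBm hfin y hm

/-! ### Poincaré type inequalities -/

lemma integrableOn_prod_of_bounded {s t : Set (Eucl n)} (hs : volume s ≠ ⊤) (ht : volume t ≠ ⊤)
    (hsm : MeasurableSet s) (htm : MeasurableSet t) {D : Eucl n × Eucl n → ℝ} (hD : Measurable D)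
    {C : ℝ} (hC : ∀ x ∈ s, ∀ y ∈ t, |D (x, y)| ≤ C) :
    Integrable D ((volume.restrict s).prod (volume.restrict t)) := by
  rw [Measure.prod_restrict]
  refine integrableOn_of_bounded ?_ hD.aestronglyMeasurable (C := C) ?_
  · rw [Measure.prod_prod]
    exact ENNReal.mul_ne_top hs ht
  · filter_upwards [ae_restrict_mem (hsm.prod htm)] with z hz
    exact hC z.1 hz.1 z.2 hz.2

lemma setIntegral_le_of_small_support {g : Eucl n → ℝ} {K : ℝ≥0} (hg : LipschitzWith K g)
    (h0 : ∀ x, 0 ≤ g x) {ρ : ℝ} (hρ : 0 < ρ) (hρ1 : ρ ≤ 1)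
    (hA : 2 * volume.real {x | 0 < g x} ≤ volume.real (ball (0 : Eucl n) ρ))
    (hAfin : volume {x | 0 < g x} ≠ ⊤) :
    ∫ x in ball (0 : Eucl n) (1 / 2), g x ≤ 2 * ρ * ∫ x in ball (0 : Eucl n) 2, ‖gradient g x‖ := by
  set I := ∫ x in ball (0 : Eucl n) 2, ‖gradient g x‖ with hI
  have hI0 : 0 ≤ I := integral_nonneg fun _ => norm_nonneg _
  set b := volume.real (ball (0 : Eucl n) ρ) with hb
  have hbpos : 0 < b := ENNReal.toReal_pos (measure_ball_pos volume _ hρ).ne' measure_ball_lt_top.ne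
  have hDc : Continuous fun p : Eucl n × Eucl n => |g (p.1 + p.2) - g p.1| :=
    ((hg.continuous.comp (continuous_fst.add continuous_snd)).sub
      (hg.continuous.comp continuous_fst)).abs
  have hDb : ∀ x ∈ ball (0 : Eucl n) (1 / 2), ∀ y ∈ ball (0 : Eucl n) ρ,
      |(|g (x + y) - g x|)| ≤ K * ρ := fun x _ y hy => by
    have := hg.norm_sub_le (x + y) x
    rw [add_sub_cancel_left, Real.norm_eq_abs] at this
    rw [abs_abs]
    refine this.trans ?_
    gcongr
    exact (mem_ball_zero_iff.1 hy).le
  have hprod := integrableOn_prod_of_bounded (s := ball (0 : Eucl n) (1 / 2))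
    (t := ball (0 : Eucl n) ρ) measure_ball_lt_top.ne measure_ball_lt_top.ne measurableSet_ball
    measurableSet_ball hDc.measurable hDb
  have hswap := integral_integral_swap (f := fun x y => |g (x + y) - g x|) hprod
  have hlow : ∀ x, g x * (b / 2) ≤ ∫ y in ball (0 : Eucl n) ρ, |g (x + y) - g x| := by
    intro x
    set A : Set (Eucl n) := {y | 0 < g (x + y)} with hAdef
    have hAm : MeasurableSet A :=
      (hg.continuous.comp (continuous_const_add x)).measurable measurableSet_Ioi
    have hAeq : volume A = volume {x | 0 < g x} := by
      have := (measurePreserving_add_left volume x).measure_preimage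
        (s := {x | 0 < g x}) (hg.continuous.measurable measurableSet_Ioi).nullMeasurableSet
      exact this
    have hi1 : IntegrableOn (fun y => g x - A.indicator (fun _ => g x) y)
        (ball (0 : Eucl n) ρ) := by
      refine Integrable.sub (integrableOn_const measure_ball_lt_top.ne) ?_
      exact (integrableOn_const (C := g x) measure_ball_lt_top.ne).indicator hAm
    have hi2 : IntegrableOn (fun y => |g (x + y) - g x|) (ball (0 : Eucl n) ρ) := by
      refine integrableOn_of_bounded measure_ball_lt_top.ne
        (hDc.comp (Continuous.prodMk_right x)).aestronglyMeasurable (C := K * ρ) ?_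
      filter_upwards [ae_restrict_mem measurableSet_ball] with y hy
      have := hg.norm_sub_le (x + y) x
      rw [add_sub_cancel_left, Real.norm_eq_abs] at this
      rw [abs_abs]
      refine this.trans ?_
      gcongr
      exact (mem_ball_zero_iff.1 hy).le
    have h1 : ∫ y in ball (0 : Eucl n) ρ, (g x - A.indicator (fun _ => g x) y) ≤
        ∫ y in ball (0 : Eucl n) ρ, |g (x + y) - g x| := by
      refine integral_mono hi1 hi2 fun y => ?_
      dsimp only
      by_cases hy : y ∈ A
      · simp [Set.indicator_of_mem hy]
      · rw [Set.indicator_of_notMem hy]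
        have : g (x + y) = 0 := le_antisymm (not_lt.1 hy) (h0 _)
        rw [this]; simp [abs_of_nonneg (h0 x)]
    refine le_trans ?_ h1
    have hi3 : Integrable (fun _ : Eucl n => g x) (volume.restrict (ball (0 : Eucl n) ρ)) :=
      integrableOn_const measure_ball_lt_top.ne
    rw [integral_sub hi3 (hi3.indicator hAm),
      setIntegral_indicator hAm, setIntegral_const, setIntegral_const, smul_eq_mul, smul_eq_mul,
      ← hb]
    have h2 : volume.real (ball (0 : Eucl n) ρ ∩ A) ≤ volume.real {x | 0 < g x} := by
      rw [measureReal_def, measureReal_def, ← hAeq]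
      exact ENNReal.toReal_mono (hAeq ▸ hAfin) (measure_mono Set.inter_subset_right)
    nlinarith [h0 x]
  have hup : ∀ y ∈ ball (0 : Eucl n) ρ,
      ∫ x in ball (0 : Eucl n) (1 / 2), |g (x + y) - g x| ≤ ρ * I := by
    intro y hy
    have hy' := mem_ball_zero_iff.1 hy
    have h1 := setIntegral_translate_le hg (convex_ball (0 : Eucl n) 2) measurableSet_ball
      measure_ball_lt_top.ne y
    refine le_trans (setIntegral_mono_set ?_ (.of_forall fun x => abs_nonneg _) ?_)
      (h1.trans (mul_le_mul_of_nonneg_right hy'.le hI0))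
    · refine integrableOn_of_bounded
        (measure_ne_top_of_subset Set.inter_subset_left measure_ball_lt_top.ne)
        (hDc.comp (Continuous.prodMk_left y)).aestronglyMeasurable (C := K * ‖y‖)
        (.of_forall fun x => ?_)
      have := hg.norm_sub_le (x + y) x
      rw [add_sub_cancel_left, Real.norm_eq_abs] at this
      rwa [abs_abs]
    · refine LE.le.eventuallyLE fun x (hx : x ∈ ball (0 : Eucl n) (1 / 2)) => ?_
      rw [mem_ball_zero_iff] at hx
      refine ⟨?_, ?_⟩
      · rw [mem_ball_zero_iff]; linarith
      · rw [Set.mem_ofPred_eq, mem_ball_zero_iff]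
        linarith [norm_add_le x y]
  have h1 : (∫ x in ball (0 : Eucl n) (1 / 2), g x) * (b / 2) ≤
      ∫ x in ball (0 : Eucl n) (1 / 2), ∫ y in ball (0 : Eucl n) ρ, |g (x + y) - g x| := by
    rw [← integral_mul_const]
    refine integral_mono_of_nonneg (.of_forall fun x => ?_) hprod.integral_prod_left
      (.of_forall hlow)
    exact mul_nonneg (h0 x) (by positivity)
  have h2 : ∫ y in ball (0 : Eucl n) ρ, ∫ x in ball (0 : Eucl n) (1 / 2), |g (x + y) - g x| ≤
      b * (ρ * I) := by
    rw [hb, ← smul_eq_mul, ← setIntegral_const]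
    refine integral_mono_ae hprod.swap.integral_prod_left
      (integrableOn_const measure_ball_lt_top.ne) ?_
    filter_upwards [ae_restrict_mem measurableSet_ball] with y hy using hup y hy
  rw [hswap] at h1
  have h3 := h1.trans h2
  have : (∫ x in ball (0 : Eucl n) (1 / 2), g x) * (b / 2) ≤ (2 * ρ * I) * (b / 2) := by linarith
  exact le_of_mul_le_mul_right this (by positivity)

/-- De Giorgi's isoperimetric inequality for Lipschitz functions with values in `[0, 1]`. -/
lemma measure_mul_measure_le {f : Eucl n → ℝ} {K : ℝ≥0} (hf : LipschitzWith K f) :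
    volume.real ({x | f x ≤ 0} ∩ ball (0 : Eucl n) (1 / 2)) *
      volume.real ({x | 1 ≤ f x} ∩ ball (0 : Eucl n) (1 / 2)) ≤
    volume.real (ball (0 : Eucl n) 1) * ∫ x in ball (0 : Eucl n) (1 / 2), ‖gradient f x‖ := by
  set B := ball (0 : Eucl n) (1 / 2) with hB
  set B₁ := ball (0 : Eucl n) 1 with hB₁
  have hBm : MeasurableSet B := measurableSet_ball
  have hBf : volume B ≠ ⊤ := measure_ball_lt_top.ne
  have hB1f : volume B₁ ≠ ⊤ := measure_ball_lt_top.ne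
  set I := ∫ x in B, ‖gradient f x‖ with hI
  have hI0 : 0 ≤ I := integral_nonneg fun _ => norm_nonneg _
  set X₀ := {x | f x ≤ 0} ∩ B with hX₀
  set X₁ := {x | 1 ≤ f x} ∩ B with hX₁
  have hX₀m : MeasurableSet X₀ := (hf.continuous.measurable measurableSet_Iic).inter hBm
  have hX₁m : MeasurableSet X₁ := (hf.continuous.measurable measurableSet_Ici).inter hBm
  let D : Eucl n × Eucl n → ℝ := fun p => B.indicator (fun z => |f z - f p.1|) (p.1 + p.2)
  have hDm : Measurable D := by
    have : D = {p : Eucl n × Eucl n | p.1 + p.2 ∈ B}.indicator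
        (fun p => |f (p.1 + p.2) - f p.1|) := by
      ext p; simp [D, Set.indicator]
    rw [this]
    refine Measurable.indicator ?_ ((continuous_fst.add continuous_snd).measurable hBm)
    exact (((hf.continuous.comp (continuous_fst.add continuous_snd)).sub
      (hf.continuous.comp continuous_fst)).abs).measurable
  have hD0 : ∀ p, 0 ≤ D p := fun p => Set.indicator_nonneg (fun _ _ => abs_nonneg _) _
  have hDb : ∀ x ∈ B, ∀ y ∈ B₁, |D (x, y)| ≤ K * 1 := fun x _ y hy => by
    rw [abs_of_nonneg (hD0 _)]
    by_cases h : x + y ∈ B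
    · have := hf.norm_sub_le (x + y) x
      rw [add_sub_cancel_left, Real.norm_eq_abs] at this
      simp only [D, Set.indicator_of_mem h]
      refine this.trans ?_
      gcongr
      exact (mem_ball_zero_iff.1 hy).le
    · simp [D, Set.indicator_of_notMem h]
  have hprod := integrableOn_prod_of_bounded hBf hB1f hBm measurableSet_ball hDm hDb
  have hswap := integral_integral_swap (f := fun x y => D (x, y)) hprod
  have hup : ∀ y ∈ B₁, ∫ x in B, D (x, y) ≤ I := by
    intro y hy
    have hy' := (mem_ball_zero_iff.1 hy).le
    have h1 : ∫ x in B, D (x, y) = ∫ x in B ∩ {x | x + y ∈ B}, |f (x + y) - f x| := by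
      have hm : MeasurableSet {x | x + y ∈ B} := (continuous_add_const y).measurable hBm
      rw [← setIntegral_indicator hm]
      rfl
    rw [h1]
    refine (setIntegral_translate_le hf (convex_ball _ _) hBm hBf y).trans ?_
    exact mul_le_of_le_one_left hI0 hy'
  have hlow : ∀ x, X₀.indicator (fun _ => volume.real X₁) x ≤ ∫ y in B₁, D (x, y) := by
    intro x
    by_cases hx : x ∈ X₀
    swap
    · rw [Set.indicator_of_notMem hx]
      exact integral_nonneg fun y => hD0 _
    rw [Set.indicator_of_mem hx]
    have hpm : MeasurableSet ((fun y => x + y) ⁻¹' X₁) := (continuous_const_add x).measurable hX₁m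
    have hpre : volume.real X₁ =
        ∫ y in B₁, ((fun y => x + y) ⁻¹' X₁).indicator (fun _ => (1 : ℝ)) y := by
      rw [setIntegral_indicator hpm, setIntegral_const, smul_eq_mul, mul_one, measureReal_def,
        measureReal_def, ← (measurePreserving_add_left volume x).measure_preimage
          hX₁m.nullMeasurableSet]
      congr 2
      refine (Set.inter_eq_right.2 fun y hy => ?_).symm
      have h1 := mem_ball_zero_iff.1 hx.2
      have h2 := mem_ball_zero_iff.1 (show x + y ∈ B from hy.2)
      rw [mem_ball_zero_iff]
      have := norm_sub_le (x + y) x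
      rw [add_sub_cancel_left] at this
      linarith
    rw [hpre]
    have hi : Integrable (fun _ : Eucl n => (1 : ℝ)) (volume.restrict B₁) :=
      integrableOn_const hB1f
    have hDi : Integrable (fun y => D (x, y)) (volume.restrict B₁) := by
      refine integrableOn_of_bounded hB1f (hDm.comp measurable_prodMk_left).aestronglyMeasurable
        (C := K * 1) ?_
      filter_upwards [ae_restrict_mem measurableSet_ball] with y hy using hDb x hx.2 y hy
    refine integral_mono (hi.indicator hpm) hDi fun y => ?_
    dsimp only
    by_cases hy : y ∈ (fun y => x + y) ⁻¹' X₁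
    · rw [Set.indicator_of_mem hy]
      have hB' : x + y ∈ B := hy.2
      simp only [D, Set.indicator_of_mem hB']
      have h1 : 1 ≤ f (x + y) := hy.1
      have h2 : f x ≤ 0 := hx.1
      exact le_trans (by linarith) (le_abs_self _)
    · rw [Set.indicator_of_notMem hy]
      exact hD0 _
  have h1 : volume.real X₀ * volume.real X₁ ≤ ∫ x in B, ∫ y in B₁, D (x, y) := by
    have hi : Integrable (fun _ : Eucl n => volume.real X₁) (volume.restrict B) :=
      integrableOn_const hBf
    have h2 : ∫ x in B, X₀.indicator (fun _ => volume.real X₁) x =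
        volume.real X₀ * volume.real X₁ := by
      rw [setIntegral_indicator hX₀m, setIntegral_const, smul_eq_mul,
        Set.inter_eq_right.2 Set.inter_subset_right]
    rw [← h2]
    exact integral_mono (hi.indicator hX₀m) hprod.integral_prod_left hlow
  refine h1.trans ?_
  rw [hswap, ← smul_eq_mul, ← setIntegral_const]
  refine integral_mono_ae hprod.swap.integral_prod_left (integrableOn_const hB1f) ?_
  filter_upwards [ae_restrict_mem measurableSet_ball] with y hy using hup y hy

/-! ### De Giorgi's lemma -/

/-- Radial Lipschitz cutoff, equal to `1` on `ball 0 ρ` and to `0` off `ball 0 (ρ + d)`. -/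
def cutoff (ρ d : ℝ) (x : Eucl n) : ℝ := max 0 (min 1 ((ρ + d - ‖x‖) / d))

lemma cutoff_nonneg (ρ d : ℝ) (x : Eucl n) : 0 ≤ cutoff ρ d x := le_max_left _ _

lemma cutoff_le_one (ρ d : ℝ) (x : Eucl n) : cutoff ρ d x ≤ 1 :=
  max_le zero_le_one (min_le_left _ _)

lemma cutoff_eq_one {ρ d : ℝ} (hd : 0 < d) {x : Eucl n} (hx : ‖x‖ ≤ ρ) : cutoff ρ d x = 1 := by
  have : 1 ≤ (ρ + d - ‖x‖) / d := by rw [le_div_iff₀ hd]; linarith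
  simp [cutoff, min_eq_left this]

lemma cutoff_eq_zero {ρ d : ℝ} (hd : 0 < d) {x : Eucl n} (hx : ρ + d ≤ ‖x‖) :
    cutoff ρ d x = 0 := by
  have : (ρ + d - ‖x‖) / d ≤ 0 := div_nonpos_of_nonpos_of_nonneg (by linarith) hd.le
  exact max_eq_left ((min_le_right _ _).trans this)

lemma lipschitzWith_cutoff (ρ : ℝ) {d : ℝ} (hd : 0 < d) :
    LipschitzWith ⟨d⁻¹, (inv_pos.2 hd).le⟩ (cutoff ρ d : Eucl n → ℝ) := by
  have h1 : LipschitzWith ⟨d⁻¹, (inv_pos.2 hd).le⟩ fun x : Eucl n => (ρ + d - ‖x‖) / d := by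
    refine LipschitzWith.of_dist_le_mul fun x y => ?_
    rw [Real.dist_eq, ← sub_div, abs_div, abs_of_pos hd, div_eq_inv_mul]
    change _ ≤ d⁻¹ * _
    gcongr
    rw [dist_comm, dist_eq_norm]
    calc |ρ + d - ‖x‖ - (ρ + d - ‖y‖)| = |‖y‖ - ‖x‖| := by ring_nf
      _ ≤ ‖y - x‖ := abs_norm_sub_norm_le _ _
  exact (h1.const_min 1).const_max 0

/-- Truncation `(v - κ)₊`. -/
def trunc (v : Eucl n → ℝ) (κ : ℝ) (x : Eucl n) : ℝ := max (v x - κ) 0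

lemma trunc_nonneg (v : Eucl n → ℝ) (κ : ℝ) (x : Eucl n) : 0 ≤ trunc v κ x := le_max_right _ _

lemma trunc_eq_zero {v : Eucl n → ℝ} {κ : ℝ} {x : Eucl n} (h : v x ≤ κ) : trunc v κ x = 0 :=
  max_eq_right (by linarith)

lemma LipschitzWith.trunc {v : Eucl n → ℝ} {K : ℝ≥0} (hv : LipschitzWith K v) (κ : ℝ) :
    LipschitzWith K (trunc v κ) := by
  have : LipschitzWith K fun x => v x - κ := by
    refine LipschitzWith.of_dist_le_mul fun x y => ?_
    rw [dist_sub_right]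
    exact hv.dist_le_mul x y
  exact this.max_const 0

/-- Caccioppoli inequality for the truncation at level `κ` of a function bounded by `1`. -/
def CaccLevel (v : Eucl n → ℝ) (Q κ : ℝ) : Prop :=
  ∀ ρ d : ℝ, 0 < ρ → 0 < d → ρ + d ≤ 1 →
    ∫ x in ball (0 : Eucl n) ρ, ‖gradient (trunc v κ) x‖ ^ 2 ≤
      Q * ((1 - κ) / d) ^ 2 * volume.real ({x | κ < v x} ∩ ball (0 : Eucl n) (ρ + d))

lemma measurableSet_superlevel {v : Eucl n → ℝ} (hv : Continuous v) (κ ρ : ℝ) :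
    MeasurableSet ({x | κ < v x} ∩ ball (0 : Eucl n) ρ) :=
  (hv.measurable measurableSet_Ioi).inter measurableSet_ball

lemma integrableOn_norm_gradient {f : Eucl n → ℝ} {K : ℝ≥0} (hf : LipschitzWith K f)
    {s : Set (Eucl n)} (hs : volume s ≠ ⊤) : IntegrableOn (fun x => ‖gradient f x‖) s :=
  integrableOn_of_bounded hs (measurable_gradient f).norm.aestronglyMeasurable (C := K)
    (.of_forall fun x => by rw [abs_norm]; exact norm_gradient_le hf x)

lemma integrableOn_norm_gradient_sq {f : Eucl n → ℝ} {K : ℝ≥0} (hf : LipschitzWith K f)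
    {s : Set (Eucl n)} (hs : volume s ≠ ⊤) : IntegrableOn (fun x => ‖gradient f x‖ ^ 2) s :=
  integrableOn_of_bounded hs ((measurable_gradient f).norm.pow_const 2).aestronglyMeasurable
    (C := (K : ℝ) ^ 2) (.of_forall fun x => by
      rw [abs_of_nonneg (by positivity)]
      gcongr
      exact norm_gradient_le hf x)

/-- An `L¹` gradient bound from an `L²` one on a small set. -/
lemma setIntegral_norm_gradient_le {f : Eucl n → ℝ} {K : ℝ≥0} (hf : LipschitzWith K f)
    {s t : Set (Eucl n)} (hst : s ⊆ t) (ht : volume t ≠ ⊤) {τ : ℝ} (hτ : 0 < τ) :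
    ∫ x in s, ‖gradient f x‖ ≤
      τ * volume.real s + τ⁻¹ * ∫ x in t, ‖gradient f x‖ ^ 2 := by
  have hs : volume s ≠ ⊤ := measure_ne_top_of_subset hst ht
  have hsq := integrableOn_norm_gradient_sq hf hs
  have hc : IntegrableOn (fun _ : Eucl n => τ) s := integrableOn_const hs
  calc ∫ x in s, ‖gradient f x‖ ≤ ∫ x in s, (τ + τ⁻¹ * ‖gradient f x‖ ^ 2) := by
        refine integral_mono (integrableOn_norm_gradient hf hs) (hc.add (hsq.const_mul _))
          fun x => ?_
        have h1 : τ * τ⁻¹ = 1 := mul_inv_cancel₀ hτ.ne'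
        have h2 := inv_pos.2 hτ
        dsimp only
        nlinarith [mul_nonneg h2.le (sq_nonneg (‖gradient f x‖ - τ)),
          norm_nonneg (gradient f x), mul_comm τ τ⁻¹]
    _ = τ * volume.real s + τ⁻¹ * ∫ x in s, ‖gradient f x‖ ^ 2 := by
        rw [integral_add hc (hsq.const_mul _), setIntegral_const, integral_const_mul, smul_eq_mul,
          mul_comm (volume.real s)]
    _ ≤ _ := by
        refine add_le_add le_rfl (mul_le_mul_of_nonneg_left ?_ (inv_pos.2 hτ).le)
        refine setIntegral_mono_set (integrableOn_norm_gradient_sq hf ht)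
          (.of_forall fun x => by positivity) (LE.le.eventuallyLE hst)

lemma deGiorgi_step {v : Eucl n → ℝ} {K : ℝ≥0} (hv : LipschitzWith K v)
    (hv1 : ∀ x ∈ ball (0 : Eucl n) 1, v x ≤ 1) {Q κ κ' : ℝ} (hκ1 : κ < 1)
    (hcac : CaccLevel v Q κ) {r d ρ : ℝ} (hr : 0 < r) (hd : 0 < d)
    (hle : r + 2 * d ≤ 1 / 2) (hρ : 0 < ρ) (hρ1 : ρ ≤ 1)
    (hA : 2 * volume.real ({x | κ < v x} ∩ ball (0 : Eucl n) (r + 2 * d)) ≤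
      volume.real (ball (0 : Eucl n) ρ)) :
    (κ' - κ) * volume.real ({x | κ' < v x} ∩ ball (0 : Eucl n) r) ≤
      2 * ρ * ((Q + 2) * ((1 - κ) / d) *
        volume.real ({x | κ < v x} ∩ ball (0 : Eucl n) (r + 2 * d))) := by
  have hbf : ∀ s : ℝ, volume (ball (0 : Eucl n) s) ≠ ⊤ := fun s => measure_ball_lt_top.ne
  set η : Eucl n → ℝ := cutoff r d with hη
  set f : Eucl n → ℝ := trunc v κ with hf
  have hfL : LipschitzWith K f := LipschitzWith.trunc hv κ
  have hηL := lipschitzWith_cutoff (n := n) r hd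
  set H := (1 - κ) with hH
  have hH0 : 0 < H := by rw [hH]; linarith
  set τ := H / d with hτ
  have hτ0 : 0 < τ := div_pos hH0 hd
  set g : Eucl n → ℝ := fun x => η x * f x with hg
  set A := {x | κ < v x} ∩ ball (0 : Eucl n) (r + d) with hAd
  set A' := {x | κ < v x} ∩ ball (0 : Eucl n) (r + 2 * d) with hAd'
  have hAA' : A ⊆ A' := Set.inter_subset_inter_right _ (ball_subset_ball (by linarith))
  have hA'f : volume A' ≠ ⊤ := measure_ne_top_of_subset Set.inter_subset_right (hbf _)
  have hAm : MeasurableSet A := measurableSet_superlevel hv.continuous _ _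
  have hAr : volume.real A ≤ volume.real A' := measureReal_mono hAA' hA'f
  have hg0 : ∀ x, 0 ≤ g x := fun x => mul_nonneg (cutoff_nonneg _ _ _) (trunc_nonneg _ _ _)
  have hfH : ∀ x ∈ ball (0 : Eucl n) (r + d), f x ≤ H := fun x hx =>
    max_le (by linarith [hv1 x (ball_subset_ball (by linarith) hx)]) hH0.le
  have hgz : ∀ x, x ∉ A → g x = 0 := by
    intro x hx
    by_cases h : κ < v x
    · have : x ∉ ball (0 : Eucl n) (r + d) := fun h' => hx ⟨h, h'⟩
      rw [mem_ball_zero_iff, not_lt] at this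
      simp [hg, hη, cutoff_eq_zero hd this]
    · simp [hg, hf, trunc_eq_zero (not_lt.1 h)]
  -- `g` is globally Lipschitz
  obtain ⟨Kg, hgL⟩ : ∃ Kg, LipschitzWith Kg g := by
    have hmin : g = fun x => η x * min (f x) H := by
      ext x
      by_cases hx : x ∈ ball (0 : Eucl n) (r + d)
      · simp [hg, min_eq_left (hfH x hx)]
      · rw [mem_ball_zero_iff, not_lt] at hx
        simp [hg, hη, cutoff_eq_zero hd hx]
    have h2 : LipschitzWith K fun x => min (f x) H := hfL.min_const H
    refine ⟨⟨d⁻¹, (inv_pos.2 hd).le⟩ * ⟨H, hH0.le⟩ + K, LipschitzWith.of_dist_le_mul fun x y => ?_⟩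
    have e1 := hηL.dist_le_mul x y
    have e2 := h2.dist_le_mul x y
    rw [hmin, Real.dist_eq]
    rw [Real.dist_eq] at e1 e2
    change _ ≤ d⁻¹ * _ at e1
    change _ ≤ (d⁻¹ * H + K) * _
    calc |η x * min (f x) H - η y * min (f y) H|
        = |(η x - η y) * min (f x) H + η y * (min (f x) H - min (f y) H)| := by ring_nf
      _ ≤ |η x - η y| * |min (f x) H| + |η y| * |min (f x) H - min (f y) H| := by
          rw [← abs_mul, ← abs_mul]; exact abs_add_le _ _
      _ ≤ (d⁻¹ * dist x y) * H + 1 * (K * dist x y) := by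
          have : |min (f x) H| ≤ H := by
            rw [abs_of_nonneg (le_min (trunc_nonneg _ _ _) hH0.le)]; exact min_le_right _ _
          have h3 : |η y| ≤ 1 := by
            rw [abs_of_nonneg (cutoff_nonneg _ _ _)]; exact cutoff_le_one _ _ _
          gcongr
      _ = _ := by ring
  have hsupp : {x | 0 < g x} ⊆ A := fun x (hx : 0 < g x) => by
    by_contra h
    exact hx.ne' (hgz x h)
  have hfin : volume {x | 0 < g x} ≠ ⊤ := measure_ne_top_of_subset (hsupp.trans hAA') hA'f
  have hmeas : 2 * volume.real {x | 0 < g x} ≤ volume.real (ball (0 : Eucl n) ρ) := by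
    have := measureReal_mono (hsupp.trans hAA') hA'f
    linarith
  have hmain := setIntegral_le_of_small_support hgL hg0 hρ hρ1 hmeas hfin
  have hgrad : ∀ᵐ x, ‖gradient g x‖ ≤
      A.indicator (fun x => ‖gradient f x‖ + τ) x := by
    filter_upwards [hfL.ae_differentiableAt, hηL.ae_differentiableAt] with x h1 h2
    by_cases hx : x ∈ A
    · rw [Set.indicator_of_mem hx, gradient_mul h2 h1]
      have e1 := norm_gradient_le hηL x
      change _ ≤ d⁻¹ at e1
      refine (norm_add_le _ _).trans (add_le_add ?_ ?_)
      · rw [norm_smul, Real.norm_eq_abs, abs_of_nonneg (cutoff_nonneg _ _ _)]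
        exact mul_le_of_le_one_left (norm_nonneg _) (cutoff_le_one _ _ _)
      · rw [norm_smul, Real.norm_eq_abs, abs_of_nonneg (trunc_nonneg _ _ _), hτ, div_eq_mul_inv]
        exact mul_le_mul (hfH x hx.2) e1 (norm_nonneg _) hH0.le
    · rw [Set.indicator_of_notMem hx, gradient_eq_zero_of_nonneg hg0 (hgz x hx), norm_zero]
  have hAf : volume A ≠ ⊤ := measure_ne_top_of_subset hAA' hA'f
  have hτi : IntegrableOn (fun _ : Eucl n => τ) A := integrableOn_const hAf
  have hgi := integrableOn_norm_gradient hfL hAf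
  have hI : ∫ x in ball (0 : Eucl n) 2, ‖gradient g x‖ ≤
      (∫ x in A, ‖gradient f x‖) + τ * volume.real A := by
    calc _ ≤ ∫ x in ball (0 : Eucl n) 2, A.indicator (fun x => ‖gradient f x‖ + τ) x := by
          refine integral_mono_ae (integrableOn_norm_gradient hgL (hbf _))
            ?_ (ae_restrict_of_ae hgrad)
          exact ((integrable_indicator_iff hAm).2 (hgi.add hτi)).integrableOn
      _ = ∫ x in A, (‖gradient f x‖ + τ) := by
          rw [setIntegral_indicator hAm, Set.inter_eq_right.2
            (Set.inter_subset_right.trans (ball_subset_ball (by linarith)))]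
      _ = _ := by
          rw [integral_add hgi hτi, setIntegral_const, smul_eq_mul, mul_comm (volume.real A)]
  have hI2 := setIntegral_norm_gradient_le hfL (Set.inter_subset_right : A ⊆ _) (hbf _) hτ0
  have hcac' := hcac (r + d) d (by linarith) hd (by linarith)
  rw [show r + d + d = r + 2 * d by ring] at hcac'
  change _ ≤ Q * τ ^ 2 * volume.real A' at hcac'
  have hI3 : τ⁻¹ * ∫ x in ball (0 : Eucl n) (r + d), ‖gradient f x‖ ^ 2 ≤
      Q * τ * volume.real A' := by
    calc _ ≤ τ⁻¹ * (Q * τ ^ 2 * volume.real A') := by gcongr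
      _ = _ := by field_simp
  have hI4 : ∫ x in ball (0 : Eucl n) 2, ‖gradient g x‖ ≤ (Q + 2) * τ * volume.real A' := by
    have : τ * volume.real A ≤ τ * volume.real A' := by gcongr
    linarith
  have hlow : (κ' - κ) * volume.real ({x | κ' < v x} ∩ ball (0 : Eucl n) r) ≤
      ∫ x in ball (0 : Eucl n) (1 / 2), g x := by
    set S := {x | κ' < v x} ∩ ball (0 : Eucl n) r with hS
    have hSm : MeasurableSet S := measurableSet_superlevel hv.continuous _ _
    have hSb : S ⊆ ball (0 : Eucl n) (1 / 2) :=
      Set.inter_subset_right.trans (ball_subset_ball (by linarith))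
    have hSf : volume S ≠ ⊤ := measure_ne_top_of_subset hSb (hbf _)
    have hgint : IntegrableOn g (ball (0 : Eucl n) (1 / 2)) := by
      refine integrableOn_of_bounded (hbf _) hgL.continuous.aestronglyMeasurable (C := H)
        (.of_forall fun x => ?_)
      rw [abs_of_nonneg (hg0 x)]
      by_cases hx : x ∈ A
      · exact (mul_le_of_le_one_left (trunc_nonneg _ _ _) (cutoff_le_one _ _ _)).trans
          (hfH x hx.2)
      · rw [hgz x hx]; exact hH0.le
    calc _ = ∫ _ in S, (κ' - κ) := by rw [setIntegral_const, smul_eq_mul, mul_comm]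
      _ ≤ ∫ x in S, g x := by
          refine setIntegral_mono_on (integrableOn_const hSf) (hgint.mono_set hSb) hSm
            fun x hx => ?_
          have h1 : η x = 1 := cutoff_eq_one hd (mem_ball_zero_iff.1 hx.2).le
          have h2 : κ' < v x := hx.1
          simp only [hg, h1, one_mul]
          exact le_max_of_le_left (by linarith)
      _ ≤ _ := setIntegral_mono_set hgint (.of_forall hg0) (LE.le.eventuallyLE hSb)
  refine hlow.trans (hmain.trans ?_)
  gcongr

lemma volume_real_ball (r : ℝ) (hr : 0 < r) :
    volume.real (ball (0 : Eucl n) r) = r ^ (n + 1) * volume.real (ball (0 : Eucl n) 1) := by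
  have := Measure.addHaar_ball_of_pos (volume : Measure (Eucl n)) 0 hr
  rw [measureReal_def, this, ENNReal.toReal_mul, ENNReal.toReal_ofReal (by positivity)]
  simp [measureReal_def]

lemma volume_real_ball_pos {r : ℝ} (hr : 0 < r) : 0 < volume.real (ball (0 : Eucl n) r) :=
  ENNReal.toReal_pos (measure_ball_pos volume _ hr).ne' measure_ball_lt_top.ne

/-- If the superlevel set is small in measure, the function is bounded away from `1`. -/
theorem deGiorgi_small_measure (n : ℕ) {Q : ℝ} (hQ : 0 ≤ Q) : ∃ ν : ℝ, 0 < ν ∧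
    ∀ (v : Eucl n → ℝ) (K : ℝ≥0) (κ : ℝ), LipschitzWith K v → κ < 1 →
      (∀ x ∈ ball (0 : Eucl n) 1, v x ≤ 1) →
      (∀ κ', κ ≤ κ' → κ' ≤ (1 + κ) / 2 → CaccLevel v Q κ') →
      volume.real ({x | κ < v x} ∩ ball (0 : Eucl n) (1 / 2)) ≤ ν →
      ∀ x ∈ ball (0 : Eucl n) (1 / 4), v x ≤ (1 + κ) / 2 := by
  set q : ℝ := (1 / 4) ^ (n + 1) with hq
  have hq0 : 0 < q := by positivity
  have hq1 : q < 1 := pow_lt_one₀ (by norm_num) (by norm_num) (by omega)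
  set C : ℝ := 128 * (Q + 2) with hC
  have hC1 : 1 ≤ C := by rw [hC]; linarith
  set θ := q / C with hθ
  have hθ0 : 0 < θ := by positivity
  have hθ1 : θ ≤ 1 := by rw [hθ, div_le_one (by linarith)]; linarith
  set b := volume.real (ball (0 : Eucl n) 1) with hb
  have hb0 : 0 < b := volume_real_ball_pos one_pos
  refine ⟨θ ^ (n + 1) * b / 2, by positivity, fun v K κ hv hκ hv1 hcac hsmall x hx => ?_⟩
  set ν := θ ^ (n + 1) * b / 2 with hν
  set H := 1 - κ with hH
  have hH0 : 0 < H := by rw [hH]; linarith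
  let s : ℕ → ℝ := fun j => (1 / 2 : ℝ) ^ j
  have hs0 : ∀ j, 0 < s j := fun j => by positivity
  have hs1 : ∀ j, s j ≤ 1 := fun j => pow_le_one₀ (by norm_num) (by norm_num)
  have hss : ∀ j, s (j + 1) = s j / 2 := fun j => by simp only [s, pow_succ]; ring
  let k : ℕ → ℝ := fun j => κ + H * (1 - s j) / 2
  let a : ℕ → ℝ := fun j =>
    volume.real ({x | k j < v x} ∩ ball (0 : Eucl n) (1 / 4 + s j / 4))
  have ha : ∀ j, a j ≤ ν * q ^ j := by
    intro j
    induction j with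
    | zero =>
      simp only [a, k, s, pow_zero, mul_one, sub_self, mul_zero, zero_div, add_zero]
      norm_num at hsmall ⊢
      exact hsmall
    | succ j ih =>
      have hk : k j < 1 := by
        simp only [k]; nlinarith [mul_pos hH0 (hs0 j)]
      have hkk : k j ≤ (1 + κ) / 2 := by
        simp only [k]; nlinarith [mul_pos hH0 (hs0 j)]
      have hkκ : κ ≤ k j := by
        simp only [k]; nlinarith [mul_nonneg hH0.le (sub_nonneg.2 (hs1 j))]
      have hρ : 0 < θ * s j ^ 2 := by have := hs0 j; positivity
      have hA : 2 * a j ≤ volume.real (ball (0 : Eucl n) (θ * s j ^ 2)) := by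
        rw [volume_real_ball _ hρ, ← hb]
        have : (θ * s j ^ 2) ^ (n + 1) = θ ^ (n + 1) * q ^ j := by
          simp only [s, hq]
          rw [mul_pow, ← pow_mul, ← pow_mul, ← pow_mul, show (1 / 4 : ℝ) = (1 / 2) ^ 2 by norm_num,
            ← pow_mul]
          ring_nf
        rw [this]
        calc 2 * a j ≤ 2 * (ν * q ^ j) := by gcongr
          _ = _ := by rw [hν]; ring
      have hstep := deGiorgi_step hv hv1 (κ' := k (j + 1)) hk (hcac _ hkκ hkk)
        (r := 1 / 4 + s (j + 1) / 4) (d := s j / 16) (ρ := θ * s j ^ 2) (Q := Q)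
        (by linarith [hs0 (j + 1)]) (by linarith [hs0 j])
        (by rw [hss]; linarith [hs1 j]) hρ
        (mul_le_one₀ hθ1 (by positivity) (pow_le_one₀ (hs0 j).le (hs1 j)))
        (by
          rw [show 1 / 4 + s (j + 1) / 4 + 2 * (s j / 16) = 1 / 4 + s j / 4 by rw [hss]; ring]
          exact hA)
      rw [show 1 / 4 + s (j + 1) / 4 + 2 * (s j / 16) = 1 / 4 + s j / 4 by rw [hss]; ring] at hstep
      change (k (j + 1) - k j) * a (j + 1) ≤ 2 * (θ * s j ^ 2) *
        ((Q + 2) * ((1 - k j) / (s j / 16)) * a j) at hstep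
      have ha0 : 0 ≤ a j := measureReal_nonneg
      have hkd : k (j + 1) - k j = H * s j / 4 := by simp only [k, hss]; ring
      have h1k : 1 - k j ≤ H := by linarith
      have hsj := hs0 j
      have h2 : H * s j / 4 * a (j + 1) ≤ H * s j / 4 * (q * a j) := by
        rw [← hkd]
        refine hstep.trans ?_
        calc _ ≤ 2 * (θ * s j ^ 2) * ((Q + 2) * (H / (s j / 16)) * a j) := by gcongr
          _ = H * s j / 4 * ((C * θ) * a j) := by rw [hC]; field_simp; ring
          _ = H * s j / 4 * (q * a j) := by
            rw [hθ, mul_div_cancel₀ q (by linarith : C ≠ 0)]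
          _ = _ := by rw [hkd]
      have h3 : a (j + 1) ≤ q * a j := le_of_mul_le_mul_left h2 (by positivity)
      calc a (j + 1) ≤ q * (ν * q ^ j) := h3.trans (by gcongr)
        _ = _ := by ring
  by_contra hcon
  rw [not_le] at hcon
  set O := {x | (1 + κ) / 2 < v x} ∩ ball (0 : Eucl n) (1 / 4) with hO
  have hOo : IsOpen O := (isOpen_lt continuous_const hv.continuous).inter isOpen_ball
  have hOf : volume O ≠ ⊤ :=
    measure_ne_top_of_subset Set.inter_subset_right measure_ball_lt_top.ne
  have hOpos : 0 < volume.real O :=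
    ENNReal.toReal_pos (hOo.measure_pos volume ⟨x, hcon, hx⟩).ne' hOf
  have hle : ∀ j, volume.real O ≤ ν * q ^ j := fun j => by
    refine le_trans (measureReal_mono ?_ (measure_ne_top_of_subset Set.inter_subset_right
      measure_ball_lt_top.ne)) (ha j)
    refine Set.inter_subset_inter (fun y (hy : (1 + κ) / 2 < v y) => ?_)
      (ball_subset_ball (by linarith [hs0 j]))
    have : k j ≤ (1 + κ) / 2 := by simp only [k]; nlinarith [mul_pos hH0 (hs0 j)]
    exact this.trans_lt hy
  have hlim : Tendsto (fun j => ν * q ^ j) atTop (𝓝 (ν * 0)) :=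
    (tendsto_pow_atTop_nhds_zero_of_lt_one hq0.le hq1).const_mul ν
  have := ge_of_tendsto' hlim hle
  linarith

lemma deGiorgi_level {v : Eucl n → ℝ} {K : ℝ≥0} (hv : LipschitzWith K v) {Q s τ : ℝ} (hQ : 0 ≤ Q)
    (hs : 0 < s) (hτ : 0 < τ) (hcac : CaccLevel v Q (1 - s)) :
    volume.real ({x | v x ≤ 1 - s} ∩ ball (0 : Eucl n) (1 / 2)) *
      volume.real ({x | 1 - s / 2 < v x} ∩ ball (0 : Eucl n) (1 / 2)) ≤
    volume.real (ball (0 : Eucl n) 1) * (2 * τ *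
      volume.real ({x | 1 - s < v x ∧ v x < 1 - s / 2} ∩ ball (0 : Eucl n) (1 / 2)) +
        8 * Q * volume.real (ball (0 : Eucl n) 1) / τ) := by
  have hbf : ∀ r : ℝ, volume (ball (0 : Eucl n) r) ≠ ⊤ := fun s => measure_ball_lt_top.ne
  set B := ball (0 : Eucl n) (1 / 2) with hB
  set b := volume.real (ball (0 : Eucl n) 1) with hb
  set g := trunc v (1 - s) with hg
  have hgL : LipschitzWith K g := LipschitzWith.trunc hv _
  set f : Eucl n → ℝ := fun x => min (2 / s * g x) 1 with hf
  have hfL : LipschitzWith (⟨2 / s, by positivity⟩ * K) f := by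
    refine LipschitzWith.min_const (LipschitzWith.of_dist_le_mul fun x y => ?_) 1
    have := hgL.dist_le_mul x y
    rw [Real.dist_eq] at this ⊢
    change _ ≤ 2 / s * K * _
    rw [← mul_sub, abs_mul, abs_of_pos (by positivity : 0 < 2 / s), mul_assoc]
    gcongr
  set D := {x | 1 - s < v x ∧ v x < 1 - s / 2} ∩ B with hD
  have hDm : MeasurableSet D :=
    ((hv.continuous.measurable measurableSet_Ioi).inter
      (hv.continuous.measurable measurableSet_Iio)).inter measurableSet_ball
  have hDf : volume D ≠ ⊤ := measure_ne_top_of_subset Set.inter_subset_right (hbf _)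
  have h1 := measure_mul_measure_le hfL
  have hX0 : {x | v x ≤ 1 - s} ∩ B ⊆ {x | f x ≤ 0} ∩ B :=
    Set.inter_subset_inter_left _ fun x (hx : v x ≤ 1 - s) => by
      change min (2 / s * g x) 1 ≤ 0
      rw [hg, trunc_eq_zero hx]; simp
  have hX1 : {x | 1 - s / 2 < v x} ∩ B ⊆ {x | 1 ≤ f x} ∩ B :=
    Set.inter_subset_inter_left _ fun x (hx : 1 - s / 2 < v x) => by
      change 1 ≤ min (2 / s * g x) 1
      refine le_min ?_ le_rfl
      have : s / 2 ≤ g x := le_max_of_le_left (by linarith)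
      calc (1 : ℝ) = 2 / s * (s / 2) := by field_simp
        _ ≤ _ := by gcongr
  have hgrad : ∀ x ∈ B, ‖gradient f x‖ ≤ D.indicator (fun x => 2 / s * ‖gradient g x‖) x := by
    intro x hx
    by_cases hxD : x ∈ D
    · rw [Set.indicator_of_mem hxD]
      have h2 : f =ᶠ[𝓝 x] fun y => 2 / s * g y := by
        have : ∀ᶠ y in 𝓝 x, v y < 1 - s / 2 :=
          hv.continuous.continuousAt.eventually_lt continuousAt_const hxD.1.2
        filter_upwards [this] with y hy
        refine min_eq_left ?_
        have : g y ≤ s / 2 := max_le (by linarith) (by linarith)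
        calc 2 / s * g y ≤ 2 / s * (s / 2) := by gcongr
          _ = 1 := by field_simp
      have h3 : gradient f x = (2 / s) • gradient g x := by
        rw [← gradient_const_mul]
        simp only [gradient, h2.fderiv_eq]
      rw [h3, norm_smul, Real.norm_eq_abs, abs_of_pos (by positivity)]
    · rw [Set.indicator_of_notMem hxD]
      have hf0 : ∀ y, 0 ≤ f y := fun y =>
        le_min (mul_nonneg (by positivity) (trunc_nonneg _ _ _)) zero_le_one
      by_cases h : v x ≤ 1 - s
      · rw [gradient_eq_zero_of_nonneg hf0, norm_zero]
        simp [hf, hg, trunc_eq_zero h]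
      · have h4 : 1 - s / 2 ≤ v x := by
          by_contra h5
          exact hxD ⟨⟨not_le.1 h, not_le.1 h5⟩, hx⟩
        have h5 : f x = 1 := by
          refine min_eq_right ?_
          have : s / 2 ≤ g x := le_max_of_le_left (by linarith)
          calc (1 : ℝ) = 2 / s * (s / 2) := by field_simp
            _ ≤ _ := by gcongr
        rw [gradient_eq_zero_of_isLocalMax, norm_zero]
        exact .of_forall fun y => by rw [h5]; exact min_le_right _ _
  have hgi := integrableOn_norm_gradient hgL hDf
  have h2 : ∫ x in B, ‖gradient f x‖ ≤ 2 / s * ∫ x in D, ‖gradient g x‖ := by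
    calc _ ≤ ∫ x in B, D.indicator (fun x => 2 / s * ‖gradient g x‖) x := by
          refine integral_mono_ae (integrableOn_norm_gradient hfL (hbf _)) ?_ ?_
          · exact ((integrable_indicator_iff hDm).2 (hgi.const_mul _)).integrableOn
          · filter_upwards [ae_restrict_mem measurableSet_ball] with x hx using hgrad x hx
      _ = _ := by
          rw [setIntegral_indicator hDm, Set.inter_eq_right.2 Set.inter_subset_right,
            integral_const_mul]
  have hτs : 0 < s * τ := by positivity
  have h3 := setIntegral_norm_gradient_le hgL (Set.inter_subset_right : D ⊆ B) (hbf _) hτs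
  have h4 := hcac (1 / 2) (1 / 2) (by norm_num) (by norm_num) (by norm_num)
  have h5 : volume.real ({x | 1 - s < v x} ∩ ball (0 : Eucl n) (1 / 2 + 1 / 2)) ≤ b := by
    rw [hb]
    refine measureReal_mono ?_ (hbf _)
    norm_num
  have h6 : ∫ x in B, ‖gradient g x‖ ^ 2 ≤ 4 * Q * s ^ 2 * b := by
    refine h4.trans ?_
    calc _ ≤ Q * ((1 - (1 - s)) / (1 / 2)) ^ 2 * b := by gcongr
      _ = _ := by ring
  have h7 : ∫ x in B, ‖gradient f x‖ ≤ 2 * τ * volume.real D + 8 * Q * b / τ := by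
    calc _ ≤ 2 / s * (s * τ * volume.real D + (s * τ)⁻¹ * (4 * Q * s ^ 2 * b)) := by
          refine h2.trans (mul_le_mul_of_nonneg_left (h3.trans ?_) (by positivity))
          exact add_le_add le_rfl (mul_le_mul_of_nonneg_left h6 (by positivity))
      _ = _ := by field_simp; ring
  calc _ ≤ volume.real ({x | f x ≤ 0} ∩ B) * volume.real ({x | 1 ≤ f x} ∩ B) := by
        refine mul_le_mul (measureReal_mono hX0 ?_) (measureReal_mono hX1 ?_)
          measureReal_nonneg measureReal_nonneg <;>
        exact measure_ne_top_of_subset Set.inter_subset_right (hbf _)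
    _ ≤ _ := h1.trans (mul_le_mul_of_nonneg_left h7 measureReal_nonneg)

/-- A function bounded by `1` satisfying Caccioppoli inequalities which is nonpositive on a
set of positive measure is bounded away from `1`. -/
theorem deGiorgi_decay (n : ℕ) {Q μ : ℝ} (hQ : 0 ≤ Q) (hμ : 0 < μ) : ∃ γ : ℝ, 0 < γ ∧ γ < 1 ∧
    ∀ (v : Eucl n → ℝ) (K : ℝ≥0), LipschitzWith K v →
      (∀ x ∈ ball (0 : Eucl n) 1, v x ≤ 1) →
      (∀ κ, 0 ≤ κ → κ ≤ 1 - γ → CaccLevel v Q κ) →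
      μ ≤ volume.real ({x | v x ≤ 0} ∩ ball (0 : Eucl n) (1 / 2)) →
      ∀ x ∈ ball (0 : Eucl n) (1 / 4), v x ≤ 1 - γ := by
  obtain ⟨ν, hν, hsmall⟩ := deGiorgi_small_measure n hQ
  set b := volume.real (ball (0 : Eucl n) 1) with hb
  have hb0 : 0 < b := volume_real_ball_pos one_pos
  set τ := 16 * Q * b ^ 2 / (μ * ν) + 1 with hτ
  have hτ0 : 0 < τ := by positivity
  set c := μ * ν / (4 * b * τ) with hc
  have hc0 : 0 < c := by positivity
  obtain ⟨J, hJ⟩ := exists_nat_gt (b / c)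
  rw [div_lt_iff₀ hc0] at hJ
  let s : ℕ → ℝ := fun j => (1 / 2 : ℝ) ^ j
  have hs0 : ∀ j, 0 < s j := fun j => by positivity
  have hs1 : ∀ j, s j ≤ 1 := fun j => pow_le_one₀ (by norm_num) (by norm_num)
  have hss : ∀ j, s (j + 1) = s j / 2 := fun j => by simp only [s, pow_succ]; ring
  have hsm : Antitone s := pow_right_anti₀ (by norm_num) (by norm_num)
  have hJ1 := hs1 J
  have hJ0 := hs0 J
  refine ⟨s J / 2, by linarith, by linarith, fun v K hv hv1 hcac hdens => ?_⟩
  have key : volume.real ({x | 1 - s J < v x} ∩ ball (0 : Eucl n) (1 / 2)) ≤ ν := by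
    by_contra! hcon
    have hbf : ∀ r : ℝ, volume (ball (0 : Eucl n) r) ≠ ⊤ := fun s => measure_ball_lt_top.ne
    let D : ℕ → Set (Eucl n) := fun j =>
      {x | 1 - s j < v x ∧ v x < 1 - s j / 2} ∩ ball (0 : Eucl n) (1 / 2)
    have hDm : ∀ j, MeasurableSet (D j) := fun j =>
      ((hv.continuous.measurable measurableSet_Ioi).inter
        (hv.continuous.measurable measurableSet_Iio)).inter measurableSet_ball
    have hDf : ∀ j, volume (D j) ≠ ⊤ := fun j =>
      measure_ne_top_of_subset Set.inter_subset_right (hbf _)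
    have hDc : ∀ j ∈ Finset.range J, c ≤ volume.real (D j) := by
      intro j hj
      rw [Finset.mem_range] at hj
      have hsj : s J ≤ s j / 2 := by rw [← hss]; exact hsm hj
      have h1 := deGiorgi_level hv hQ (hs0 j) hτ0
        (hcac (1 - s j) (by linarith [hs1 j]) (by linarith))
      have h2 : μ ≤ volume.real ({x | v x ≤ 1 - s j} ∩ ball (0 : Eucl n) (1 / 2)) := by
        refine hdens.trans (measureReal_mono (Set.inter_subset_inter_left _
          fun x (hx : v x ≤ 0) => ?_) (measure_ne_top_of_subset Set.inter_subset_right (hbf _)))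
        change v x ≤ 1 - s j
        linarith [hs1 j]
      have h3 : ν ≤ volume.real ({x | 1 - s j / 2 < v x} ∩ ball (0 : Eucl n) (1 / 2)) := by
        refine hcon.le.trans (measureReal_mono (Set.inter_subset_inter_left _
          fun x (hx : 1 - s J < v x) => ?_)
          (measure_ne_top_of_subset Set.inter_subset_right (hbf _)))
        change 1 - s j / 2 < v x
        linarith
      have h4 : μ * ν ≤ b * (2 * τ * volume.real (D j) + 8 * Q * b / τ) :=
        (mul_le_mul h2 h3 hν.le measureReal_nonneg).trans h1
      have h5 : b * (8 * Q * b / τ) ≤ μ * ν / 2 := by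
        rw [← mul_div_assoc, div_le_iff₀ hτ0, hτ]
        have : μ * ν / 2 * (16 * Q * b ^ 2 / (μ * ν)) = 8 * Q * b ^ 2 := by field_simp; ring
        nlinarith [mul_pos hμ hν]
      rw [hc, div_le_iff₀ (by positivity)]
      nlinarith
    have hdisj : Set.PairwiseDisjoint (↑(Finset.range J)) D := by
      intro i _ j _ hij
      have aux : ∀ i j, i < j → Disjoint (D i) (D j) := fun i j hij => by
        rw [Set.disjoint_left]
        rintro x ⟨⟨_, h1⟩, _⟩ ⟨⟨h2, _⟩, _⟩
        have : s j ≤ s i / 2 := by rw [← hss]; exact hsm hij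
        linarith
      rcases lt_or_gt_of_ne hij with h | h
      · exact aux i j h
      · exact (aux j i h).symm
    have hsum := measureReal_biUnion_finset (μ := (volume : Measure (Eucl n))) hdisj
      (fun j _ => hDm j) (fun j _ => hDf j)
    have h1 : volume.real (⋃ j ∈ Finset.range J, D j) ≤ b := by
      refine measureReal_mono (Set.iUnion₂_subset fun j _ => ?_) (hbf _)
      exact Set.inter_subset_right.trans (ball_subset_ball (by norm_num))
    have h2 := Finset.card_nsmul_le_sum _ _ _ hDc
    rw [Finset.card_range, nsmul_eq_mul] at h2
    linarith
  have h2 : (1 + (1 - s J)) / 2 = 1 - s J / 2 := by ring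
  intro x hx
  rw [← h2]
  exact hsmall v K (1 - s J) hv (by linarith) hv1
    (fun κ' h1 h3 => hcac κ' (by linarith) (by rw [← h2]; exact h3)) key x hx

/-! ### Structure conditions at unit scale and the Caccioppoli inequality -/

/-- Quantitative structure conditions on the coefficients, at scale `ε`. -/
structure Coeffs (lam Lam M ε : ℝ) (G : Eucl n → ℝ → Eucl n → Eucl n)
    (G₀ : Eucl n → ℝ → Eucl n → ℝ) : Prop where
  lam_pos : 0 < lam
  Lam_nonneg : 0 ≤ Lam
  M_nonneg : 0 ≤ M
  eps_nonneg : 0 ≤ ε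
  eps_le_one : ε ≤ 1
  mono : ∀ x ∈ ball (0 : Eucl n) 2, ∀ z : ℝ, |z| ≤ M → ∀ p q : Eucl n, ‖p‖ ≤ M → ‖q‖ ≤ M →
    lam * ‖p - q‖ ^ 2 ≤ ⟪G x z p - G x z q, p - q⟫_ℝ
  lip : ∀ x ∈ ball (0 : Eucl n) 2, ∀ x' ∈ ball (0 : Eucl n) 2, ∀ z z' : ℝ, |z| ≤ M → |z'| ≤ M →
    ∀ p p' : Eucl n, ‖p‖ ≤ M → ‖p'‖ ≤ M →
      ‖G x z p - G x' z' p'‖ ≤ Lam * (ε * (‖x - x'‖ + |z - z'|) + ‖p - p'‖)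
  lip₀ : ∀ x ∈ ball (0 : Eucl n) 2, ∀ x' ∈ ball (0 : Eucl n) 2, ∀ z z' : ℝ, |z| ≤ M → |z'| ≤ M →
    ∀ p p' : Eucl n, ‖p‖ ≤ M → ‖p'‖ ≤ M →
      |G₀ x z p - G₀ x' z' p'| ≤ Lam * ε * (‖x - x'‖ + |z - z'| + ‖p - p'‖)
  bd₀ : ∀ x ∈ ball (0 : Eucl n) 2, ∀ z : ℝ, |z| ≤ M → ∀ p : Eucl n, ‖p‖ ≤ M →
    |G₀ x z p| ≤ Lam * ε

/-- A Lipschitz solution of the thin obstacle problem near the closed unit ball, vanishing at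
the origin. -/
structure UnitSol (G : Eucl n → ℝ → Eucl n → Eucl n) (G₀ : Eucl n → ℝ → Eucl n → ℝ)
    (L : ℝ≥0) (U : Eucl n → ℝ) : Prop where
  lip : LipschitzWith L U
  map_zero : U 0 = 0
  nonneg : ∀ x ∈ ball (0 : Eucl n) 2, x (Fin.last n) = 0 → 0 ≤ U x
  weak : ∀ (ψ : Eucl n → ℝ) (K : ℝ≥0), LipschitzWith K ψ → (∀ x ∉ ball (0 : Eucl n) 2, ψ x = 0) →
    (∀ x ∈ ball (0 : Eucl n) 2, x (Fin.last n) = 0 → 0 ≤ U x + ψ x) →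
    0 ≤ ∫ x in ball (0 : Eucl n) 2,
      (⟪G x (U x) (gradient U x), gradient ψ x⟫_ℝ + G₀ x (U x) (gradient U x) * ψ x)

lemma UnitSol.abs_le {G : Eucl n → ℝ → Eucl n → Eucl n} {G₀ : Eucl n → ℝ → Eucl n → ℝ}
    {L : ℝ≥0} {U : Eucl n → ℝ} (hU : UnitSol G G₀ L U) (x : Eucl n) : |U x| ≤ L * ‖x‖ := by
  have := hU.lip.norm_sub_le x 0
  rwa [hU.map_zero, sub_zero, sub_zero, Real.norm_eq_abs] at this

lemma exists_measurable_of_continuousOn {E : Type*} [TopologicalSpace E] [MeasurableSpace E]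
    [BorelSpace E] [Zero E] {X : Type*} [MeasurableSpace X] [TopologicalSpace X] [BorelSpace X]
    {S : Set X} (hS : MeasurableSet S) {f : X → E} (hf : ContinuousOn f S) :
    ∃ f' : X → E, Measurable f' ∧ ∀ x ∈ S, f' x = f x := by
  classical
  exact ⟨S.piecewise f 0, hf.measurable_piecewise continuousOn_const hS,
    fun x hx => Set.piecewise_eq_of_mem _ _ _ hx⟩

lemma measurableSet_prod_ball (M : ℝ) : MeasurableSet
    (ball (0 : Eucl n) 2 ×ˢ closedBall (0 : ℝ) M ×ˢ closedBall (0 : Eucl n) M) :=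
  measurableSet_ball.prod (measurableSet_closedBall.prod measurableSet_closedBall)

lemma Coeffs.exists_measurable {lam Lam M ε : ℝ} {G : Eucl n → ℝ → Eucl n → Eucl n}
    {G₀ : Eucl n → ℝ → Eucl n → ℝ} (hG : Coeffs lam Lam M ε G G₀) {z : Eucl n → ℝ}
    {p : Eucl n → Eucl n} (hz : Measurable z) (hp : Measurable p)
    (hzM : ∀ x ∈ ball (0 : Eucl n) 2, |z x| ≤ M) (hpM : ∀ x ∈ ball (0 : Eucl n) 2, ‖p x‖ ≤ M) :
    ∃ (A : Eucl n → Eucl n) (A₀ : Eucl n → ℝ) (C : ℝ), Measurable A ∧ Measurable A₀ ∧ 0 ≤ C ∧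
      (∀ x, ‖A x‖ ≤ C) ∧ (∀ x, |A₀ x| ≤ C) ∧
      ∀ x ∈ ball (0 : Eucl n) 2, A x = G x (z x) (p x) ∧ A₀ x = G₀ x (z x) (p x) := by
  set S := ball (0 : Eucl n) 2 ×ˢ closedBall (0 : ℝ) M ×ˢ closedBall (0 : Eucl n) M with hS
  have hmem : ∀ x ∈ ball (0 : Eucl n) 2, (x, z x, p x) ∈ S := fun x hx =>
    ⟨hx, by simpa using hzM x hx, by simpa using hpM x hx⟩
  have hmeas : Measurable fun x => (x, z x, p x) := measurable_id.prodMk (hz.prodMk hp)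
  have e1 := hG.eps_le_one
  have e0 := hG.eps_nonneg
  have L0 := hG.Lam_nonneg
  have hsum : ∀ q ∈ S, ∀ q' ∈ S, (‖q.1 - q'.1‖ + |q.2.1 - q'.2.1|) + ‖q.2.2 - q'.2.2‖ ≤
      3 * dist q q' := by
    intro q _ q' _
    rw [← dist_eq_norm, ← Real.dist_eq, ← dist_eq_norm]
    have h1 : dist q.1 q'.1 ≤ dist q q' := le_max_left _ _
    have h2 : dist q.2 q'.2 ≤ dist q q' := le_max_right _ _
    have h3 : dist q.2.1 q'.2.1 ≤ dist q.2 q'.2 := le_max_left _ _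
    have h4 : dist q.2.2 q'.2.2 ≤ dist q.2 q'.2 := le_max_right _ _
    linarith
  have hGc : ContinuousOn (fun q : Eucl n × ℝ × Eucl n => G q.1 q.2.1 q.2.2) S := by
    refine LipschitzOnWith.continuousOn (K := ⟨Lam * 3, by positivity⟩)
      (LipschitzOnWith.of_dist_le_mul fun q hq q' hq' => ?_)
    rw [dist_eq_norm]
    refine (hG.lip _ hq.1 _ hq'.1 _ _ (by simpa using hq.2.1) (by simpa using hq'.2.1) _ _
      (by simpa using hq.2.2) (by simpa using hq'.2.2)).trans ?_
    change _ ≤ Lam * 3 * _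
    rw [mul_assoc]
    refine mul_le_mul_of_nonneg_left (le_trans ?_ (hsum q hq q' hq')) L0
    have : 0 ≤ ‖q.1 - q'.1‖ + |q.2.1 - q'.2.1| := by positivity
    nlinarith
  have hG₀c : ContinuousOn (fun q : Eucl n × ℝ × Eucl n => G₀ q.1 q.2.1 q.2.2) S := by
    refine LipschitzOnWith.continuousOn (K := ⟨Lam * 3, by positivity⟩)
      (LipschitzOnWith.of_dist_le_mul fun q hq q' hq' => ?_)
    rw [Real.dist_eq]
    refine (hG.lip₀ _ hq.1 _ hq'.1 _ _ (by simpa using hq.2.1) (by simpa using hq'.2.1) _ _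
      (by simpa using hq.2.2) (by simpa using hq'.2.2)).trans ?_
    change _ ≤ Lam * 3 * _
    rw [mul_assoc Lam 3]
    refine mul_le_mul (mul_le_of_le_one_right L0 e1) (hsum q hq q' hq') (by positivity) L0
  obtain ⟨A, hA, hAe⟩ := exists_measurable_of_continuousOn (measurableSet_prod_ball M) hGc
  obtain ⟨A₀, hA₀, hA₀e⟩ := exists_measurable_of_continuousOn (measurableSet_prod_ball M) hG₀c
  refine ⟨(ball (0 : Eucl n) 2).indicator fun x => A (x, z x, p x),
    (ball (0 : Eucl n) 2).indicator fun x => A₀ (x, z x, p x),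
    ‖G 0 0 0‖ + Lam * (2 + M + M) + Lam * ε,
    (hA.comp hmeas).indicator measurableSet_ball, (hA₀.comp hmeas).indicator measurableSet_ball,
    ?_, fun x => ?_, fun x => ?_, fun x hx => ?_⟩
  · have := hG.M_nonneg
    positivity
  · have M0 := hG.M_nonneg
    by_cases hx : x ∈ ball (0 : Eucl n) 2
    · rw [Set.indicator_of_mem hx, hAe _ (hmem x hx)]
      have h1 := hG.lip x hx 0 (by simp) (z x) 0 (hzM x hx) (by simpa using M0) (p x) 0 (hpM x hx)
        (by simpa using M0)
      simp only [sub_zero] at h1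
      have h2 := norm_sub_norm_le (G x (z x) (p x)) (G 0 0 0)
      have h3 : Lam * (ε * (‖x‖ + |z x|) + ‖p x‖) ≤ Lam * (2 + M + M) := by
        refine mul_le_mul_of_nonneg_left (add_le_add ?_ (hpM x hx)) L0
        exact (mul_le_of_le_one_left (by positivity) e1).trans
          (add_le_add (mem_ball_zero_iff.1 hx).le (hzM x hx))
      have h4 : 0 ≤ Lam * ε := by positivity
      change ‖G x (z x) (p x)‖ ≤ _
      linarith
    · rw [Set.indicator_of_notMem hx, norm_zero]; positivity
  · have M0 := hG.M_nonneg
    by_cases hx : x ∈ ball (0 : Eucl n) 2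
    · rw [Set.indicator_of_mem hx, hA₀e _ (hmem x hx)]
      refine (hG.bd₀ x hx _ (hzM x hx) _ (hpM x hx)).trans ?_
      have : 0 ≤ ‖G 0 0 0‖ + Lam * (2 + M + M) := by positivity
      linarith
    · rw [Set.indicator_of_notMem hx, abs_zero]; positivity
  · rw [Set.indicator_of_mem hx, Set.indicator_of_mem hx, hAe _ (hmem x hx), hA₀e _ (hmem x hx)]
    exact ⟨rfl, rfl⟩

lemma lipschitzWith_mul {f g : Eucl n → ℝ} {Kf Kg Cf Cg : ℝ≥0} (hf : LipschitzWith Kf f)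
    (hg : LipschitzWith Kg g) (hCf : ∀ x, |f x| ≤ Cf) (hCg : ∀ x, |g x| ≤ Cg) :
    LipschitzWith (Kf * Cg + Cf * Kg) fun x => f x * g x := by
  refine LipschitzWith.of_dist_le_mul fun x y => ?_
  have e1 := hf.dist_le_mul x y
  have e2 := hg.dist_le_mul x y
  rw [Real.dist_eq] at e1 e2 ⊢
  push_cast
  calc |f x * g x - f y * g y| = |(f x - f y) * g x + f y * (g x - g y)| := by ring_nf
    _ ≤ |f x - f y| * |g x| + |f y| * |g x - g y| := by
        rw [← abs_mul, ← abs_mul]; exact abs_add_le _ _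
    _ ≤ Kf * dist x y * Cg + Cf * (Kg * dist x y) := by
        gcongr
        exacts [hCg x, hCf y]
    _ = _ := by ring

lemma integrable_pairing {A : Eucl n → Eucl n} {A₀ : Eucl n → ℝ} {C : ℝ} (hA : Measurable A)
    (hA₀ : Measurable A₀) (hAC : ∀ x, ‖A x‖ ≤ C) (hA₀C : ∀ x, |A₀ x| ≤ C) {ψ : Eucl n → ℝ}
    {K : ℝ≥0} (hψ : LipschitzWith K ψ) {H : ℝ} (hψH : ∀ x, |ψ x| ≤ H) {s : Set (Eucl n)}
    (hs : volume s ≠ ⊤) :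
    IntegrableOn (fun x => ⟪A x, gradient ψ x⟫_ℝ + A₀ x * ψ x) s := by
  have hC : 0 ≤ C := (norm_nonneg _).trans (hAC 0)
  refine integrableOn_of_bounded hs (C := C * K + C * H) ?_ (.of_forall fun x => ?_)
  · exact ((hA.inner (measurable_gradient ψ)).add
      (hA₀.mul hψ.continuous.measurable)).aestronglyMeasurable
  · refine (abs_add_le _ _).trans (add_le_add ?_ ?_)
    · exact (abs_real_inner_le_norm _ _).trans
        (mul_le_mul (hAC x) (norm_gradient_le hψ x) (norm_nonneg _) hC)
    · rw [abs_mul]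
      exact mul_le_mul (hA₀C x) (hψH x) (abs_nonneg _) hC

/-- The constant in the Caccioppoli inequality for difference quotients. -/
def caccConst (lam Lam L : ℝ) : ℝ :=
  8 / lam * (3 * (Lam * (1 + L)) + 8 * (Lam * (1 + L)) ^ 2 / lam)

lemma caccConst_nonneg {lam Lam L : ℝ} (h1 : 0 < lam) (h2 : 0 ≤ Lam) (h3 : 0 ≤ L) :
    0 ≤ caccConst lam Lam L := by
  unfold caccConst; positivity

lemma cacc_pointwise {lam Lm ε h η f D c : ℝ} {Pa Pb ξ ζ : Eucl n} (hlam : 0 < lam) (hLm : 0 ≤ Lm)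
    (hε : 0 ≤ ε) (hε1 : ε ≤ 1) (hh : 0 < h) (hη : 0 ≤ η) (hη1 : η ≤ 1) (hf : 0 ≤ f) (hD : 1 ≤ D)
    (hζ : ‖ζ‖ ≤ D) (h1 : lam * h * ‖ξ‖ ^ 2 ≤ ⟪Pa, ξ⟫_ℝ) (h2 : ‖Pa‖ ≤ Lm * h * ‖ξ‖)
    (h3 : ‖Pb‖ ≤ Lm * ε * h) (h4 : |c| ≤ Lm * ε * h * (1 + ‖ξ‖)) :
    h * (lam / 2 * (η ^ 2 * ‖ξ‖ ^ 2) - (3 * Lm + 8 * Lm ^ 2 / lam) * (ε + f * D) ^ 2) ≤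
      ⟪Pa + Pb, η • (η • ξ + f • ζ) + (η * f) • ζ⟫_ℝ + c * (η * (η * f)) := by
  have e1 : ⟪Pa + Pb, η • (η • ξ + f • ζ) + (η * f) • ζ⟫_ℝ =
      η ^ 2 * ⟪Pa, ξ⟫_ℝ + 2 * η * f * ⟪Pa, ζ⟫_ℝ + η ^ 2 * ⟪Pb, ξ⟫_ℝ + 2 * η * f * ⟪Pb, ζ⟫_ℝ := by
    simp only [inner_add_left, inner_add_right, inner_smul_right]
    ring
  rw [e1]
  set a := η * ‖ξ‖ with ha
  set X := ε + f * D with hX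
  have ha0 : 0 ≤ a := by positivity
  have hfD : f ≤ f * D := le_mul_of_one_le_right hf hD
  have hfX : f ≤ X := by linarith
  have hfDX : f * D ≤ X := by linarith
  have hεX : ε ≤ X := by linarith [mul_nonneg hf (zero_le_one.trans hD)]
  have hX0 : 0 ≤ X := hε.trans hεX
  have t1 : lam * h * a ^ 2 ≤ η ^ 2 * ⟪Pa, ξ⟫_ℝ := by
    have := mul_le_mul_of_nonneg_left h1 (sq_nonneg η)
    calc _ = η ^ 2 * (lam * h * ‖ξ‖ ^ 2) := by rw [ha]; ring
      _ ≤ _ := this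
  have t2 : -(2 * (Lm * h * (a * X))) ≤ 2 * η * f * ⟪Pa, ζ⟫_ℝ := by
    have i1 : -(Lm * h * ‖ξ‖ * D) ≤ ⟪Pa, ζ⟫_ℝ := by
      refine neg_le_of_abs_le ((abs_real_inner_le_norm _ _).trans ?_)
      gcongr
    calc _ ≤ -(2 * (Lm * h * (a * (f * D)))) := by gcongr
      _ = 2 * η * f * (-(Lm * h * ‖ξ‖ * D)) := by rw [ha]; ring
      _ ≤ _ := by gcongr
  have t3 : -(Lm * h * (a * X)) ≤ η ^ 2 * ⟪Pb, ξ⟫_ℝ := by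
    have i1 : -(Lm * ε * h * ‖ξ‖) ≤ ⟪Pb, ξ⟫_ℝ := by
      refine neg_le_of_abs_le ((abs_real_inner_le_norm _ _).trans ?_)
      gcongr
    calc -(Lm * h * (a * X)) ≤ -(Lm * h * (η * a * ε)) := by
          have : η * a * ε ≤ a * X := by
            have : η * a ≤ a := mul_le_of_le_one_left ha0 hη1
            gcongr
          gcongr
      _ = η ^ 2 * (-(Lm * ε * h * ‖ξ‖)) := by rw [ha]; ring
      _ ≤ _ := by gcongr
  have t4 : -(2 * (Lm * h * X ^ 2)) ≤ 2 * η * f * ⟪Pb, ζ⟫_ℝ := by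
    have i1 : -(Lm * ε * h * D) ≤ ⟪Pb, ζ⟫_ℝ := by
      refine neg_le_of_abs_le ((abs_real_inner_le_norm _ _).trans ?_)
      gcongr
    calc -(2 * (Lm * h * X ^ 2)) ≤ -(2 * (Lm * h * (η * (f * D) * ε))) := by
          have : η * (f * D) * ε ≤ X ^ 2 := by
            have : η * (f * D) ≤ X := (mul_le_of_le_one_left (by positivity) hη1).trans hfDX
            rw [sq]; gcongr
          gcongr
      _ = 2 * η * f * (-(Lm * ε * h * D)) := by ring
      _ ≤ _ := by gcongr
  have t5 : -(Lm * h * (X ^ 2 + a * X)) ≤ c * (η * (η * f)) := by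
    have i1 := neg_le_of_abs_le h4
    calc -(Lm * h * (X ^ 2 + a * X)) ≤ -(Lm * h * (ε * f * (η ^ 2) + ε * (η * a * f))) := by
          have s1 : ε * f * η ^ 2 ≤ X ^ 2 := by
            rw [sq X]
            exact (mul_le_of_le_one_right (by positivity) (pow_le_one₀ hη hη1)).trans (by gcongr)
          have s2 : ε * (η * a * f) ≤ a * X := by
            refine (mul_le_of_le_one_left (by positivity) hε1).trans ?_
            have : η * a ≤ a := mul_le_of_le_one_left ha0 hη1
            gcongr
          gcongr
      _ = -(Lm * ε * h * (1 + ‖ξ‖)) * (η * (η * f)) := by rw [ha]; ring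
      _ ≤ _ := by gcongr
  have t6 : Lm * (4 * (a * X)) ≤ lam / 2 * a ^ 2 + 8 * Lm ^ 2 / lam * X ^ 2 := by
    have : 0 ≤ (lam * a - 4 * Lm * X) ^ 2 / (2 * lam) := by positivity
    have e : (lam * a - 4 * Lm * X) ^ 2 / (2 * lam) =
        lam / 2 * a ^ 2 + 8 * Lm ^ 2 / lam * X ^ 2 - Lm * (4 * (a * X)) := by
      field_simp; ring
    linarith
  have t7 := mul_le_mul_of_nonneg_left t6 hh.le
  have e2 : η ^ 2 * ‖ξ‖ ^ 2 = a ^ 2 := by rw [ha]; ring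
  rw [e2]
  nlinarith

lemma lipschitzWith_diffQuot {U : Eucl n → ℝ} {L : ℝ≥0} (hU : LipschitzWith L U) {h : ℝ}
    (hh : 0 < h) (e : Eucl n) :
    LipschitzWith (⟨h⁻¹, (inv_pos.2 hh).le⟩ * (2 * L)) (diffQuot h e U) := by
  refine LipschitzWith.of_dist_le_mul fun x y => ?_
  have e1 := hU.dist_le_mul x y
  have e2 := hU.dist_le_mul (x + h • e) (y + h • e)
  rw [dist_add_right] at e2
  rw [Real.dist_eq] at *
  change _ ≤ h⁻¹ * (2 * L) * _
  rw [diffQuot, diffQuot, ← sub_div, abs_div, abs_of_pos hh, div_eq_inv_mul, mul_assoc]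
  gcongr
  calc |U (x + h • e) - U x - (U (y + h • e) - U y)|
      = |(U (x + h • e) - U (y + h • e)) - (U x - U y)| := by ring_nf
    _ ≤ _ := abs_sub _ _
    _ ≤ _ := by linarith

lemma abs_diffQuot_le {U : Eucl n → ℝ} {L : ℝ≥0} (hU : LipschitzWith L U) {h : ℝ}
    (hh : 0 < h) {e : Eucl n} (he : ‖e‖ = 1) (x : Eucl n) : |diffQuot h e U x| ≤ L := by
  have := hU.dist_le_mul (x + h • e) x
  rw [Real.dist_eq, dist_eq_norm, add_sub_cancel_left, norm_smul, he, mul_one, Real.norm_eq_abs,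
    abs_of_pos hh] at this
  rw [diffQuot, abs_div, abs_of_pos hh, div_le_iff₀ hh]
  exact this

set_option maxHeartbeats 1000000 in
lemma caccioppoli {lam Lam M ε : ℝ} {G : Eucl n → ℝ → Eucl n → Eucl n}
    {G₀ : Eucl n → ℝ → Eucl n → ℝ} (hG : Coeffs lam Lam M ε G G₀) {L : ℝ≥0} {U : Eucl n → ℝ}
    (hU : UnitSol G G₀ L U) (hM : 2 * L ≤ M) {e : Eucl n} (he : ‖e‖ = 1)
    (he0 : e (Fin.last n) = 0) {h : ℝ} (hh : 0 < h) (hh1 : h ≤ 1) {κ H : ℝ} (hκ : 0 ≤ κ)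
    (hH : ε ≤ H) (hH0 : 0 < H) (hw : ∀ x ∈ ball (0 : Eucl n) 1, diffQuot h e U x - κ ≤ H)
    {ρ d : ℝ} (hρ : 0 < ρ) (hd : 0 < d) (hρd : ρ + d ≤ 1) :
    ∫ x in ball (0 : Eucl n) ρ, ‖gradient (trunc (diffQuot h e U) κ) x‖ ^ 2 ≤
      caccConst lam Lam L * (H / d) ^ 2 *
        volume.real ({x | κ < diffQuot h e U x} ∩ ball (0 : Eucl n) (ρ + d)) := by
  have hlam := hG.lam_pos
  have hLam := hG.Lam_nonneg
  have hε := hG.eps_nonneg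
  have hε1 := hG.eps_le_one
  set w := diffQuot h e U with hwdef
  have hwL := lipschitzWith_diffQuot hU.lip hh e
  rw [← hwdef] at hwL
  set f := trunc w κ with hf
  obtain ⟨Kf, hfL⟩ : ∃ Kf, LipschitzWith Kf f := ⟨_, LipschitzWith.trunc hwL κ⟩
  have hf0 : ∀ x, 0 ≤ f x := trunc_nonneg _ _
  have hfb : ∀ x, |f x| ≤ L := fun x => by
    rw [abs_of_nonneg (hf0 x)]
    have := (abs_le.1 (abs_diffQuot_le hU.lip hh he x)).2
    exact max_le (by linarith) L.2
  have hfH : ∀ x ∈ ball (0 : Eucl n) 1, f x ≤ H := fun x hx => max_le (hw x hx) hH0.le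
  set η : Eucl n → ℝ := cutoff ρ d with hη
  have hη0 : ∀ x, 0 ≤ η x := cutoff_nonneg _ _
  have hη1 : ∀ x, η x ≤ 1 := cutoff_le_one _ _
  have hηb : ∀ x, |η x| ≤ (1 : ℝ≥0) := fun x => by
    rw [abs_of_nonneg (hη0 x)]; exact hη1 x
  have hηL := lipschitzWith_cutoff (n := n) ρ hd
  rw [← hη] at hηL
  have hηfL := lipschitzWith_mul hηL hfL hηb hfb
  have hηfb : ∀ x, |η x * f x| ≤ L := fun x => by
    rw [abs_mul]
    exact (mul_le_of_le_one_left (abs_nonneg _) (hηb x)).trans (hfb x)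
  have hψL := lipschitzWith_mul hηL hηfL hηb hηfb
  set ψ : Eucl n → ℝ := fun x => η x * (η x * f x) with hψ
  obtain ⟨Kψ, hψL⟩ : ∃ Kψ, LipschitzWith Kψ ψ := ⟨_, hψL⟩
  have hψ0 : ∀ x, 0 ≤ ψ x := fun x => mul_nonneg (hη0 x) (mul_nonneg (hη0 x) (hf0 x))
  have hψf : ∀ x, ψ x ≤ f x := fun x =>
    (mul_le_of_le_one_left (mul_nonneg (hη0 x) (hf0 x)) (hη1 x)).trans
      (mul_le_of_le_one_left (hf0 x) (hη1 x))
  have hψb : ∀ x, |ψ x| ≤ L := fun x => by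
    rw [abs_of_nonneg (hψ0 x)]
    exact (hψf x).trans ((le_abs_self _).trans (hfb x))
  set S := {x | κ < w x} ∩ ball (0 : Eucl n) (ρ + d) with hS
  have hSm : MeasurableSet S := measurableSet_superlevel hwL.continuous _ _
  have hS1 : S ⊆ ball (0 : Eucl n) 1 := Set.inter_subset_right.trans (ball_subset_ball hρd)
  have hSf : volume S ≠ ⊤ := measure_ne_top_of_subset hS1 measure_ball_lt_top.ne
  have hψS : ∀ x, x ∉ S → ψ x = 0 := fun x hx => by
    by_cases h : κ < w x
    · have : x ∉ ball (0 : Eucl n) (ρ + d) := fun h' => hx ⟨h, h'⟩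
      rw [mem_ball_zero_iff, not_lt] at this
      simp [hψ, hη, cutoff_eq_zero hd this]
    · simp [hψ, hf, trunc_eq_zero (not_lt.1 h)]
  have hψgS : ∀ x, x ∉ S → gradient ψ x = 0 := fun x hx =>
    gradient_eq_zero_of_nonneg hψ0 (hψS x hx)
  have hb12 : ball (0 : Eucl n) 1 ⊆ ball (0 : Eucl n) 2 := ball_subset_ball (by norm_num)
  have hshift : ∀ y ∈ ball (0 : Eucl n) 1, y + h • e ∈ ball (0 : Eucl n) 2 := fun y hy => by
    rw [mem_ball_zero_iff] at *
    refine (norm_add_le _ _).trans_lt ?_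
    rw [norm_smul, he, mul_one, Real.norm_eq_abs, abs_of_pos hh]
    linarith
  have hUM : ∀ x ∈ ball (0 : Eucl n) 2, |U x| ≤ M := fun x hx => by
    rw [mem_ball_zero_iff] at hx
    refine (hU.abs_le x).trans (le_trans ?_ hM)
    rw [mul_comm]
    gcongr
  have hgM : ∀ x : Eucl n, ‖gradient U x‖ ≤ M := fun x =>
    (norm_gradient_le hU.lip x).trans (by linarith [L.2])
  obtain ⟨A, A₀, C, hA, hA₀, hC0, hAC, hA₀C, hAe⟩ := hG.exists_measurable
    hU.lip.continuous.measurable (measurable_gradient U) hUM (fun x _ => hgM x)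
  -- the solution tested with `ψ`
  have test1 : 0 ≤ ∫ x in ball (0 : Eucl n) 1, (⟪A x, gradient ψ x⟫_ℝ + A₀ x * ψ x) := by
    have h1 := hU.weak ψ Kψ hψL (fun x hx => hψS x fun h => hx (hb12 (hS1 h)))
      (fun x hx hx0 => add_nonneg (hU.nonneg x hx hx0) (hψ0 x))
    have h2 : ∫ x in ball (0 : Eucl n) 2,
        (⟪G x (U x) (gradient U x), gradient ψ x⟫_ℝ + G₀ x (U x) (gradient U x) * ψ x) =
        ∫ x in ball (0 : Eucl n) 2, (⟪A x, gradient ψ x⟫_ℝ + A₀ x * ψ x) :=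
      setIntegral_congr_fun measurableSet_ball fun x hx => by
        simp only [(hAe x hx).1, (hAe x hx).2]
    rw [h2] at h1
    rwa [setIntegral_eq_of_subset_of_forall_sdiff_eq_zero measurableSet_ball hb12] at h1
    intro x hx
    have : x ∉ S := fun h => hx.2 (hS1 h)
    simp [hψS x this, hψgS x this]
  -- the translated solution tested with `-h ψ`
  have test2 : ∫ y in ball (0 : Eucl n) 1,
      (⟪A (y + h • e), gradient ψ y⟫_ℝ + A₀ (y + h • e) * ψ y) ≤ 0 := by
    set χ : Eucl n → ℝ := fun x => ψ (x + -(h • e)) with hχ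
    have hχL : LipschitzWith Kψ χ := LipschitzWith.of_dist_le_mul fun x y => by
      have := hψL.dist_le_mul (x + -(h • e)) (y + -(h • e))
      rwa [dist_add_right] at this
    have hmχ : LipschitzWith (⟨h, hh.le⟩ * Kψ) fun x => -h * χ x :=
      LipschitzWith.of_dist_le_mul fun x y => by
        have := hχL.dist_le_mul x y
        rw [Real.dist_eq] at this ⊢
        rw [← mul_sub, abs_mul, abs_neg, abs_of_pos hh]
        change _ ≤ h * Kψ * _
        rw [mul_assoc]
        gcongr
    have hχz : ∀ x, x + -(h • e) ∉ S → χ x = 0 := fun x hx => hψS _ hx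
    have hχg : ∀ x, gradient χ x = gradient ψ (x + -(h • e)) := fun x =>
      gradient_comp_add_right x _
    have h1 := hU.weak (fun x => -h * χ x) _ hmχ (fun x hx => by
        have : x + -(h • e) ∉ S := fun h' => hx (by simpa using hshift _ (hS1 h'))
        simp [hχz x this]) (fun x hx hx0 => by
        set y := x + -(h • e) with hy
        have hxy : y + h • e = x := by simp [hy]
        by_cases hyS : y ∈ S
        · have hy0 : y (Fin.last n) = 0 := by simp [hy, hx0, he0]
          have h2 := hU.nonneg y (hb12 (hS1 hyS)) hy0
          have h3 : h * w y = U x - U y := by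
            rw [hwdef, diffQuot, hxy]; field_simp
          have h4 : f y = w y - κ := max_eq_left (by linarith [show κ < w y from hyS.1])
          have h5 := mul_le_mul_of_nonneg_left (hψf y) hh.le
          rw [h4, mul_sub, h3] at h5
          have h6 : 0 ≤ h * κ := by positivity
          change 0 ≤ U x + -h * ψ y
          linarith
        · rw [hχz x hyS]; simpa using hU.nonneg x hx hx0)
    have h2 : ∫ x in ball (0 : Eucl n) 2,
        (⟪G x (U x) (gradient U x), gradient (fun x => -h * χ x) x⟫_ℝ +
          G₀ x (U x) (gradient U x) * (-h * χ x)) =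
        -h * ∫ x in ball (0 : Eucl n) 2, (⟪A x, gradient χ x⟫_ℝ + A₀ x * χ x) := by
      rw [← integral_const_mul]
      refine setIntegral_congr_fun measurableSet_ball fun x hx => ?_
      simp only [(hAe x hx).1, (hAe x hx).2, gradient_const_mul, inner_smul_right]
      ring
    have h3 : ∫ x in ball (0 : Eucl n) 2, (⟪A x, gradient χ x⟫_ℝ + A₀ x * χ x) =
        ∫ x, (⟪A x, gradient χ x⟫_ℝ + A₀ x * χ x) := by
      refine setIntegral_eq_integral_of_forall_compl_eq_zero fun x hx => ?_
      have : x + -(h • e) ∉ S := fun h' => hx (by simpa using hshift _ (hS1 h'))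
      rw [hχz x this, hχg, hψgS _ this]; simp
    have h4 : ∫ y in ball (0 : Eucl n) 1,
        (⟪A (y + h • e), gradient ψ y⟫_ℝ + A₀ (y + h • e) * ψ y) =
        ∫ y, (⟪A (y + h • e), gradient ψ y⟫_ℝ + A₀ (y + h • e) * ψ y) := by
      refine setIntegral_eq_integral_of_forall_compl_eq_zero fun y hy => ?_
      have : y ∉ S := fun h' => hy (hS1 h')
      rw [hψS y this, hψgS y this]; simp
    have h5 : ∫ y, (⟪A (y + h • e), gradient ψ y⟫_ℝ + A₀ (y + h • e) * ψ y) =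
        ∫ x, (⟪A x, gradient χ x⟫_ℝ + A₀ x * χ x) := by
      rw [← integral_add_right_eq_self (μ := volume)
        (fun x => (⟪A x, gradient χ x⟫_ℝ + A₀ x * χ x)) (h • e)]
      refine integral_congr_ae (.of_forall fun y => ?_)
      have hyy : y + h • e + -(h • e) = y := by abel
      change _ = ⟪A (y + h • e), gradient χ (y + h • e)⟫_ℝ +
        A₀ (y + h • e) * ψ (y + h • e + -(h • e))
      rw [hχg, hyy]
    rw [h2, h3] at h1
    rw [h4, h5]
    nlinarith
  have hi1 : IntegrableOn (fun x => ⟪A x, gradient ψ x⟫_ℝ + A₀ x * ψ x) (ball (0 : Eucl n) 1) :=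
    integrable_pairing hA hA₀ hAC hA₀C hψL hψb measure_ball_lt_top.ne
  have hi2 : IntegrableOn (fun x => ⟪A (x + h • e), gradient ψ x⟫_ℝ + A₀ (x + h • e) * ψ x)
      (ball (0 : Eucl n) 1) :=
    integrable_pairing (A := fun x => A (x + h • e)) (A₀ := fun x => A₀ (x + h • e))
      (hA.comp (measurable_add_const _)) (hA₀.comp (measurable_add_const _))
      (fun x => hAC _) (fun x => hA₀C _) hψL hψb measure_ball_lt_top.ne
  have hdiff : ∫ x in ball (0 : Eucl n) 1,
      (⟪A (x + h • e) - A x, gradient ψ x⟫_ℝ + (A₀ (x + h • e) - A₀ x) * ψ x) ≤ 0 := by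
    have : ∫ x in ball (0 : Eucl n) 1,
        (⟪A (x + h • e) - A x, gradient ψ x⟫_ℝ + (A₀ (x + h • e) - A₀ x) * ψ x) =
        (∫ y in ball (0 : Eucl n) 1,
          (⟪A (y + h • e), gradient ψ y⟫_ℝ + A₀ (y + h • e) * ψ y)) -
        ∫ x in ball (0 : Eucl n) 1, (⟪A x, gradient ψ x⟫_ℝ + A₀ x * ψ x) := by
      rw [← integral_sub hi2 hi1]
      refine integral_congr_ae (.of_forall fun y => ?_)
      simp only [inner_sub_left]; ring
    rw [this]; linarith
  set Lm := Lam * (1 + (L : ℝ)) with hLm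
  have hLm0 : 0 ≤ Lm := by positivity
  set D := d⁻¹ with hD
  have hD1 : 1 ≤ D := by rw [hD]; exact (one_le_inv₀ hd).2 (by linarith)
  set Cq := 3 * Lm + 8 * Lm ^ 2 / lam with hCq
  have hCq0 : 0 ≤ Cq := by positivity
  set E : Eucl n → ℝ := fun x => h * (lam / 2 * (η x ^ 2 * ‖gradient f x‖ ^ 2) -
    Cq * (2 * (H / d)) ^ 2) with hE
  -- pointwise lower bound
  have hpt : ∀ᵐ x, x ∈ ball (0 : Eucl n) 1 → S.indicator E x ≤
      ⟪A (x + h • e) - A x, gradient ψ x⟫_ℝ + (A₀ (x + h • e) - A₀ x) * ψ x := by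
    have hdU' : ∀ᵐ x : Eucl n, DifferentiableAt ℝ U (x + h • e) :=
      (measurePreserving_add_right volume (h • e)).quasiMeasurePreserving.ae
        hU.lip.ae_differentiableAt
    filter_upwards [hU.lip.ae_differentiableAt, hdU', hfL.ae_differentiableAt,
      hηL.ae_differentiableAt] with x d1 d2 d3 d4 hx
    by_cases hxS : x ∈ S
    swap
    · rw [Set.indicator_of_notMem hxS, hψS x hxS, hψgS x hxS]; simp
    rw [Set.indicator_of_mem hxS]
    have hx2 := hb12 hx
    have hxs := hshift x hx
    have hgψ : gradient ψ x = η x • (η x • gradient f x + f x • gradient η x) +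
        (η x * f x) • gradient η x := by
      have d5 : DifferentiableAt ℝ (fun y => η y * f y) x := d4.mul d3
      rw [hψ, gradient_mul d4 d5, gradient_mul d4 d3]
    have hgf : gradient f x = h⁻¹ • (gradient U (x + h • e) - gradient U x) := by
      have hcomp : DifferentiableAt ℝ (fun y => U (y + h • e)) x :=
        DifferentiableAt.comp (g := U) x d2 (differentiableAt_id.add_const _)
      have hpos : 0 < w x - κ := by linarith [show κ < w x from hxS.1]
      have hwe : w = fun y => h⁻¹ * (U (y + h • e) - U y) := by
        ext y; rw [hwdef, diffQuot, div_eq_inv_mul]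
      calc gradient f x = gradient (fun y => w y - κ) x :=
            gradient_posPart_of_pos (f := fun y => w y - κ)
              (hwL.continuous.sub continuous_const) hpos
        _ = gradient w x := gradient_sub_const κ
        _ = _ := by
            rw [hwe, gradient_const_mul, gradient_sub hcomp d1, gradient_comp_add_right]
    have hgh : gradient U (x + h • e) - gradient U x = h • gradient f x := by
      rw [hgf, smul_smul, mul_inv_cancel₀ hh.ne', one_smul]
    have hnh : ‖gradient U (x + h • e) - gradient U x‖ = h * ‖gradient f x‖ := by
      rw [hgh, norm_smul, Real.norm_eq_abs, abs_of_pos hh]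
    have hdU : |U (x + h • e) - U x| ≤ h * L := by
      have := abs_diffQuot_le hU.lip hh he x
      rw [diffQuot, abs_div, abs_of_pos hh, div_le_iff₀ hh] at this
      linarith
    have hdx : ‖x + h • e - x‖ = h := by
      rw [add_sub_cancel_left, norm_smul, he, mul_one, Real.norm_eq_abs, abs_of_pos hh]
    set p := gradient U x with hp
    set p' := gradient U (x + h • e) with hp'
    set Pa := G x (U x) p' - G x (U x) p with hPa
    set Pb := G (x + h • e) (U (x + h • e)) p' - G x (U x) p' with hPb
    have e1 : A (x + h • e) - A x = Pa + Pb := by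
      rw [(hAe _ hxs).1, (hAe _ hx2).1, hPa, hPb]
      change G _ _ p' - G _ _ p = _
      abel
    have b1 : lam * h * ‖gradient f x‖ ^ 2 ≤ ⟪Pa, gradient f x⟫_ℝ := by
      have := hG.mono x hx2 (U x) (hUM x hx2) p' p (hgM _) (hgM _)
      rw [hnh, hgh, inner_smul_right] at this
      have h9 : h * (lam * h * ‖gradient f x‖ ^ 2) ≤ h * ⟪Pa, gradient f x⟫_ℝ := by
        calc _ = lam * (h * ‖gradient f x‖) ^ 2 := by ring
          _ ≤ _ := this
      exact le_of_mul_le_mul_left h9 hh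
    have b2 : ‖Pa‖ ≤ Lm * h * ‖gradient f x‖ := by
      have := hG.lip x hx2 x hx2 (U x) (U x) (hUM x hx2) (hUM x hx2) p' p (hgM _) (hgM _)
      rw [hnh, sub_self, sub_self, norm_zero, abs_zero, add_zero, mul_zero, zero_add] at this
      refine this.trans ?_
      rw [hLm]
      have : Lam * (h * ‖gradient f x‖) * 1 ≤ Lam * (h * ‖gradient f x‖) * (1 + L) := by
        gcongr; linarith [L.2]
      linarith
    have b3 : ‖Pb‖ ≤ Lm * ε * h := by
      have := hG.lip _ hxs x hx2 _ (U x) (hUM _ hxs) (hUM x hx2) p' p' (hgM _) (hgM _)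
      rw [hdx, sub_self, norm_zero, add_zero] at this
      refine this.trans ?_
      calc _ ≤ Lam * (ε * (h + h * L)) := by gcongr
        _ = _ := by rw [hLm]; ring
    have b4 : |A₀ (x + h • e) - A₀ x| ≤ Lm * ε * h * (1 + ‖gradient f x‖) := by
      rw [(hAe _ hxs).2, (hAe _ hx2).2]
      have := hG.lip₀ _ hxs x hx2 _ (U x) (hUM _ hxs) (hUM x hx2) p' p (hgM _) (hgM _)
      rw [hdx, hnh] at this
      refine this.trans ?_
      have hL0 : 0 ≤ (L : ℝ) * ‖gradient f x‖ := by positivity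
      calc _ ≤ Lam * ε * (h + h * L + h * ‖gradient f x‖) := by gcongr
        _ ≤ Lam * ε * (h * (1 + L) * (1 + ‖gradient f x‖)) := by
            have : 0 ≤ h * (L * ‖gradient f x‖) := by positivity
            gcongr
            nlinarith
        _ = _ := by rw [hLm]; ring
    have b5 : ‖gradient η x‖ ≤ D := norm_gradient_le hηL x
    have key := cacc_pointwise hlam hLm0 hε hε1 hh (hη0 x) (hη1 x) (hf0 x) hD1 b5 b1 b2 b3 b4
    rw [e1, hgψ]
    refine le_trans ?_ key
    simp only [hE]
    refine mul_le_mul_of_nonneg_left (sub_le_sub_left (mul_le_mul_of_nonneg_left ?_ hCq0) _) hh.le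
    have hXle : ε + f x * D ≤ 2 * (H / d) := by
      have i1 : f x * D ≤ H / d := by
        rw [div_eq_mul_inv]; exact mul_le_mul_of_nonneg_right (hfH x hx) (by positivity)
      have i2 : H ≤ H / d := by
        rw [div_eq_mul_inv]; exact le_mul_of_one_le_right hH0.le hD1
      linarith
    have : 0 ≤ f x * D := mul_nonneg (hf0 x) (by positivity)
    exact pow_le_pow_left₀ (by positivity) hXle 2
  have hηfi : IntegrableOn (fun x => η x ^ 2 * ‖gradient f x‖ ^ 2) S := by
    refine integrableOn_of_bounded hSf (C := 1 * (Kf : ℝ) ^ 2) ?_ (.of_forall fun x => ?_)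
    · exact ((hηL.continuous.measurable.pow_const 2).mul
        ((measurable_gradient f).norm.pow_const 2)).aestronglyMeasurable
    · rw [abs_of_nonneg (by positivity)]
      exact mul_le_mul (pow_le_one₀ (hη0 x) (hη1 x))
        (pow_le_pow_left₀ (norm_nonneg _) (norm_gradient_le hfL x) 2) (by positivity) zero_le_one
  have hci : IntegrableOn (fun _ : Eucl n => Cq * (2 * (H / d)) ^ 2) S := integrableOn_const hSf
  have hEi : IntegrableOn E S := ((hηfi.const_mul (lam / 2)).sub hci).const_mul h
  have hInt : ∫ x in S, E x ≤ 0 := by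
    refine le_trans ?_ hdiff
    rw [← Set.inter_eq_right.2 hS1, ← setIntegral_indicator hSm]
    refine integral_mono_ae ((integrable_indicator_iff hSm).2 hEi).integrableOn ?_
      ((ae_restrict_iff' measurableSet_ball).2 hpt)
    refine (hi2.sub hi1).congr (.of_forall fun y => ?_)
    simp only [inner_sub_left, Pi.sub_apply]; ring
  have hInt2 : ∫ x in S, E x = h * (lam / 2 * (∫ x in S, η x ^ 2 * ‖gradient f x‖ ^ 2) -
      Cq * (2 * (H / d)) ^ 2 * volume.real S) := by
    rw [hE, integral_const_mul, integral_sub (hηfi.const_mul (lam / 2)) hci, integral_const_mul,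
      setIntegral_const, smul_eq_mul, mul_comm (volume.real S)]
  rw [hInt2] at hInt
  have hfin : lam / 2 * (∫ x in S, η x ^ 2 * ‖gradient f x‖ ^ 2) ≤
      Cq * (2 * (H / d)) ^ 2 * volume.real S := by
    by_contra! hc
    have h7 := mul_pos hh (sub_pos.2 hc)
    linarith
  have hleft : ∫ x in ball (0 : Eucl n) ρ, ‖gradient f x‖ ^ 2 ≤
      ∫ x in S, η x ^ 2 * ‖gradient f x‖ ^ 2 := by
    have hz : ∀ x ∉ S, x ∈ ball (0 : Eucl n) ρ → gradient f x = 0 := fun x hx hxρ => by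
      refine gradient_eq_zero_of_nonneg hf0 (trunc_eq_zero (not_lt.1 fun h' => hx ⟨h', ?_⟩))
      exact ball_subset_ball (by linarith) hxρ
    have h1 : ∫ x in ball (0 : Eucl n) ρ, ‖gradient f x‖ ^ 2 =
        ∫ x in ball (0 : Eucl n) ρ ∩ S, ‖gradient f x‖ ^ 2 :=
      (setIntegral_eq_of_subset_of_forall_sdiff_eq_zero measurableSet_ball Set.inter_subset_left
        fun x hx => by
          rw [hz x (fun h' => hx.2 ⟨hx.1, h'⟩) hx.1]; simp)
    rw [h1]
    calc _ = ∫ x in ball (0 : Eucl n) ρ ∩ S, η x ^ 2 * ‖gradient f x‖ ^ 2 := by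
          refine setIntegral_congr_fun (measurableSet_ball.inter hSm) fun x hx => ?_
          have : η x = 1 := cutoff_eq_one hd (mem_ball_zero_iff.1 hx.1).le
          simp [this]
      _ ≤ _ := setIntegral_mono_set hηfi (.of_forall fun x => by positivity)
          (LE.le.eventuallyLE Set.inter_subset_right)
  refine hleft.trans ?_
  have : caccConst lam Lam L * (H / d) ^ 2 * volume.real S =
      2 / lam * (Cq * (2 * (H / d)) ^ 2 * volume.real S) := by
    rw [caccConst, ← hLm, ← hCq]; ring
  rw [this]
  calc _ = 2 / lam * (lam / 2 * ∫ x in S, η x ^ 2 * ‖gradient f x‖ ^ 2) := by field_simp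
    _ ≤ _ := by gcongr

lemma diffQuot_decay (n : ℕ) {lam Lam M μ : ℝ} (hlam : 0 < lam) (hLam : 0 ≤ Lam) (L : ℝ≥0)
    (hM : 2 * L ≤ M) (hμ : 0 < μ) :
    ∃ γ : ℝ, 0 < γ ∧ γ < 1 ∧ ∀ (ε : ℝ) (G : Eucl n → ℝ → Eucl n → Eucl n)
      (G₀ : Eucl n → ℝ → Eucl n → ℝ) (U : Eucl n → ℝ), Coeffs lam Lam M ε G G₀ →
      UnitSol G G₀ L U → ∀ (e : Eucl n) (h s : ℝ), ‖e‖ = 1 → e (Fin.last n) = 0 → 0 < h → h ≤ 1 →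
      0 < s → ε ≤ s * γ / 2 → (∀ x ∈ ball (0 : Eucl n) 1, diffQuot h e U x ≤ s) →
      μ ≤ volume.real ({x | diffQuot h e U x ≤ s / 2} ∩ ball (0 : Eucl n) (1 / 2)) →
      ∀ x ∈ ball (0 : Eucl n) (1 / 4), diffQuot h e U x ≤ s * (1 - γ / 2) := by
  obtain ⟨γ, hγ0, hγ1, H⟩ := deGiorgi_decay n (caccConst_nonneg hlam hLam L.coe_nonneg) hμ
  refine ⟨γ, hγ0, hγ1, fun ε G G₀ U hG hU e h s he he0 hh hh1 hs hε hw hm x hx => ?_⟩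
  set w := diffQuot h e U with hwdef
  obtain ⟨K, hwL⟩ : ∃ K, LipschitzWith K w := ⟨_, lipschitzWith_diffQuot hU.lip hh e⟩
  have hvL : LipschitzWith (⟨2 / s, by positivity⟩ * K) fun x => 2 / s * w x - 1 :=
    LipschitzWith.of_dist_le_mul fun x y => by
      have := hwL.dist_le_mul x y
      rw [Real.dist_eq] at this ⊢
      rw [sub_sub_sub_cancel_right, ← mul_sub, abs_mul, abs_of_pos (by positivity : 0 < 2 / s)]
      change _ ≤ 2 / s * K * _
      rw [mul_assoc]
      gcongr
  have hiff : ∀ y a, 2 / s * w y - 1 ≤ a ↔ w y ≤ s * (1 + a) / 2 := fun y a => by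
    rw [sub_le_iff_le_add, div_mul_eq_mul_div, div_le_iff₀ hs]
    constructor <;> intro h <;> linarith
  have key := H _ _ hvL (fun y hy => (hiff y 1).2 (by linarith [hw y hy])) ?_ ?_ x hx
  · have := (hiff x _).1 key
    linarith
  · intro κ hκ0 hκ1 ρ d hρ hd hρd
    have hκH : s * γ / 2 ≤ s * (1 - κ) / 2 := by
      have : γ ≤ 1 - κ := by linarith
      gcongr
    have h1 := caccioppoli hG hU hM he he0 hh hh1 (κ := s * (1 + κ) / 2) (H := s * (1 - κ) / 2)
      (by positivity) (hε.trans hκH) (lt_of_lt_of_le (by positivity) hκH)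
      (fun y hy => by linarith [hw y hy]) hρ hd hρd
    have hset : {y | κ < 2 / s * w y - 1} = {y | s * (1 + κ) / 2 < w y} := by
      ext y
      exact not_iff_not.1 (by simpa using hiff y κ)
    have htr : trunc (fun x => 2 / s * w x - 1) κ =
        fun y => 2 / s * trunc w (s * (1 + κ) / 2) y := by
      ext y
      rw [trunc, trunc, mul_max_of_nonneg _ _ (by positivity), mul_zero]
      congr 1
      field_simp
      ring
    rw [htr, hset]
    have h2 : ∀ y, ‖gradient (fun y => 2 / s * trunc w (s * (1 + κ) / 2) y) y‖ ^ 2 =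
        (2 / s) ^ 2 * ‖gradient (trunc w (s * (1 + κ) / 2)) y‖ ^ 2 := fun y => by
      rw [gradient_const_mul, norm_smul, mul_pow, Real.norm_eq_abs, sq_abs]
    simp only [h2]
    rw [integral_const_mul]
    refine (mul_le_mul_of_nonneg_left h1 (by positivity)).trans_eq ?_
    rw [← hwdef, show ((1 - κ) / d) ^ 2 = (2 / s) ^ 2 * (s * (1 - κ) / 2 / d) ^ 2 by field_simp]
    ring
  · convert hm using 5
    rw [hiff]; simp

lemma diffQuot_density {G : Eucl n → ℝ → Eucl n → Eucl n} {G₀ : Eucl n → ℝ → Eucl n → ℝ}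
    {L : ℝ≥0} {U : Eucl n → ℝ} (hU : UnitSol G G₀ L U) (hL : 0 < L) {e : Eucl n} (he : ‖e‖ = 1)
    (he0 : e (Fin.last n) = 0) {h : ℝ} (hh : 0 < h) (hh1 : h ≤ 1 / 8) {S s : ℝ} (hS : 0 < S)
    (hSs : S ≤ s) (hsL : s ≤ L) :
    S / (8 * L) * volume.real (ball (0 : Eucl n) (S / (64 * L))) ≤
      volume.real ({x | diffQuot h e U x ≤ s / 2} ∩ ball (0 : Eucl n) (1 / 2)) := by
  have hL' : (0 : ℝ) < L := hL
  set δ := S / (64 * L) with hδ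
  have hδ0 : 0 < δ := by positivity
  have hLδ : L * δ = S / 64 := by rw [hδ]; field_simp
  have hδ1 : δ ≤ 1 / 4 := by
    rw [hδ, div_le_iff₀ (by positivity)]; linarith
  set w := diffQuot h e U with hw
  obtain ⟨K, hwL⟩ : ∃ K, LipschitzWith K w := ⟨_, lipschitzWith_diffQuot hU.lip hh e⟩
  have hwU : ∀ x, h * w x = U (x + h • e) - U x := fun x => by
    rw [hw, diffQuot]; field_simp
  set B := volume.real (ball (0 : Eucl n) δ) with hB
  have hB0 : 0 < B := volume_real_ball_pos hδ0
  obtain ⟨m, hm1, hm2⟩ : ∃ m : ℕ, 1 / 8 ≤ m * h ∧ m * h ≤ 1 / 4 := by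
    refine ⟨⌊1 / (4 * h)⌋₊, ?_, ?_⟩
    · have := Nat.lt_floor_add_one (1 / (4 * h))
      rw [div_lt_iff₀ (by positivity)] at this
      linarith
    · have := Nat.floor_le (show 0 ≤ 1 / (4 * h) by positivity)
      rw [le_div_iff₀ (by positivity)] at this
      linarith
  have hInt : ∀ {f : Eucl n → ℝ}, Continuous f → ∀ a : Eucl n,
      IntegrableOn (fun y => f (y - a)) (ball (0 : Eucl n) δ) := fun hf a =>
    ((hf.comp (continuous_id.sub continuous_const)).locallyIntegrable.integrableOn_isCompact
      (isCompact_closedBall 0 δ)).mono_set ball_subset_closedBall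
  set I : ℕ → ℝ := fun j => ∫ y in ball (0 : Eucl n) δ, U (y - (j * h) • e) with hI
  have hUint := fun j : ℕ => hInt hU.lip.continuous ((j * h) • e)
  have hcst : ∀ c : ℝ, IntegrableOn (fun _ : Eucl n => c) (ball (0 : Eucl n) δ) := fun c =>
    integrableOn_const measure_ball_lt_top.ne
  have hI0 : I 0 ≤ S / 64 * B := by
    have : I 0 ≤ ∫ _ in ball (0 : Eucl n) δ, S / 64 := by
      refine setIntegral_mono_on (hUint 0) (hcst _) measurableSet_ball fun y hy => ?_
      simp only [Nat.cast_zero, zero_mul, zero_smul, sub_zero]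
      rw [mem_ball_zero_iff] at hy
      have := (abs_le.1 (hU.abs_le y)).2
      rw [← hLδ]
      exact this.trans (by gcongr)
    rwa [setIntegral_const, smul_eq_mul, mul_comm] at this
  have hIm : -(S / 64) * B ≤ I m := by
    have : ∫ _ in ball (0 : Eucl n) δ, -(S / 64) ≤ I m := by
      refine setIntegral_mono_on (hcst _) (hUint m) measurableSet_ball fun y hy => ?_
      rw [mem_ball_zero_iff] at hy
      set x := y - (m * h) • e with hx
      set x' := x - (x (Fin.last n)) • eLast n with hx'
      have hxl : x (Fin.last n) = y (Fin.last n) := by simp [hx, he0]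
      have hyl : |y (Fin.last n)| ≤ ‖y‖ := by
        simpa using PiLp.norm_apply_le y (Fin.last n)
      have hel : ‖eLast n‖ = 1 := by simp [eLast]
      have hdist : dist x x' ≤ δ := by
        rw [dist_eq_norm, hx', sub_sub_cancel, norm_smul, hel, mul_one, hxl, Real.norm_eq_abs]
        exact hyl.trans hy.le
      have hxn : ‖x‖ ≤ 1 / 2 := by
        refine (norm_sub_le _ _).trans ?_
        rw [norm_smul, he, mul_one, Real.norm_eq_abs, abs_of_nonneg (by positivity)]
        linarith
      have h0 : 0 ≤ U x' := by
        refine hU.nonneg x' ?_ (by simp [hx', eLast])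
        rw [mem_ball_zero_iff]
        have : ‖x'‖ ≤ ‖x‖ + dist x x' := by
          rw [dist_comm, dist_eq_norm]
          simpa using norm_add_le x (x' - x)
        linarith
      have h1 := hU.lip.dist_le_mul x x'
      rw [Real.dist_eq] at h1
      have h2 : L * dist x x' ≤ L * δ := by gcongr
      have := (abs_le.1 (h1.trans h2)).1
      rw [hLδ] at this
      linarith
    rwa [setIntegral_const, smul_eq_mul, mul_comm] at this
  have hm0 : 0 < m := by
    rcases Nat.eq_zero_or_pos m with h0 | h0
    · rw [h0] at hm1; norm_num at hm1
    · exact h0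
  obtain ⟨j, hjm, hj⟩ : ∃ j ∈ Finset.range m, I j - I (j + 1) ≤ S / 32 * B / m := by
    refine Finset.exists_le_of_sum_le (by simpa using hm0.ne') ?_
    rw [Finset.sum_range_sub', Finset.sum_const, Finset.card_range, nsmul_eq_mul]
    have : (m : ℝ) ≠ 0 := by positivity
    rw [mul_div_cancel₀ _ this]
    linarith
  set a := ((j + 1 : ℕ) * h) • e with ha
  have hwa : ∫ y in ball (0 : Eucl n) δ, w (y - a) ≤ S / 4 * B := by
    have h1 : h * ∫ y in ball (0 : Eucl n) δ, w (y - a) = I j - I (j + 1) := by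
      rw [← integral_const_mul, hI, ← integral_sub (hUint j) (hUint (j + 1))]
      refine integral_congr_ae (.of_forall fun y => ?_)
      have : y - a + h • e = y - (j * h) • e := by
        rw [ha]; push_cast; module
      simp only [hwU, this]
      rw [ha]
    have h2 : h * ∫ y in ball (0 : Eucl n) δ, w (y - a) ≤ h * (S / 4 * B) := by
      rw [h1]
      refine hj.trans ?_
      rw [div_le_iff₀ (by positivity)]
      have : S / 4 * B * (1 / 8) ≤ S / 4 * B * (m * h) := by gcongr
      linarith
    exact le_of_mul_le_mul_left h2 hh
  set A' := {y | w (y - a) ≤ s / 2} ∩ ball (0 : Eucl n) δ with hA'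
  have hA'm : MeasurableSet A' :=
    ((isClosed_le (hwL.continuous.comp (continuous_id.sub continuous_const))
      continuous_const).measurableSet).inter measurableSet_ball
  have hA'B : A' ⊆ ball (0 : Eucl n) δ := Set.inter_subset_right
  have hlow : s / 2 * B - 2 * L * volume.real A' ≤ ∫ y in ball (0 : Eucl n) δ, w (y - a) := by
    have hi : IntegrableOn (A'.indicator fun _ => 2 * (L : ℝ)) (ball (0 : Eucl n) δ) :=
      (hcst _).indicator hA'm
    have h1 : ∫ y in ball (0 : Eucl n) δ, (s / 2 - A'.indicator (fun _ => 2 * (L : ℝ)) y) ≤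
        ∫ y in ball (0 : Eucl n) δ, w (y - a) := by
      refine setIntegral_mono_on ((hcst _).sub hi) (hInt hwL.continuous a) measurableSet_ball
        fun y hy => ?_
      by_cases hyA : y ∈ A'
      · rw [Set.indicator_of_mem hyA]
        have := (abs_le.1 (abs_diffQuot_le hU.lip hh he (y - a))).1
        rw [← hw] at this
        linarith
      · rw [Set.indicator_of_notMem hyA]
        have : ¬ w (y - a) ≤ s / 2 := fun h' => hyA ⟨h', hy⟩
        linarith
    rw [integral_sub (hcst _) hi, setIntegral_const, setIntegral_indicator hA'm,
      setIntegral_const, Set.inter_eq_right.2 hA'B, smul_eq_mul, smul_eq_mul] at h1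
    linarith
  have hmeas : volume.real A' ≤
      volume.real ({x | w x ≤ s / 2} ∩ ball (0 : Eucl n) (1 / 2)) := by
    have hsub : A' ⊆ (fun y => y + -a) ⁻¹' ({x | w x ≤ s / 2} ∩ ball (0 : Eucl n) (1 / 2)) := by
      rintro y ⟨hy1, hy2⟩
      refine ⟨by simpa [sub_eq_add_neg] using hy1, ?_⟩
      rw [mem_ball_zero_iff] at *
      have hna : ‖a‖ ≤ 1 / 4 := by
        rw [ha, norm_smul, he, mul_one, Real.norm_eq_abs, abs_of_nonneg (by positivity)]
        refine le_trans ?_ hm2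
        have : j + 1 ≤ m := Finset.mem_range.1 hjm
        gcongr
      have := norm_add_le y (-a)
      rw [norm_neg] at this
      linarith
    have hfin : volume ({x | w x ≤ s / 2} ∩ ball (0 : Eucl n) (1 / 2)) ≠ ⊤ :=
      measure_ne_top_of_subset Set.inter_subset_right measure_ball_lt_top.ne
    refine ENNReal.toReal_mono hfin ((measure_mono hsub).trans_eq ?_)
    exact measure_preimage_add_right volume _ _
  have h5 : S / 4 * B ≤ 2 * L * volume.real A' := by
    have : S / 2 * B ≤ s / 2 * B := by gcongr
    linarith
  refine le_trans ?_ hmeas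
  rw [div_mul_eq_mul_div, div_le_iff₀ (by positivity)]
  linarith

/-- The rescalings of `u` at `z₀` are solutions whose coefficients obey uniform bounds. -/
structure RescalingFamily (lam Lam M r₀ : ℝ) (L : ℝ≥0) (G : ℝ → Eucl n → ℝ → Eucl n → Eucl n)
    (G₀ : ℝ → Eucl n → ℝ → Eucl n → ℝ) (u : Eucl n → ℝ) (z₀ : Eucl n) : Prop where
  radius_pos : 0 < r₀
  coeffs : ∀ r, 0 < r → r ≤ r₀ → Coeffs lam Lam M r (G r) (G₀ r)
  sol : ∀ r, 0 < r → r ≤ r₀ → UnitSol (G r) (G₀ r) L fun y => u (z₀ + r • y) / r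

section Tangential

variable {lam Lam M r₀ : ℝ} {L : ℝ≥0} {G : ℝ → Eucl n → ℝ → Eucl n → Eucl n}
  {G₀ : ℝ → Eucl n → ℝ → Eucl n → ℝ} {u : Eucl n → ℝ} {z₀ : Eucl n}

/-- Near `z₀` the increments of `u` in the direction `e` have slope at most `s`. -/
def SlopeLE (u : Eucl n → ℝ) (z₀ e : Eucl n) (s : ℝ) : Prop :=
  ∃ r > 0, ∀ (x : Eucl n) (h : ℝ), 0 < h → x ∈ ball z₀ r → x + h • e ∈ ball z₀ r →
    u (x + h • e) - u x ≤ s * h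

lemma SlopeLE.mono {e : Eucl n} {s s' : ℝ} (h : SlopeLE u z₀ e s) (hs : s ≤ s') :
    SlopeLE u z₀ e s' := by
  obtain ⟨r, hr, H⟩ := h
  exact ⟨r, hr, fun x t ht hx hx' => (H x t ht hx hx').trans (by gcongr)⟩

lemma RescalingFamily.slope_decay (hfam : RescalingFamily lam Lam M r₀ L G G₀ u z₀)
    (hL : 0 < L) (hM : 2 * L ≤ M) {S : ℝ} (hS : 0 < S) :
    ∃ γ : ℝ, 0 < γ ∧ γ < 1 ∧ ∀ (e : Eucl n) (s : ℝ), ‖e‖ = 1 → e (Fin.last n) = 0 →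
      S ≤ s → s ≤ L → SlopeLE u z₀ e s → SlopeLE u z₀ e (s * (1 - γ / 2)) := by
  have hL' : (0 : ℝ) < L := hL
  have hr₀ := hfam.radius_pos
  have hc₀ := hfam.coeffs r₀ hr₀ le_rfl
  have hμ : 0 < S / (8 * L) * volume.real (ball (0 : Eucl n) (S / (64 * L))) :=
    mul_pos (by positivity) (volume_real_ball_pos (by positivity))
  obtain ⟨γ, hγ0, hγ1, H⟩ := diffQuot_decay n hc₀.lam_pos hc₀.Lam_nonneg L hM hμ
  refine ⟨γ, hγ0, hγ1, fun e s he he0 hSs hsL hs => ?_⟩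
  have hs0 : 0 < s := hS.trans_le hSs
  obtain ⟨r₁, hr₁, Hs⟩ := hs
  obtain ⟨r, hr0, hrr₀, hrr₁, hrγ⟩ : ∃ r, 0 < r ∧ r ≤ r₀ ∧ 2 * r ≤ r₁ ∧ r ≤ s * γ / 2 :=
    ⟨min r₀ (min (r₁ / 2) (s * γ / 2)), by positivity, min_le_left _ _,
      by linarith [(min_le_right r₀ (min (r₁ / 2) (s * γ / 2))).trans (min_le_left _ _)],
      (min_le_right _ _).trans (min_le_right _ _)⟩
  have hU := hfam.sol r hr0 hrr₀
  set U : Eucl n → ℝ := fun y => u (z₀ + r • y) / r with hUdef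
  have hdq : ∀ (y : Eucl n) (h : ℝ), 0 < h →
      diffQuot h e U y = (u (z₀ + r • y + (r * h) • e) - u (z₀ + r • y)) / (r * h) :=
    fun y h hh => by
      rw [diffQuot, hUdef]
      simp only [smul_add, smul_smul, add_assoc]
      field_simp
  have hw : ∀ h : ℝ, 0 < h → h ≤ 1 / 8 → ∀ y ∈ ball (0 : Eucl n) (1 / 4),
      diffQuot h e U y ≤ s * (1 - γ / 2) := by
    intro h hh hh1
    refine H r (G r) (G₀ r) U (hfam.coeffs r hr0 hrr₀) hU e h s he he0 hh (by linarith) hs0 hrγ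
      (fun y hy => ?_) (diffQuot_density hU hL he he0 hh hh1 hS hSs hsL)
    rw [mem_ball_zero_iff] at hy
    rw [hdq y h hh, div_le_iff₀ (by positivity)]
    refine Hs _ _ (by positivity) ?_ ?_
    · rw [mem_ball_iff_norm, add_sub_cancel_left, norm_smul, Real.norm_eq_abs, abs_of_pos hr0]
      nlinarith
    · rw [mem_ball_iff_norm, add_assoc, add_sub_cancel_left]
      refine (norm_add_le _ _).trans_lt ?_
      rw [norm_smul, norm_smul, he, Real.norm_eq_abs, abs_of_pos hr0, Real.norm_eq_abs,
        abs_of_pos (by positivity)]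
      nlinarith
  refine ⟨r / 4, by positivity, fun x h hh hx hxh => ?_⟩
  have hh2 : h ≤ r / 2 := by
    have : ‖h • e‖ < r / 4 + r / 4 := by
      have h1 : h • e = (x + h • e - z₀) - (x - z₀) := by abel
      rw [h1]
      rw [mem_ball_iff_norm] at hx hxh
      exact (norm_sub_le _ _).trans_lt (by linarith)
    rw [norm_smul, he, mul_one, Real.norm_eq_abs, abs_of_pos hh] at this
    linarith
  have hstep : ∀ θ : ℝ, 0 ≤ θ → θ ≤ 1 →
      u (x + θ • (h • e) + (h / 4) • e) - u (x + θ • (h • e)) ≤ s * (1 - γ / 2) * (h / 4) := by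
    intro θ h0 h1
    have hmem := (convex_ball z₀ (r / 4)).add_smul_mem hx hxh ⟨h0, h1⟩
    set p := x + θ • (h • e) with hp
    have hy : r⁻¹ • (p - z₀) ∈ ball (0 : Eucl n) (1 / 4) := by
      rw [mem_ball_iff_norm] at hmem
      rw [mem_ball_zero_iff, norm_smul, norm_inv, Real.norm_eq_abs, abs_of_pos hr0,
        inv_mul_lt_iff₀ hr0]
      linarith
    have hrh : 0 < h / 4 / r := by positivity
    have h8 : h / 4 / r ≤ 1 / 8 := by rw [div_le_iff₀ hr0]; linarith
    have := hw _ hrh h8 _ hy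
    have e1 : z₀ + r • r⁻¹ • (p - z₀) = p := by
      rw [smul_inv_smul₀ hr0.ne']; abel
    have e2 : r * (h / 4 / r) = h / 4 := by field_simp
    rwa [hdq _ _ hrh, e1, e2, div_le_iff₀ (by positivity)] at this
  have s0 := hstep 0 le_rfl zero_le_one
  have s1 := hstep (1 / 4) (by norm_num) (by norm_num)
  have s2 := hstep (1 / 2) (by norm_num) (by norm_num)
  have s3 := hstep (3 / 4) (by norm_num) (by norm_num)
  rw [show x + (0 : ℝ) • (h • e) + (h / 4) • e = x + (1 / 4 : ℝ) • (h • e) by module,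
    zero_smul, add_zero] at s0
  rw [show x + (1 / 4 : ℝ) • (h • e) + (h / 4) • e = x + (1 / 2 : ℝ) • (h • e) by module] at s1
  rw [show x + (1 / 2 : ℝ) • (h • e) + (h / 4) • e = x + (3 / 4 : ℝ) • (h • e) by module] at s2
  rw [show x + (3 / 4 : ℝ) • (h • e) + (h / 4) • e = x + h • e by module] at s3
  linarith

/-- The tangential increments of `u` near a free boundary point are of lower order. -/
theorem RescalingFamily.slope_small (hfam : RescalingFamily lam Lam M r₀ L G G₀ u z₀)
    (hL : 0 < L) (hM : 2 * L ≤ M) (hu : LipschitzWith L u) {e : Eucl n} (he : ‖e‖ = 1)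
    (he0 : e (Fin.last n) = 0) {S : ℝ} (hS : 0 < S) : SlopeLE u z₀ e S := by
  have hbase : SlopeLE u z₀ e L := ⟨1, one_pos, fun x h hh _ _ => by
    have := hu.dist_le_mul (x + h • e) x
    rw [dist_eq_norm (x + h • e), add_sub_cancel_left, norm_smul, he, mul_one, Real.norm_eq_abs,
      abs_of_pos hh] at this
    exact (le_abs_self _).trans this⟩
  rcases le_or_gt (L : ℝ) S with hSL | hSL
  · exact hbase.mono hSL
  obtain ⟨γ, hγ0, hγ1, H⟩ := hfam.slope_decay hL hM hS
  set q := 1 - γ / 2 with hq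
  have hq0 : 0 ≤ q := by linarith
  have hq1 : q < 1 := by linarith
  have hiter : ∀ k : ℕ, SlopeLE u z₀ e (max S (L * q ^ k)) := by
    intro k
    induction k with
    | zero => simpa using hbase.mono (le_max_right S (L : ℝ))
    | succ k ih =>
      have hk : L * q ^ k ≤ L := mul_le_of_le_one_right L.2 (pow_le_one₀ hq0 hq1.le)
      refine (H e _ he he0 (le_max_left _ _) (max_le hSL.le hk) ih).mono ?_
      rw [max_mul_of_nonneg _ _ hq0, pow_succ, ← mul_assoc]
      exact max_le_max (mul_le_of_le_one_right hS.le hq1.le) le_rfl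
  have hlim : Tendsto (fun k : ℕ => L * q ^ k) atTop (𝓝 0) := by
    simpa using (tendsto_pow_atTop_nhds_zero_of_lt_one hq0 hq1).const_mul (L : ℝ)
  obtain ⟨k, hk⟩ := (hlim.eventually (gt_mem_nhds hS)).exists
  simpa [max_eq_left hk.le] using hiter k

end Tangential

lemma lipschitzWith_indicator_ball {f : Eucl n → ℝ} {K : ℝ≥0} {x₀ : Eucl n} {ρ : ℝ}
    (hf : LipschitzOnWith K f (closedBall x₀ ρ)) (h0 : ∀ x ∈ sphere x₀ ρ, f x = 0) :
    LipschitzWith K ((ball x₀ ρ).indicator f) := by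
  have key : ∀ x ∈ ball x₀ ρ, ∀ y ∉ ball x₀ ρ, |f x| ≤ K * dist x y := by
    intro x hx y hy
    have hc : ContinuousOn (fun t : ℝ => dist (x + t • (y - x)) x₀) (Set.Icc 0 1) := by fun_prop
    have := intermediate_value_Icc zero_le_one hc
    obtain ⟨t, ht, htρ⟩ := this (show ρ ∈ _ from
      ⟨by simpa using (mem_ball.1 hx).le, by simpa using hy⟩)
    have hz : x + t • (y - x) ∈ sphere x₀ ρ := htρ
    have h1 := hf.dist_le_mul x (ball_subset_closedBall hx) _ (sphere_subset_closedBall hz)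
    rw [h0 _ hz, Real.dist_eq, sub_zero] at h1
    refine h1.trans (mul_le_mul_of_nonneg_left ?_ K.2)
    rw [dist_eq_norm, sub_add_cancel_left, norm_neg, norm_smul, Real.norm_eq_abs,
      abs_of_nonneg ht.1, dist_comm, dist_eq_norm]
    exact mul_le_of_le_one_left (norm_nonneg _) ht.2
  refine LipschitzWith.of_dist_le_mul fun x y => ?_
  by_cases hx : x ∈ ball x₀ ρ <;> by_cases hy : y ∈ ball x₀ ρ
  · rw [Set.indicator_of_mem hx, Set.indicator_of_mem hy]
    exact hf.dist_le_mul x (ball_subset_closedBall hx) y (ball_subset_closedBall hy)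
  · rw [Set.indicator_of_mem hx, Set.indicator_of_notMem hy, Real.dist_eq, sub_zero]
    exact key x hx y hy
  · rw [Set.indicator_of_notMem hx, Set.indicator_of_mem hy, dist_comm, Real.dist_eq, sub_zero,
      dist_comm]
    exact key y hy x hx
  · rw [Set.indicator_of_notMem hx, Set.indicator_of_notMem hy, dist_self]
    positivity

lemma inner_gradient_le {Z : Eucl n → ℝ} {x e : Eucl n} {B : ℝ} (hd : DifferentiableAt ℝ Z x)
    (hB : ∀ᶠ h : ℝ in 𝓝[>] 0, Z (x + h • e) - Z x ≤ B * h) : ⟪gradient Z x, e⟫_ℝ ≤ B := by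
  have h1 : HasDerivAt (fun t : ℝ => Z (x + t • e)) ⟪gradient Z x, e⟫_ℝ 0 := by
    have := (hd.hasGradientAt.hasFDerivAt).hasLineDerivAt e
    rwa [InnerProductSpace.toDual_apply_apply] at this
  have h2 := h1.tendsto_slope_zero_right
  refine le_of_tendsto h2 ?_
  filter_upwards [hB, self_mem_nhdsWithin] with h hh (h0 : 0 < h)
  rw [zero_add, zero_smul, add_zero, smul_eq_mul, inv_mul_le_iff₀ h0]
  linarith

/-- Integration by parts against a nonnegative function supported in a ball, with a one-sided
bound on the difference quotients. -/
lemma neg_le_setIntegral_mul_inner_gradient {Z φ : Eucl n → ℝ} {K K' : ℝ≥0} {x₀ : Eucl n} {ρ : ℝ}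
    (hZ : LipschitzOnWith K Z (ball x₀ ρ)) (hφ : LipschitzWith K' φ) (h0 : ∀ x, 0 ≤ φ x)
    (hφ0 : ∀ x ∉ ball x₀ ρ, φ x = 0) {e : Eucl n} {B : ℝ}
    (hB : ∀ x ∈ ball x₀ ρ, ∀ h : ℝ, 0 < h → x + h • e ∈ ball x₀ ρ → Z (x + h • e) - Z x ≤ B * h) :
    -B * ∫ x in ball x₀ ρ, φ x ≤ ∫ x in ball x₀ ρ, Z x * ⟪gradient φ x, e⟫_ℝ := by
  obtain ⟨Z', hZ', heq⟩ := hZ.extend_real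
  have hcs : HasCompactSupport φ := HasCompactSupport.intro (isCompact_closedBall x₀ ρ)
    fun x hx => hφ0 x fun h => hx (ball_subset_closedBall h)
  have ibp := hZ'.integral_lineDeriv_mul_eq (μ := volume) hφ hcs e
  have hg0 : ∀ x ∉ ball x₀ ρ, gradient φ x = 0 := fun x hx =>
    gradient_eq_zero_of_nonneg h0 (hφ0 x hx)
  have h1 : ∫ x, lineDeriv ℝ φ x (-e) * Z' x = -∫ x in ball x₀ ρ, Z x * ⟪gradient φ x, e⟫_ℝ := by
    rw [← integral_neg]
    have : ∫ x in ball x₀ ρ, -(Z x * ⟪gradient φ x, e⟫_ℝ) =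
        ∫ x in ball x₀ ρ, -(Z' x * ⟪gradient φ x, e⟫_ℝ) :=
      setIntegral_congr_fun measurableSet_ball fun x hx => by simp only [heq hx]
    rw [this, setIntegral_eq_integral_of_forall_compl_eq_zero fun x hx => by simp [hg0 x hx]]
    refine integral_congr_ae ?_
    filter_upwards [hφ.ae_differentiableAt] with x hx
    have := (hx.hasGradientAt.hasFDerivAt).hasLineDerivAt (-e)
    rw [this.lineDeriv]
    simp only [map_neg, InnerProductSpace.toDual_apply_apply]
    ring
  have h2 : ∫ x, lineDeriv ℝ Z' x e * φ x = ∫ x in ball x₀ ρ, ⟪gradient Z' x, e⟫_ℝ * φ x := by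
    rw [setIntegral_eq_integral_of_forall_compl_eq_zero fun x hx => by simp [hφ0 x hx]]
    refine integral_congr_ae ?_
    filter_upwards [hZ'.ae_differentiableAt] with x hx
    rw [((hx.hasGradientAt.hasFDerivAt).hasLineDerivAt e).lineDeriv]
    simp
  obtain ⟨C, hC⟩ := hcs.exists_bound_of_continuous hφ.continuous
  have h3 : ∫ x in ball x₀ ρ, ⟪gradient Z' x, e⟫_ℝ * φ x ≤ ∫ x in ball x₀ ρ, B * φ x := by
    refine integral_mono_ae ?_ ?_ ?_
    · refine integrableOn_of_bounded measure_ball_lt_top.ne (C := K * ‖e‖ * C) ?_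
        (.of_forall fun x => ?_)
      · exact (((measurable_gradient Z').inner measurable_const).mul
          hφ.continuous.measurable).aestronglyMeasurable
      · rw [abs_mul]
        exact mul_le_mul ((abs_real_inner_le_norm _ _).trans
          (mul_le_mul_of_nonneg_right (norm_gradient_le hZ' x) (norm_nonneg _))) (hC x)
          (abs_nonneg _) (by positivity)
    · exact (hφ.continuous.integrable_of_hasCompactSupport hcs).integrableOn.const_mul B
    · refine (ae_restrict_iff' measurableSet_ball).2 ?_
      filter_upwards [hZ'.ae_differentiableAt] with x hx hxb
      refine mul_le_mul_of_nonneg_right (inner_gradient_le hx ?_) (h0 x)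
      have hcont : Tendsto (fun h : ℝ => x + h • e) (𝓝[>] 0) (𝓝 x) := by
        have : Continuous fun h : ℝ => x + h • e := by fun_prop
        simpa using (this.tendsto 0).mono_left nhdsWithin_le_nhds
      filter_upwards [hcont (isOpen_ball.mem_nhds hxb), self_mem_nhdsWithin] with h hh h0
      rw [← heq hxb, ← heq hh]
      exact hB x hxb h h0 hh
  rw [integral_const_mul] at h3
  rw [h1, h2] at ibp
  linarith

/-- A quadratic barrier, of opposite convexity in the normal and in the tangential directions. -/
def barrier (s δ D m b : ℝ) (c x : Eucl n) : ℝ :=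
  s * (δ / 2 * ‖x - c‖ ^ 2 - (D + δ) / 2 * ((x - c) (Fin.last n)) ^ 2) + m * x (Fin.last n) + b

/-- The gradient of `barrier`. -/
def barrierGrad (s δ D m : ℝ) (c x : Eucl n) : Eucl n :=
  s • (δ • (x - c) - ((D + δ) * (x - c) (Fin.last n)) • eLast n) + m • eLast n

lemma norm_eLast : ‖eLast n‖ = 1 := by simp [eLast]

lemma inner_eLast (x : Eucl n) : ⟪eLast n, x⟫_ℝ = x (Fin.last n) := by
  simp [eLast, EuclideanSpace.inner_single_left]

lemma abs_last_le (x : Eucl n) : |x (Fin.last n)| ≤ ‖x‖ := by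
  simpa using PiLp.norm_apply_le x (Fin.last n)

lemma hasGradientAt_barrier (s δ D m b : ℝ) (c x : Eucl n) :
    HasGradientAt (barrier s δ D m b c) (barrierGrad s δ D m c x) x := by
  rw [hasGradientAt_iff_hasFDerivAt]
  have h1 : HasFDerivAt (fun y : Eucl n => y - c) (ContinuousLinearMap.id ℝ _) x :=
    (hasFDerivAt_id x).sub_const c
  have h2 := h1.norm_sq
  have h3 : HasFDerivAt (fun y : Eucl n => y (Fin.last n))
      (EuclideanSpace.proj (𝕜 := ℝ) (Fin.last n)) x :=
    (EuclideanSpace.proj (𝕜 := ℝ) (Fin.last n) : Eucl n →L[ℝ] ℝ).hasFDerivAt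
  have h4 : HasFDerivAt (fun y : Eucl n => (y - c) (Fin.last n))
      (EuclideanSpace.proj (𝕜 := ℝ) (Fin.last n)) x := by
    simpa using h3.sub_const (c (Fin.last n))
  have h5 := ((((h2.const_mul (δ / 2)).sub ((h4.pow 2).const_mul ((D + δ) / 2))).const_mul s).add
    (h3.const_mul m)).add_const b
  refine h5.congr_fderiv ?_
  ext y
  simp only [barrierGrad, InnerProductSpace.toDual_apply_apply, inner_add_left, inner_sub_left,
    real_inner_smul_left, inner_eLast]
  simp
  left
  ring

lemma barrierGrad_sub (s δ D m : ℝ) (c x y : Eucl n) :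
    barrierGrad s δ D m c x - barrierGrad s δ D m c y =
      s • (δ • (x - y) - ((D + δ) * (x - y) (Fin.last n)) • eLast n) := by
  simp only [barrierGrad, PiLp.sub_apply]
  module

lemma norm_barrierGrad_sub_le {s δ D : ℝ} (hs : |s| = 1) (hδ : 0 ≤ δ) (hD : 0 ≤ D) (m : ℝ)
    (c x y : Eucl n) :
    ‖barrierGrad s δ D m c x - barrierGrad s δ D m c y‖ ≤ (D + 2 * δ) * ‖x - y‖ := by
  rw [barrierGrad_sub, norm_smul, Real.norm_eq_abs, hs, one_mul]
  refine (norm_sub_le _ _).trans ?_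
  rw [norm_smul, norm_smul, norm_eLast, mul_one, Real.norm_eq_abs, Real.norm_eq_abs, abs_mul,
    abs_of_nonneg hδ, abs_of_nonneg (by positivity)]
  have : (D + δ) * |(x - y) (Fin.last n)| ≤ (D + δ) * ‖x - y‖ := by
    gcongr; exact abs_last_le _
  linarith

lemma barrierGrad_add_smul_castSucc (s δ D m : ℝ) (c x : Eucl n) (h : ℝ) (i : Fin n) :
    barrierGrad s δ D m c (x + h • EuclideanSpace.single i.castSucc 1) -
      barrierGrad s δ D m c x = (h * (s * δ)) • EuclideanSpace.single i.castSucc (1 : ℝ) := by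
  rw [barrierGrad_sub, add_sub_cancel_left]
  have : (h • EuclideanSpace.single i.castSucc (1 : ℝ) : Eucl n) (Fin.last n) = 0 := by
    simp
  rw [this]
  module

lemma barrierGrad_add_smul_last (s δ D m : ℝ) (c x : Eucl n) (h : ℝ) :
    barrierGrad s δ D m c (x + h • eLast n) - barrierGrad s δ D m c x =
      (-(h * (s * D))) • eLast n := by
  rw [barrierGrad_sub, add_sub_cancel_left]
  have : (h • eLast n : Eucl n) (Fin.last n) = h := by simp [eLast]
  rw [this]
  module

lemma abs_barrier_sub_le {s δ D m b M : ℝ} {c : Eucl n} {B : Set (Eucl n)} (hB : Convex ℝ B)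
    (hg : ∀ x ∈ B, ‖barrierGrad s δ D m c x‖ ≤ M) {x y : Eucl n} (hx : x ∈ B) (hy : y ∈ B) :
    |barrier s δ D m b c x - barrier s δ D m b c y| ≤ M * ‖x - y‖ := by
  refine hB.norm_image_sub_le_of_norm_hasFDerivWithin_le (f := barrier s δ D m b c)
    (f' := fun z => InnerProductSpace.toDual ℝ _ (barrierGrad s δ D m c z))
    (fun z _ => (hasGradientAt_barrier s δ D m b c z).hasFDerivAt.hasFDerivWithinAt)
    (fun z hz => ?_) hy hx
  rw [LinearIsometryEquiv.norm_map]
  exact hg z hz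

lemma lipschitzOnWith_barrierFlux {lam Lam M ε : ℝ} {G : Eucl n → ℝ → Eucl n → Eucl n}
    {G₀ : Eucl n → ℝ → Eucl n → ℝ} (hG : Coeffs lam Lam M ε G G₀) {s δ D m b : ℝ} {c : Eucl n}
    (hs : |s| = 1) (hδ : 0 ≤ δ) (hD : 0 ≤ D) {x₀ : Eucl n} {ρ : ℝ}
    (hsub : ball x₀ ρ ⊆ ball 0 2) (hP : ∀ x ∈ ball x₀ ρ, |barrier s δ D m b c x| ≤ M)
    (hP' : ∀ x ∈ ball x₀ ρ, ‖barrierGrad s δ D m c x‖ ≤ M) :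
    ∃ K : ℝ≥0, LipschitzOnWith K
      (fun x => G x (barrier s δ D m b c x) (barrierGrad s δ D m c x)) (ball x₀ ρ) := by
  have e0 := hG.eps_nonneg
  have L0 := hG.Lam_nonneg
  have M0 := hG.M_nonneg
  refine ⟨⟨Lam * (ε * (1 + M) + (D + 2 * δ)), by positivity⟩,
    LipschitzOnWith.of_dist_le_mul fun x hx y hy => ?_⟩
  rw [dist_eq_norm, dist_eq_norm]
  refine (hG.lip x (hsub hx) y (hsub hy) _ _ (hP x hx) (hP y hy) _ _ (hP' x hx)
    (hP' y hy)).trans ?_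
  change _ ≤ Lam * (ε * (1 + M) + (D + 2 * δ)) * ‖x - y‖
  have h1 := abs_barrier_sub_le (b := b) (convex_ball x₀ ρ) hP' hx hy
  have h2 := norm_barrierGrad_sub_le hs hδ hD m c x y
  calc _ ≤ Lam * (ε * (‖x - y‖ + M * ‖x - y‖) + (D + 2 * δ) * ‖x - y‖) := by gcongr
    _ = _ := by ring

lemma barrierFlux_lower_bound {lam Lam M ε : ℝ} {G : Eucl n → ℝ → Eucl n → Eucl n}
    {G₀ : Eucl n → ℝ → Eucl n → ℝ} (hG : Coeffs lam Lam M ε G G₀) {s δ D m b : ℝ} {c : Eucl n}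
    (hs : s = 1 ∨ s = -1) (hδ : 0 ≤ δ) (hD : 0 < D) {x₀ : Eucl n} {ρ : ℝ}
    (hsub : ball x₀ ρ ⊆ ball 0 2) (hP : ∀ x ∈ ball x₀ ρ, |barrier s δ D m b c x| ≤ M)
    (hP' : ∀ x ∈ ball x₀ ρ, ‖barrierGrad s δ D m c x‖ ≤ M) {φ : Eucl n → ℝ} {K' : ℝ≥0}
    (hφ : LipschitzWith K' φ) (h0 : ∀ x, 0 ≤ φ x) (hφ0 : ∀ x ∉ ball x₀ ρ, φ x = 0) :
    (lam * D - n * (Lam * δ) - (n + 1) * (Lam * ε * (1 + M))) * ∫ x in ball x₀ ρ, φ x ≤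
      ∫ x in ball x₀ ρ,
        s * ⟪G x (barrier s δ D m b c x) (barrierGrad s δ D m c x), gradient φ x⟫_ℝ := by
  have hs1 : |s| = 1 := by rcases hs with rfl | rfl <;> simp
  have hss : s * s = 1 := by rcases hs with rfl | rfl <;> norm_num
  have e0 := hG.eps_nonneg
  have L0 := hG.Lam_nonneg
  have M0 := hG.M_nonneg
  set X : Eucl n → Eucl n := fun x => G x (barrier s δ D m b c x) (barrierGrad s δ D m c x)
    with hX
  obtain ⟨K, hK⟩ := lipschitzOnWith_barrierFlux (b := b) hG hs1 hδ hD.le hsub hP hP'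
  have hcoord : ∀ i : Fin (n + 1), LipschitzOnWith K (fun x => s * X x i) (ball x₀ ρ) := by
    intro i
    refine LipschitzOnWith.of_dist_le_mul fun x hx y hy => ?_
    rw [Real.dist_eq, ← mul_sub, abs_mul, hs1, one_mul]
    refine le_trans ?_ (hK.dist_le_mul x hx y hy)
    rw [dist_eq_norm]
    exact PiLp.norm_apply_le (X x - X y) i
  have hsplit : ∀ x ∈ ball x₀ ρ, ∀ h : ℝ, 0 < h → ∀ e : Eucl n, ‖e‖ = 1 →
      x + h • e ∈ ball x₀ ρ →
      ‖X (x + h • e) - G x (barrier s δ D m b c x) (barrierGrad s δ D m c (x + h • e))‖ ≤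
        Lam * ε * (1 + M) * h := by
    intro x hx h hh e he hxe
    refine (hG.lip _ (hsub hxe) x (hsub hx) _ _ (hP _ hxe) (hP x hx) _ _ (hP' _ hxe)
      (hP' _ hxe)).trans ?_
    have h1 := abs_barrier_sub_le (b := b) (convex_ball x₀ ρ) hP' hxe hx
    have h2 : ‖x + h • e - x‖ = h := by
      rw [add_sub_cancel_left, norm_smul, he, mul_one, Real.norm_eq_abs, abs_of_pos hh]
    rw [h2] at h1 ⊢
    rw [sub_self, norm_zero, add_zero]
    calc _ ≤ Lam * (ε * (h + M * h)) := by gcongr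
      _ = _ := by ring
  have htan : ∀ i : Fin n, -(Lam * ε * (1 + M) + Lam * δ) * ∫ x in ball x₀ ρ, φ x ≤
      ∫ x in ball x₀ ρ, s * X x i.castSucc *
        ⟪gradient φ x, EuclideanSpace.single i.castSucc 1⟫_ℝ := by
    intro i
    refine neg_le_setIntegral_mul_inner_gradient (hcoord _) hφ h0 hφ0 fun x hx h hh hxe => ?_
    have h1 := hsplit x hx h hh _ (by simp) hxe
    have h2 := hG.lip x (hsub hx) x (hsub hx) _ _ (hP x hx) (hP x hx) _ _ (hP' _ hxe) (hP' x hx)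
    rw [barrierGrad_add_smul_castSucc, sub_self, sub_self, norm_zero, abs_zero, norm_smul,
      Real.norm_eq_abs, abs_mul, abs_mul, hs1, abs_of_pos hh, abs_of_nonneg hδ] at h2
    rw [← mul_sub]
    refine (le_abs_self _).trans ?_
    rw [abs_mul, hs1, one_mul]
    have h3 : |X (x + h • EuclideanSpace.single i.castSucc 1) i.castSucc - X x i.castSucc| ≤
        ‖X (x + h • EuclideanSpace.single i.castSucc 1) - X x‖ :=
      PiLp.norm_apply_le (X (x + h • EuclideanSpace.single i.castSucc 1) - X x) i.castSucc
    refine h3.trans ((norm_sub_le_norm_sub_add_norm_sub _ _ _).trans (add_le_add h1 h2) |>.trans ?_)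
    simp
    nlinarith
  have hlast : -(Lam * ε * (1 + M) - lam * D) * ∫ x in ball x₀ ρ, φ x ≤
      ∫ x in ball x₀ ρ, s * X x (Fin.last n) *
        ⟪gradient φ x, EuclideanSpace.single (Fin.last n) 1⟫_ℝ := by
    refine neg_le_setIntegral_mul_inner_gradient (hcoord _) hφ h0 hφ0 fun x hx h hh hxe => ?_
    change x + h • eLast n ∈ _ at hxe
    change s * X (x + h • eLast n) _ - _ ≤ _
    have h1 := hsplit x hx h hh _ norm_eLast hxe
    have h2 := hG.mono x (hsub hx) _ (hP x hx) _ _ (hP' _ hxe) (hP' x hx)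
    rw [barrierGrad_add_smul_last, norm_smul, norm_eLast, mul_one, Real.norm_eq_abs, sq_abs,
      real_inner_smul_right, real_inner_comm, inner_eLast] at h2
    have h3 : s * (X (x + h • eLast n) (Fin.last n) - G x (barrier s δ D m b c x)
        (barrierGrad s δ D m c (x + h • eLast n)) (Fin.last n)) ≤ Lam * ε * (1 + M) * h := by
      refine (le_abs_self _).trans ?_
      rw [abs_mul, hs1, one_mul]
      exact (abs_last_le (X (x + h • eLast n) - G x (barrier s δ D m b c x)
        (barrierGrad s δ D m c (x + h • eLast n)))).trans h1
    have h4 : s * (G x (barrier s δ D m b c x) (barrierGrad s δ D m c (x + h • eLast n))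
        (Fin.last n) - X x (Fin.last n)) ≤ -(lam * D) * h := by
      rw [PiLp.sub_apply] at h2
      have : (h * D) * (lam * (h * D)) ≤ (h * D) * (-(s * (G x (barrier s δ D m b c x)
          (barrierGrad s δ D m c (x + h • eLast n)) (Fin.last n) - X x (Fin.last n)))) := by
        refine le_trans (le_of_eq ?_) (h2.trans (le_of_eq ?_))
        · linear_combination (-(lam * h ^ 2 * D ^ 2)) * hss
        · ring
      have := le_of_mul_le_mul_left this (by positivity)
      linarith
    linarith
  have hInt : ∀ i : Fin (n + 1), IntegrableOn (fun x => s * X x i *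
      ⟪gradient φ x, EuclideanSpace.single i 1⟫_ℝ) (ball x₀ ρ) := by
    intro i
    obtain ⟨Z', hZ', heq⟩ := (hcoord i).extend_real
    obtain ⟨C, hC⟩ := (isCompact_closedBall x₀ ρ).exists_bound_of_continuousOn
      hZ'.continuous.continuousOn
    have : IntegrableOn (fun x => Z' x * ⟪gradient φ x, EuclideanSpace.single i 1⟫_ℝ)
        (ball x₀ ρ) := by
      refine integrableOn_of_bounded measure_ball_lt_top.ne (C := C * K') ?_
        ((ae_restrict_iff' measurableSet_ball).2 (.of_forall fun x hx => ?_))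
      · exact (hZ'.continuous.measurable.mul
          ((measurable_gradient φ).inner measurable_const)).aestronglyMeasurable
      · have hx' := hC x (ball_subset_closedBall hx)
        rw [abs_mul]
        refine mul_le_mul hx' ?_ (abs_nonneg _) ((norm_nonneg _).trans hx')
        refine (abs_real_inner_le_norm _ _).trans ?_
        simpa using norm_gradient_le hφ x
    exact this.congr_fun (fun x hx => by simp only [← heq hx]) measurableSet_ball
  have hsum : ∫ x in ball x₀ ρ, s * ⟪X x, gradient φ x⟫_ℝ =
      ∑ i : Fin (n + 1), ∫ x in ball x₀ ρ, s * X x i *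
        ⟪gradient φ x, EuclideanSpace.single i 1⟫_ℝ := by
    rw [← integral_finsetSum _ fun i _ => hInt i]
    refine integral_congr_ae (.of_forall fun x => ?_)
    simp only [PiLp.inner_apply, Finset.mul_sum]
    refine Finset.sum_congr rfl fun i _ => ?_
    simp
    ring
  rw [hsum, Fin.sum_univ_castSucc]
  have := Finset.sum_le_sum fun (i : Fin n) (_ : i ∈ Finset.univ) => htan i
  rw [Finset.sum_const, Finset.card_univ, Fintype.card_fin, nsmul_eq_mul] at this
  linarith

lemma flux_comparison_pointwise {lam Lam M ε : ℝ} {G : Eucl n → ℝ → Eucl n → Eucl n}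
    {G₀ : Eucl n → ℝ → Eucl n → ℝ} (hG : Coeffs lam Lam M ε G G₀) {s : ℝ} (hs : s = 1 ∨ s = -1)
    {x : Eucl n} (hx : x ∈ ball 0 2) {z w : ℝ} (hz : |z| ≤ M) (hw : |w| ≤ M) {p q : Eucl n}
    (hp : ‖p‖ ≤ M) (hq : ‖q‖ ≤ M) (hpos : 0 ≤ s * (z - w)) :
    s * ⟪G x w q, s • (p - q)⟫_ℝ - (Lam * ε + Lam ^ 2 * ε * M / (2 * lam)) * (s * (z - w)) ≤
      s * (⟪G x z p, s • (p - q)⟫_ℝ + G₀ x z p * (s * (z - w))) := by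
  have hs1 : |s| = 1 := by rcases hs with rfl | rfl <;> simp
  have hss : s * s = 1 := by rcases hs with rfl | rfl <;> norm_num
  have e0 := hG.eps_nonneg
  have e1 := hG.eps_le_one
  have L0 := hG.Lam_nonneg
  have M0 := hG.M_nonneg
  have l0 := hG.lam_pos
  set f := s * (z - w) with hf
  have hfabs : |z - w| = f := by
    rw [← abs_of_nonneg hpos, hf, abs_mul, hs1, one_mul]
  have hf2 : f ≤ 2 * M := by
    rw [← hfabs]
    have := abs_sub z w
    linarith
  have h1 := hG.mono x hx z hz p q hp hq
  have h2 := hG.lip x hx x hx z w hz hw q q hq hq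
  rw [sub_self, sub_self, norm_zero, zero_add, add_zero, hfabs] at h2
  have h3 : -(Lam * (ε * f) * ‖p - q‖) ≤ ⟪G x z q - G x w q, p - q⟫_ℝ := by
    refine (abs_le.1 ((abs_real_inner_le_norm _ _).trans ?_)).1
    gcongr
  have h4 := hG.bd₀ x hx z hz p hp
  have h5 : -(Lam * ε * f) ≤ s * G₀ x z p * f := by
    have : -(Lam * ε) ≤ s * G₀ x z p :=
      (abs_le.1 (show |s * G₀ x z p| ≤ _ by rwa [abs_mul, hs1, one_mul])).1
    nlinarith
  have h6 : ⟪G x z p - G x w q, p - q⟫_ℝ =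
      ⟪G x z p - G x z q, p - q⟫_ℝ + ⟪G x z q - G x w q, p - q⟫_ℝ := by
    rw [← inner_add_left, sub_add_sub_cancel]
  have h7 : -(Lam ^ 2 * ε * M / (2 * lam) * f) ≤
      lam * ‖p - q‖ ^ 2 - Lam * (ε * f) * ‖p - q‖ := by
    have e : lam * ‖p - q‖ ^ 2 - Lam * (ε * f) * ‖p - q‖ + Lam ^ 2 * ε * M / (2 * lam) * f =
        ((2 * lam * ‖p - q‖ - Lam * ε * f) ^ 2 + Lam ^ 2 * ε * f * (2 * M - ε * f)) /
          (4 * lam) := by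
      field_simp
      ring
    have : 0 ≤ 2 * M - ε * f := by nlinarith
    have : 0 ≤ ((2 * lam * ‖p - q‖ - Lam * ε * f) ^ 2 + Lam ^ 2 * ε * f * (2 * M - ε * f)) /
          (4 * lam) := by positivity
    linarith
  have h8 : s * ⟪G x z p, s • (p - q)⟫_ℝ - s * ⟪G x w q, s • (p - q)⟫_ℝ =
      ⟪G x z p - G x w q, p - q⟫_ℝ := by
    rw [real_inner_smul_right, real_inner_smul_right, inner_sub_left]
    linear_combination (⟪G x z p, p - q⟫_ℝ - ⟪G x w q, p - q⟫_ℝ) * hss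
  nlinarith

/-- Comparison with a strict barrier. For `s = 1` the barrier lies above the solution, for
`s = -1` below. -/
theorem barrier_comparison {lam Lam M ε : ℝ} {G : Eucl n → ℝ → Eucl n → Eucl n}
    {G₀ : Eucl n → ℝ → Eucl n → ℝ} {L : ℝ≥0} {U : Eucl n → ℝ} (hG : Coeffs lam Lam M ε G G₀)
    (hU : UnitSol G G₀ L U) (hM : 2 * L ≤ M) {s δ D m b : ℝ} {c : Eucl n} (hs : s = 1 ∨ s = -1)
    (hδ : 0 ≤ δ) (hD : 0 < D) {x₀ : Eucl n} {ρ : ℝ} (hsub : closedBall x₀ ρ ⊆ ball 0 2)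
    (hP : ∀ x ∈ closedBall x₀ ρ, |barrier s δ D m b c x| ≤ M)
    (hP' : ∀ x ∈ closedBall x₀ ρ, ‖barrierGrad s δ D m c x‖ ≤ M)
    (hsph : ∀ x ∈ sphere x₀ ρ, s * (U x - barrier s δ D m b c x) ≤ 0)
    (hthin : ∀ x ∈ ball x₀ ρ, x (Fin.last n) = 0 → 0 < s * (U x - barrier s δ D m b c x) →
      0 ≤ barrier s δ D m b c x)
    (hc : n * (Lam * δ) + (n + 1) * (Lam * ε * (1 + M)) +
      (Lam * ε + Lam ^ 2 * ε * M / (2 * lam)) < lam * D) :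
    ∀ x ∈ ball x₀ ρ, s * (U x - barrier s δ D m b c x) ≤ 0 := by
  have hs1 : |s| = 1 := by rcases hs with rfl | rfl <;> simp
  have hss : s * s = 1 := by rcases hs with rfl | rfl <;> norm_num
  have M0 := hG.M_nonneg
  have hLM : (L : ℝ) ≤ M := by have := L.coe_nonneg; linarith
  have hsub' : ball x₀ ρ ⊆ ball 0 2 := ball_subset_closedBall.trans hsub
  have hPb : ∀ x ∈ ball x₀ ρ, |barrier s δ D m b c x| ≤ M :=
    fun x hx => hP x (ball_subset_closedBall hx)
  have hPb' : ∀ x ∈ ball x₀ ρ, ‖barrierGrad s δ D m c x‖ ≤ M :=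
    fun x hx => hP' x (ball_subset_closedBall hx)
  have hUM : ∀ x ∈ ball (0 : Eucl n) 2, |U x| ≤ M := fun x hx => by
    have h1 := hU.abs_le x
    have h2 : ‖x‖ < 2 := by simpa using hx
    have := L.coe_nonneg
    nlinarith
  set P := barrier s δ D m b c with hPdef
  set f : Eucl n → ℝ := fun x => s * (U x - P x) with hf
  have hPd : ∀ x, HasGradientAt P (barrierGrad s δ D m c x) x := hasGradientAt_barrier s δ D m b c
  have hfc : Continuous f := continuous_const.mul (hU.lip.continuous.sub
    (continuous_iff_continuousAt.2 fun x => (hPd x).differentiableAt.continuousAt))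
  set φ := (ball x₀ ρ).indicator fun x => max (f x) 0 with hφ
  have hφ_lip : LipschitzWith (L + ⟨M, M0⟩) φ := by
    refine lipschitzWith_indicator_ball (LipschitzOnWith.of_dist_le_mul fun x hx y hy => ?_)
      fun x hx => max_eq_right (hsph x hx)
    rw [Real.dist_eq]
    refine (abs_max_sub_max_le_abs _ _ _).trans ?_
    have h1 := hU.lip.dist_le_mul x y
    have h2 := abs_barrier_sub_le (b := b) (convex_closedBall x₀ ρ) hP' hx hy
    rw [Real.dist_eq] at h1
    rw [hf, ← mul_sub, abs_mul, hs1, one_mul, sub_sub_sub_comm]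
    refine (abs_sub _ _).trans ?_
    rw [← dist_eq_norm] at h2
    change _ ≤ (L + M) * dist x y
    linarith
  have hφ0 : ∀ x, 0 ≤ φ x := fun x => Set.indicator_nonneg (fun _ _ => le_max_right _ _) x
  have hφout : ∀ x ∉ ball x₀ ρ, φ x = 0 := fun x hx => Set.indicator_of_notMem hx _
  have hφpos : ∀ x, 0 < φ x → x ∈ ball x₀ ρ ∧ 0 < f x ∧ φ x = f x := by
    intro x hx
    by_cases hxb : x ∈ ball x₀ ρ
    · rw [hφ, Set.indicator_of_mem hxb] at hx ⊢
      have : 0 < f x := by simpa using hx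
      exact ⟨hxb, this, max_eq_left this.le⟩
    · rw [hφout x hxb] at hx
      exact absurd hx (lt_irrefl _)
  have hgrad0 : ∀ x, φ x = 0 → gradient φ x = 0 := fun x hx => gradient_eq_zero_of_nonneg hφ0 hx
  have hgrad : ∀ x, 0 < φ x → DifferentiableAt ℝ U x →
      gradient φ x = s • (gradient U x - barrierGrad s δ D m c x) := by
    intro x hx hd
    obtain ⟨hxb, hfx, -⟩ := hφpos x hx
    have hev : φ =ᶠ[𝓝 x] f := by
      filter_upwards [isOpen_ball.mem_nhds hxb, hfc.continuousAt.eventually (lt_mem_nhds hfx)]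
        with y hy hfy
      rw [hφ, Set.indicator_of_mem hy, max_eq_left (le_of_lt hfy)]
    rw [Filter.EventuallyEq.gradient_eq hev, hf, gradient_const_mul,
      gradient_sub hd (hPd x).differentiableAt,
      (hPd x).gradient]
  obtain ⟨A, A₀, C, hA, hA₀, hC, hAC, hA₀C, hAeq⟩ := hG.exists_measurable
    hU.lip.continuous.measurable (measurable_gradient U) hUM
    fun x _ => (norm_gradient_le hU.lip x).trans hLM
  obtain ⟨X, X₀, C', hX, -, -, hXC, -, hXeq⟩ := hG.exists_measurable
    (z := (ball x₀ ρ).indicator P) (p := (ball x₀ ρ).indicator (barrierGrad s δ D m c))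
    ((continuous_iff_continuousAt.2 fun x =>
      (hPd x).differentiableAt.continuousAt).measurable.indicator measurableSet_ball)
    (by
      refine Measurable.indicator ?_ measurableSet_ball
      have : barrierGrad s δ D m c = gradient P := funext fun x => (hPd x).gradient.symm
      rw [this]
      exact measurable_gradient P)
    (fun x _ => by
      by_cases hx : x ∈ ball x₀ ρ
      · rw [Set.indicator_of_mem hx]; exact hPb x hx
      · rw [Set.indicator_of_notMem hx, abs_zero]; exact M0)
    (fun x _ => by
      by_cases hx : x ∈ ball x₀ ρ
      · rw [Set.indicator_of_mem hx]; exact hPb' x hx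
      · rw [Set.indicator_of_notMem hx, norm_zero]; exact M0)
  have hXb : ∀ x ∈ ball x₀ ρ, X x = G x (P x) (barrierGrad s δ D m c x) := fun x hx => by
    rw [(hXeq x (hsub' hx)).1, Set.indicator_of_mem hx, Set.indicator_of_mem hx]
  have hcs : HasCompactSupport φ := HasCompactSupport.intro (isCompact_closedBall x₀ ρ)
    fun x hx => hφout x fun h => hx (ball_subset_closedBall h)
  obtain ⟨H, hH⟩ := hcs.exists_bound_of_continuous hφ_lip.continuous
  have hlow := barrierFlux_lower_bound (b := b) hG hs hδ hD hsub' hPb hPb' hφ_lip hφ0 hφout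
  have hup : ∫ x in ball x₀ ρ, s * (⟪A x, gradient φ x⟫_ℝ + A₀ x * φ x) ≤ 0 := by
    have hψ : LipschitzWith (L + ⟨M, M0⟩) fun x => -s * φ x := by
      refine LipschitzWith.of_dist_le_mul fun x y => ?_
      rw [Real.dist_eq, ← mul_sub, abs_mul, abs_neg, hs1, one_mul]
      exact hφ_lip.dist_le_mul x y
    have := hU.weak (fun x => -s * φ x) _ hψ
      (fun x hx => by simp only [hφout x fun h => hx (hsub' h), mul_zero])
      (fun x hx hx0 => by
        rcases (hφ0 x).eq_or_lt with h | (h : 0 < φ x)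
        · simp only [← h, mul_zero, add_zero]; exact hU.nonneg x hx hx0
        · obtain ⟨hxb, hfx, he⟩ := hφpos x h
          simp only [he, hf]
          have := hthin x hxb hx0 hfx
          linarith [show U x + -s * (s * (U x - P x)) = P x by
            linear_combination (-(U x - P x)) * hss])
    have e : ∫ x in ball (0 : Eucl n) 2, (⟪G x (U x) (gradient U x),
        gradient (fun x => -s * φ x) x⟫_ℝ + G₀ x (U x) (gradient U x) * (-s * φ x)) =
        ∫ x in ball x₀ ρ, -(s * (⟪A x, gradient φ x⟫_ℝ + A₀ x * φ x)) := by
      rw [setIntegral_eq_of_subset_of_forall_sdiff_eq_zero measurableSet_ball hsub']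
      · refine setIntegral_congr_fun measurableSet_ball fun x hx => ?_
        simp only [gradient_const_mul, (hAeq x (hsub' hx)).1, (hAeq x (hsub' hx)).2,
          real_inner_smul_right]
        ring
      · intro x hx
        have h0 := hφout x hx.2
        simp only [gradient_const_mul, hgrad0 x h0, h0]
        simp
    rw [e, integral_neg] at this
    linarith
  set κ := Lam * ε + Lam ^ 2 * ε * M / (2 * lam) with hκ
  have hφint : IntegrableOn φ (ball x₀ ρ) :=
    (hφ_lip.continuous.integrable_of_hasCompactSupport hcs).integrableOn
  have hXint : IntegrableOn (fun x => s * ⟪X x, gradient φ x⟫_ℝ) (ball x₀ ρ) := by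
    have := integrable_pairing (C := C') (A₀ := fun _ => 0) hX measurable_const hXC
      (fun x => by simpa using (norm_nonneg _).trans (hXC 0)) hφ_lip hH
      (measure_ball_lt_top (x := x₀) (r := ρ)).ne
    have h := Integrable.const_mul this s
    simp only [zero_mul, add_zero] at h
    exact h
  have hmid : ∫ x in ball x₀ ρ, (s * ⟪X x, gradient φ x⟫_ℝ - κ * φ x) ≤
      ∫ x in ball x₀ ρ, s * (⟪A x, gradient φ x⟫_ℝ + A₀ x * φ x) := by
    refine integral_mono_ae (hXint.sub (hφint.const_mul κ)) ((integrable_pairing hA hA₀ hAC hA₀C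
      hφ_lip hH measure_ball_lt_top.ne).const_mul s)
      ((ae_restrict_iff' measurableSet_ball).2 ?_)
    filter_upwards [hU.lip.ae_differentiableAt] with x hd hx
    rcases (hφ0 x).eq_or_lt with h | (h : 0 < φ x)
    · simp [hgrad0 x h.symm, ← h]
    · obtain ⟨-, hfx, he⟩ := hφpos x h
      rw [hgrad x h hd, he, hXb x hx, (hAeq x (hsub' hx)).1, (hAeq x (hsub' hx)).2]
      exact flux_comparison_pointwise hG hs (hsub' hx) (hUM x (hsub' hx)) (hPb x hx)
        ((norm_gradient_le hU.lip x).trans hLM) (hPb' x hx) hfx.le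
  rw [integral_sub hXint (hφint.const_mul κ), integral_const_mul κ] at hmid
  have hXi : ∫ x in ball x₀ ρ, s * ⟪X x, gradient φ x⟫_ℝ = ∫ x in ball x₀ ρ,
      s * ⟪G x (P x) (barrierGrad s δ D m c x), gradient φ x⟫_ℝ :=
    setIntegral_congr_fun measurableSet_ball fun x hx => by simp only [hXb x hx]
  rw [hXi] at hmid
  have hle : ∫ x in ball x₀ ρ, φ x ≤ 0 := by
    by_contra! hpos
    nlinarith
  intro x hx
  by_contra! hfx
  have hφx : φ x ≠ 0 := by
    rw [hφ, Set.indicator_of_mem hx]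
    exact ((show 0 < f x from hfx).trans_le (le_max_left _ _)).ne'
  have := hφ_lip.continuous.integral_pos_of_hasCompactSupport_nonneg_nonzero (μ := volume) hcs
    hφ0 hφx
  rw [← setIntegral_eq_integral_of_forall_compl_eq_zero hφout] at this
  linarith

/-! ### Rescalings of a solution -/

lemma exists_lipschitzOnWith_of_contDiffOn {E E' : Type*} [NormedAddCommGroup E] [NormedSpace ℝ E]
    [NormedAddCommGroup E'] [NormedSpace ℝ E'] {f : E → E'} {S K : Set E} (hS : IsOpen S)
    (hf : ContDiffOn ℝ 1 f S) (hK : IsCompact K) (hKc : Convex ℝ K) (hKS : K ⊆ S) :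
    ∃ C : ℝ≥0, LipschitzOnWith C f K := by
  obtain ⟨C, hC⟩ := hK.exists_bound_of_continuousOn
    ((hf.continuousOn_fderiv_of_isOpen hS le_rfl).mono hKS)
  refine ⟨C.toNNReal, hKc.lipschitzOnWith_of_nnnorm_fderiv_le (𝕜 := ℝ) (fun x hx =>
    (hf.differentiableOn one_ne_zero).differentiableAt (hS.mem_nhds (hKS hx))) fun x hx => ?_⟩
  exact NNReal.le_toNNReal_of_coe_le (hC x hx)

lemma mono_of_fderiv_coercive {A : Eucl n → Eucl n} (hA : Differentiable ℝ A) {lam M : ℝ}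
    (h : ∀ p : Eucl n, ‖p‖ ≤ M → ∀ ξ : Eucl n, lam * ‖ξ‖ ^ 2 ≤ ⟪fderiv ℝ A p ξ, ξ⟫_ℝ)
    {p q : Eucl n} (hp : ‖p‖ ≤ M) (hq : ‖q‖ ≤ M) :
    lam * ‖p - q‖ ^ 2 ≤ ⟪A p - A q, p - q⟫_ℝ := by
  set w : ℝ → ℝ := fun t => ⟪A (q + t • (p - q)), p - q⟫_ℝ with hw
  have hd : ∀ t, HasDerivAt w ⟪fderiv ℝ A (q + t • (p - q)) (p - q), p - q⟫_ℝ t := by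
    intro t
    have h1 : HasDerivAt (fun t : ℝ => q + t • (p - q)) (p - q) t := by
      simpa using ((hasDerivAt_id t).smul_const (p - q)).const_add q
    have h2 := (hA (q + t • (p - q))).hasFDerivAt.comp_hasDerivAt t h1
    simpa using h2.inner ℝ (hasDerivAt_const t (p - q))
  have hdiff : Differentiable ℝ w := fun t => (hd t).differentiableAt
  have := (convex_Icc (0 : ℝ) 1).mul_sub_le_image_sub_of_le_deriv hdiff.continuous.continuousOn
    hdiff.differentiableOn (C := lam * ‖p - q‖ ^ 2) (fun t ht => ?_) 0 (by simp) 1 (by simp)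
    zero_le_one
  · simpa [hw, inner_sub_left] using this
  · rw [interior_Icc] at ht
    rw [(hd t).deriv]
    refine h _ ?_ _
    have hcv := (convex_closedBall (0 : Eucl n) M).add_smul_sub_mem (x := q) (y := p)
      (by simpa using hq) (by simpa using hp) ⟨ht.1.le, ht.2.le⟩
    simpa using hcv

lemma norm_prod_sub_le (q q' : Eucl n × ℝ × Eucl n) :
    dist q q' ≤ ‖q.1 - q'.1‖ + |q.2.1 - q'.2.1| + ‖q.2.2 - q'.2.2‖ := by
  rw [Prod.dist_eq, Prod.dist_eq, ← dist_eq_norm, ← Real.dist_eq, ← dist_eq_norm]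
  have h1 : 0 ≤ dist q.1 q'.1 := dist_nonneg
  have h2 : 0 ≤ dist q.2.1 q'.2.1 := dist_nonneg
  have h3 : 0 ≤ dist q.2.2 q'.2.2 := dist_nonneg
  refine max_le (by linarith) (max_le (by linarith) (by linarith))

lemma exists_coeffs_rescaled {F : Eucl n → ℝ → Eucl n → Eucl n} {F₀ : Eucl n → ℝ → Eucl n → ℝ}
    (hF : H0 F F₀) (hell : H1 F) {z₀ : Eucl n} (hz₀ : z₀ ∈ ball (0 : Eucl n) 1) {M : ℝ}
    (hM : 0 < M) : ∃ lam Lam r₀ : ℝ, 0 < r₀ ∧ ball z₀ (2 * r₀) ⊆ ball 0 1 ∧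
      ∀ r, 0 < r → r ≤ r₀ → Coeffs lam Lam M r (fun x z p => F (z₀ + r • x) (r * z) p)
        fun x z p => r * F₀ (z₀ + r • x) (r * z) p := by
  have hz1 : ‖z₀‖ < 1 := by simpa using hz₀
  set R := (1 - ‖z₀‖) / 2 with hR
  have hR0 : 0 < R := by rw [hR]; linarith
  have hball : closedBall z₀ R ⊆ ball 0 1 := fun x hx => by
    have h1 : ‖x - z₀‖ ≤ R := by simpa [dist_eq_norm] using hx
    have h2 := norm_add_le (x - z₀) z₀
    rw [sub_add_cancel] at h2
    simp only [mem_ball_zero_iff]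
    linarith
  set S := ball (0 : Eucl n) 1 ×ˢ (Set.univ : Set ℝ) ×ˢ (Set.univ : Set (Eucl n)) with hS
  have hSo : IsOpen S := isOpen_ball.prod (isOpen_univ.prod isOpen_univ)
  set K := closedBall z₀ R ×ˢ closedBall (0 : ℝ) M ×ˢ closedBall (0 : Eucl n) M with hK
  have hKc : IsCompact K := (isCompact_closedBall _ _).prod
    ((isCompact_closedBall _ _).prod (isCompact_closedBall _ _))
  have hKv : Convex ℝ K := (convex_closedBall _ _).prod
    ((convex_closedBall _ _).prod (convex_closedBall _ _))
  have hKS : K ⊆ S := fun q hq => ⟨hball hq.1, trivial, trivial⟩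
  obtain ⟨C, hC⟩ := exists_lipschitzOnWith_of_contDiffOn hSo hF.1 hKc hKv hKS
  obtain ⟨C₀, hC₀⟩ := exists_lipschitzOnWith_of_contDiffOn hSo hF.2 hKc hKv hKS
  obtain ⟨B, hB⟩ := hKc.exists_bound_of_continuousOn (hF.2.continuousOn.mono hKS)
  obtain ⟨lam, hlam, hmono⟩ := hell M hM
  have hB0 : 0 ≤ B := (norm_nonneg _).trans (hB (z₀, 0, 0) ⟨by simp [hR0.le], by simp [hM.le],
    by simp [hM.le]⟩)
  have hC0 := C.coe_nonneg
  have hC₀0 := C₀.coe_nonneg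
  refine ⟨lam, C + C₀ + B, min 1 (R / 2), by positivity, ?_, fun r hr hrr => ?_⟩
  · refine (ball_subset_closedBall.trans (closedBall_subset_closedBall ?_)).trans hball
    linarith [min_le_right 1 (R / 2)]
  have hr1 : r ≤ 1 := hrr.trans (min_le_left _ _)
  have hr2 : r ≤ R / 2 := hrr.trans (min_le_right _ _)
  have hx' : ∀ x ∈ ball (0 : Eucl n) 2, z₀ + r • x ∈ closedBall z₀ R := fun x hx => by
    have : ‖x‖ < 2 := by simpa using hx
    rw [mem_closedBall, dist_eq_norm, add_sub_cancel_left, norm_smul, Real.norm_eq_abs,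
      abs_of_pos hr]
    nlinarith [norm_nonneg x]
  have hz' : ∀ z : ℝ, |z| ≤ M → r * z ∈ closedBall (0 : ℝ) M := fun z hz => by
    rw [mem_closedBall_zero_iff, Real.norm_eq_abs, abs_mul, abs_of_pos hr]
    nlinarith [abs_nonneg z]
  have hmem : ∀ x ∈ ball (0 : Eucl n) 2, ∀ z : ℝ, |z| ≤ M → ∀ p : Eucl n, ‖p‖ ≤ M →
      (z₀ + r • x, r * z, p) ∈ K := fun x hx z hz p hp =>
    ⟨hx' x hx, hz' z hz, by simpa using hp⟩
  have hdist : ∀ (x x' : Eucl n) (z z' : ℝ) (p p' : Eucl n),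
      dist (z₀ + r • x, r * z, p) (z₀ + r • x', r * z', p') ≤
        r * (‖x - x'‖ + |z - z'|) + ‖p - p'‖ := fun x x' z z' p p' => by
    refine (norm_prod_sub_le _ _).trans (le_of_eq ?_)
    simp only [add_sub_add_left_eq_sub, ← smul_sub, ← mul_sub, norm_smul, abs_mul,
      Real.norm_eq_abs, abs_of_pos hr]
    ring
  refine ⟨hlam, by positivity, hM.le, hr.le, hr1, ?_, ?_, ?_, ?_⟩
  · intro x hx z hz p q hp hq
    have hxb := hball (hx' x hx)
    refine mono_of_fderiv_coercive (A := F (z₀ + r • x) (r * z)) ?_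
      (hmono _ hxb _ (by simpa using hz' z hz)) hp hq
    intro p
    have h1 : DifferentiableAt ℝ (fun q : Eucl n × ℝ × Eucl n => F q.1 q.2.1 q.2.2)
        (z₀ + r • x, r * z, p) := (hF.1.differentiableOn one_ne_zero).differentiableAt
      (hSo.mem_nhds ⟨hxb, trivial, trivial⟩)
    have h2 : DifferentiableAt ℝ (fun p : Eucl n => (z₀ + r • x, r * z, p)) p := by fun_prop
    exact DifferentiableAt.comp (f := fun p : Eucl n => (z₀ + r • x, r * z, p))
      (g := fun q : Eucl n × ℝ × Eucl n => F q.1 q.2.1 q.2.2) p h1 h2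
  · intro x hx x' hx' z z' hz hz' p p' hp hp'
    have := hC.dist_le_mul _ (hmem x hx z hz p hp) _ (hmem x' hx' z' hz' p' hp')
    rw [dist_eq_norm] at this
    refine this.trans ?_
    gcongr
    · linarith
    · exact hdist x x' z z' p p'
  · intro x hx x' hx' z z' hz hz' p p' hp hp'
    have := hC₀.dist_le_mul _ (hmem x hx z hz p hp) _ (hmem x' hx' z' hz' p' hp')
    rw [Real.dist_eq] at this
    rw [← mul_sub, abs_mul, abs_of_pos hr, mul_comm _ r, mul_assoc]
    gcongr
    refine this.trans ?_
    have h1 := hdist x x' z z' p p'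
    have h2 : r * (‖x - x'‖ + |z - z'|) ≤ ‖x - x'‖ + |z - z'| :=
      mul_le_of_le_one_left (by positivity) hr1
    gcongr
    · linarith
    · linarith
  · intro x hx z hz p hp
    have := hB _ (hmem x hx z hz p hp)
    rw [Real.norm_eq_abs] at this
    rw [abs_mul, abs_of_pos hr, mul_comm _ r]
    gcongr
    linarith

lemma gradient_comp_smul {f : Eucl n → ℝ} (c : ℝ) (x : Eucl n) :
    gradient (fun y => f (c • y)) x = c • gradient f (c • x) := by
  simp [gradient, fderiv_comp_smul]

lemma gradient_comp_add_smul {f : Eucl n → ℝ} (z₀ : Eucl n) (r : ℝ) (x : Eucl n) :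
    gradient (fun y => f (z₀ + r • y)) x = r • gradient f (z₀ + r • x) := by
  have h := gradient_comp_smul (f := fun y => f (y + z₀)) r x
  rw [gradient_comp_add_right] at h
  simpa only [add_comm] using h

lemma gradient_rescale {f : Eucl n → ℝ} (z₀ : Eucl n) {r : ℝ} (hr : r ≠ 0) (x : Eucl n) :
    gradient (fun y => f (z₀ + r • y) / r) x = gradient f (z₀ + r • x) := by
  have : (fun y => f (z₀ + r • y) / r) = fun y => r⁻¹ * f (z₀ + r • y) := by
    funext y; rw [div_eq_inv_mul]
  rw [this, gradient_const_mul, gradient_comp_add_smul, smul_smul, inv_mul_cancel₀ hr, one_smul]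

lemma gradient_unscale {f : Eucl n → ℝ} (z₀ : Eucl n) {r : ℝ} (hr : r ≠ 0) (x : Eucl n) :
    gradient (fun y => r * f (r⁻¹ • (y - z₀))) x = gradient f (r⁻¹ • (x - z₀)) := by
  have h : (fun y => f (r⁻¹ • (y - z₀))) = fun y => f (-(r⁻¹ • z₀) + r⁻¹ • y) := by
    funext y; congr 1; module
  rw [gradient_const_mul, h, gradient_comp_add_smul, smul_smul, mul_inv_cancel₀ hr, one_smul]
  congr 1
  module

lemma integral_comp_rescale (f : Eucl n → ℝ) (z₀ : Eucl n) {r : ℝ} (hr : 0 < r) :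
    ∫ x, f (r⁻¹ • (x - z₀)) = r ^ (n + 1) * ∫ y, f y := by
  rw [integral_sub_right_eq_self (fun x => f (r⁻¹ • x)) z₀,
    Measure.integral_comp_inv_smul_of_nonneg volume f hr.le]
  simp

lemma unitSol_rescaled {F : Eucl n → ℝ → Eucl n → Eucl n} {F₀ : Eucl n → ℝ → Eucl n → ℝ}
    {g u u' : Eucl n → ℝ} (hu : ThinSolution F F₀ g u) {z₀ : Eucl n} (hz₀ : z₀ ∈ coincidenceSet u)
    {L : ℝ≥0} (hu' : LipschitzWith L u') (heq : Set.EqOn u u' (closedBall 0 1)) {r : ℝ}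
    (hr : 0 < r) (hsub : ball z₀ (2 * r) ⊆ ball 0 1) :
    UnitSol (fun x z p => F (z₀ + r • x) (r * z) p) (fun x z p => r * F₀ (z₀ + r • x) (r * z) p)
      L fun y => u' (z₀ + r • y) / r := by
  have hrne := hr.ne'
  have heq' : ∀ x ∈ ball (0 : Eucl n) 1, u x = u' x := fun x hx => heq (ball_subset_closedBall hx)
  have hmem : ∀ y ∈ ball (0 : Eucl n) 2, z₀ + r • y ∈ ball (0 : Eucl n) 1 := fun y hy => hsub <| by
    have : ‖y‖ < 2 := by simpa using hy
    rw [mem_ball, dist_eq_norm, add_sub_cancel_left, norm_smul, Real.norm_eq_abs, abs_of_pos hr]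
    nlinarith
  have hmem' : ∀ x, r⁻¹ • (x - z₀) ∈ ball (0 : Eucl n) 2 ↔ x ∈ ball z₀ (2 * r) := fun x => by
    rw [mem_ball_zero_iff, norm_smul, norm_inv, Real.norm_eq_abs, abs_of_pos hr, mem_ball,
      dist_eq_norm, inv_mul_lt_iff₀ hr, mul_comm]
  have hback : ∀ x, z₀ + r • r⁻¹ • (x - z₀) = x := fun x => by
    rw [smul_smul, mul_inv_cancel₀ hrne, one_smul, add_sub_cancel]
  have hlast : ∀ y : Eucl n, (z₀ + r • y) (Fin.last n) = r * y (Fin.last n) := fun y => by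
    have : z₀ (Fin.last n) = 0 := hz₀.1.2
    simp [this]
  refine ⟨LipschitzWith.of_dist_le_mul fun x y => ?_, ?_, fun x hx hx0 => ?_,
    fun ψ K hψ hψ0 hψU => ?_⟩
  · have := hu'.dist_le_mul (z₀ + r • x) (z₀ + r • y)
    rw [Real.dist_eq, dist_add_left, dist_smul₀, Real.norm_eq_abs, abs_of_pos hr] at this
    rw [Real.dist_eq, ← sub_div, abs_div, abs_of_pos hr, div_le_iff₀ hr]
    linarith
  · simp [← heq' z₀ hz₀.1.1, hz₀.2]
  · rw [← heq' _ (hmem x hx)]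
    exact div_nonneg (hu.1.2.2 _ ⟨hmem x hx, by simp [hlast, hx0]⟩) hr.le
  · set w : Eucl n → ℝ := fun x => r * ψ (r⁻¹ • (x - z₀)) with hw
    have hw_lip : LipschitzWith K w := LipschitzWith.of_dist_le_mul fun x y => by
      have := hψ.dist_le_mul (r⁻¹ • (x - z₀)) (r⁻¹ • (y - z₀))
      rw [Real.dist_eq, dist_smul₀, dist_sub_right, norm_inv, Real.norm_eq_abs,
        abs_of_pos hr] at this
      rw [Real.dist_eq, ← mul_sub, abs_mul, abs_of_pos hr]
      calc _ ≤ r * (K * (r⁻¹ * dist x y)) := by gcongr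
        _ = _ := by field_simp
    have hw0 : ∀ x ∉ ball z₀ (2 * r), w x = 0 := fun x hx => by
      rw [hw]
      simp only [hψ0 _ fun h => hx ((hmem' x).1 h), mul_zero]
    have hv : AdmissibleThin g fun x => u x + w x := by
      obtain ⟨⟨C, hC⟩, hsph, hthin⟩ := hu.1
      refine ⟨⟨C + K, hC.add hw_lip.lipschitzOnWith⟩, fun x hx => ?_, fun x hx => ?_⟩
      · have hx' : x ∉ ball z₀ (2 * r) := fun h => by
          have h1 : ‖x‖ < 1 := by simpa using hsub h
          have h2 : ‖x‖ = 1 := by simpa using hx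
          linarith
        change u x + w x = g x
        rw [hw0 x hx', add_zero, hsph x hx]
      · change 0 ≤ u x + w x
        by_cases hxb : x ∈ ball z₀ (2 * r)
        · have h1 := hψU _ ((hmem' x).2 hxb) (by
            have h2 := hlast (r⁻¹ • (x - z₀))
            rw [hback, show x (Fin.last n) = 0 from hx.2] at h2
            exact (mul_eq_zero.1 h2.symm).resolve_left hrne)
          rw [hback, ← heq' x hx.1] at h1
          have h3 : u x + w x = r * (u x / r + ψ (r⁻¹ • (x - z₀))) := by
            rw [hw]; field_simp
          rw [h3]
          positivity
        · rw [hw0 x hxb, add_zero]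
          exact hthin x hx
    have hvar := hu.2 _ hv
    set H : Eucl n → ℝ := fun y => ⟪F (z₀ + r • y) (u' (z₀ + r • y)) (gradient u' (z₀ + r • y)),
      gradient ψ y⟫_ℝ + r * F₀ (z₀ + r • y) (u' (z₀ + r • y)) (gradient u' (z₀ + r • y)) * ψ y
      with hH
    have e1 : ∫ x in ball (0 : Eucl n) 1, (⟪F x (u x) (gradient u x),
        gradient (fun x => u x + w x) x - gradient u x⟫_ℝ +
          F₀ x (u x) (gradient u x) * (u x + w x - u x)) =
        ∫ x in ball (0 : Eucl n) 1, (ball (0 : Eucl n) 2).indicator H (r⁻¹ • (x - z₀)) := by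
      refine integral_congr_ae ((ae_restrict_iff' measurableSet_ball).2 ?_)
      filter_upwards [hu'.ae_differentiableAt, hw_lip.ae_differentiableAt,
        (Measure.addHaar_sphere volume z₀ (2 * r) : volume (sphere z₀ (2 * r)) = 0) |>
          measure_eq_zero_iff_ae_notMem.1] with x hd hdw hxs hx
      have hev : u =ᶠ[𝓝 x] u' := by
        filter_upwards [isOpen_ball.mem_nhds hx] with y hy using heq' y hy
      have hdu : DifferentiableAt ℝ u x := hd.congr_of_eventuallyEq hev
      rw [gradient_add hdu hdw, hev.gradient_eq, add_sub_cancel_left, add_sub_cancel_left,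
        hw, gradient_unscale z₀ hrne, heq' x hx]
      by_cases hxb : x ∈ ball z₀ (2 * r)
      · rw [Set.indicator_of_mem ((hmem' x).2 hxb)]
        simp only [hH, hback]
        ring
      · rw [Set.indicator_of_notMem fun h => hxb ((hmem' x).1 h)]
        have hev0 : w =ᶠ[𝓝 x] fun _ => 0 := by
          have : x ∉ closedBall z₀ (2 * r) := fun h =>
            (ball_union_sphere (x := z₀) (ε := 2 * r) ▸ h).elim hxb hxs
          filter_upwards [isClosed_closedBall.isOpen_compl.mem_nhds this] with y hy
          exact hw0 y fun h => hy (ball_subset_closedBall h)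
        have h1 := hev0.gradient_eq
        rw [hw, gradient_unscale z₀ hrne, gradient_fun_const] at h1
        have h2 := hw0 x hxb
        simp only [hw] at h2
        simp only [h1, h2]
        simp
    have e2 : ∫ x in ball (0 : Eucl n) 1, (ball (0 : Eucl n) 2).indicator H (r⁻¹ • (x - z₀)) =
        r ^ (n + 1) * ∫ y in ball (0 : Eucl n) 2, H y := by
      rw [setIntegral_eq_integral_of_forall_compl_eq_zero, integral_comp_rescale _ _ hr,
        integral_indicator measurableSet_ball]
      exact fun x hx => Set.indicator_of_notMem (fun h => hx (hsub ((hmem' x).1 h))) _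
    rw [e1, e2] at hvar
    have h3 := nonneg_of_mul_nonneg_right hvar (by positivity)
    refine h3.trans (le_of_eq (setIntegral_congr_fun measurableSet_ball fun y _ => ?_))
    simp only [hH, gradient_rescale z₀ hrne, mul_div_cancel₀ _ hrne]

theorem exists_rescalingFamily {F : Eucl n → ℝ → Eucl n → Eucl n} {F₀ : Eucl n → ℝ → Eucl n → ℝ}
    (hF : H0 F F₀) (hell : H1 F) {g u u' : Eucl n → ℝ} (hu : ThinSolution F F₀ g u) {z₀ : Eucl n}
    (hz₀ : z₀ ∈ coincidenceSet u) {L : ℝ≥0} (hu' : LipschitzWith L u')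
    (heq : Set.EqOn u u' (closedBall 0 1)) {M : ℝ} (hM : 0 < M) :
    ∃ lam Lam r₀ : ℝ, RescalingFamily lam Lam M r₀ L (fun r x z p => F (z₀ + r • x) (r * z) p)
      (fun r x z p => r * F₀ (z₀ + r • x) (r * z) p) u' z₀ := by
  obtain ⟨lam, Lam, r₀, hr₀, hsub, h⟩ := exists_coeffs_rescaled hF hell hz₀.1.1 hM
  exact ⟨lam, Lam, r₀, hr₀, h, fun r hr hrr => unitSol_rescaled hu hz₀ hu' heq hr
    ((ball_subset_ball (by linarith)).trans hsub)⟩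

/-! ### Blowups -/

lemma barrierGrad_self (s δ D m : ℝ) (c : Eucl n) : barrierGrad s δ D m c c = m • eLast n := by
  simp [barrierGrad]

section Blowup

variable {lam Lam M r₀ : ℝ} {L : ℝ≥0} {G : ℝ → Eucl n → ℝ → Eucl n → Eucl n}
  {G₀ : ℝ → Eucl n → ℝ → Eucl n → ℝ} {u w : Eucl n → ℝ} {z₀ : Eucl n} {t : ℕ → ℝ}

lemma RescalingFamily.eventually_barrier_comparison
    (hfam : RescalingFamily lam Lam M r₀ L G G₀ u z₀) (hM : 2 * L + 4 ≤ M) (ht : ∀ k, 0 < t k)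
    (htlim : Tendsto t atTop (𝓝 0))
    (hconv : TendstoUniformlyOn (fun k x => u (z₀ + t k • x) / t k) w atTop (ball 0 1))
    {s δ D θ : ℝ} (hs : s = 1 ∨ s = -1) (hδ : 0 ≤ δ) (hδ1 : δ ≤ 1) (hD : 0 < D) (hD1 : D ≤ 1)
    (hδD : n * (Lam * δ) < lam * D) (hθ : 0 < θ) :
    ∀ᶠ k in atTop, ∀ (m b : ℝ) (c : Eucl n) (ρ : ℝ), |m| ≤ L →
      |barrier s δ D m b c c| ≤ L + 1 → 0 < ρ → ρ ≤ 1 → closedBall c ρ ⊆ ball 0 1 →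
      (∀ x ∈ sphere c ρ, s * (w x - barrier s δ D m b c x) ≤ -θ) →
      (s = 1 → ∀ x ∈ ball c ρ, x (Fin.last n) = 0 → 0 ≤ barrier s δ D m b c x) →
      s * (u (z₀ + t k • c) / t k - barrier s δ D m b c c) ≤ 0 := by
  have hs1 : |s| = 1 := by rcases hs with rfl | rfl <;> simp
  have hlim : Tendsto (fun k => n * (Lam * δ) + (n + 1) * (Lam * t k * (1 + M)) +
      (Lam * t k + Lam ^ 2 * t k * M / (2 * lam))) atTop (𝓝 (n * (Lam * δ))) := by
    have hc : Continuous fun ε : ℝ => n * (Lam * δ) + (n + 1) * (Lam * ε * (1 + M)) +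
      (Lam * ε + Lam ^ 2 * ε * M / (2 * lam)) := by fun_prop
    simpa [Function.comp_def] using (hc.tendsto 0).comp htlim
  filter_upwards [hlim.eventually (gt_mem_nhds hδD),
    htlim.eventually (gt_mem_nhds hfam.radius_pos),
    Metric.tendstoUniformlyOn_iff.1 hconv θ hθ]
    with k hk hkr hkθ m b c ρ hm hb hρ hρ1 hsub hsph hthin
  have hG := hfam.coeffs (t k) (ht k) hkr.le
  have hU := hfam.sol (t k) (ht k) hkr.le
  have hL0 := L.coe_nonneg
  have hP' : ∀ x ∈ closedBall c ρ, ‖barrierGrad s δ D m c x‖ ≤ L + 3 := fun x hx => by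
    have h1 := norm_barrierGrad_sub_le hs1 hδ hD.le m c x c
    have h2 : ‖x - c‖ ≤ 1 := by rw [← dist_eq_norm]; exact (mem_closedBall.1 hx).trans hρ1
    have h3 := norm_le_insert' (barrierGrad s δ D m c x) (barrierGrad s δ D m c c)
    have h4 : ‖barrierGrad s δ D m c c‖ ≤ L := by
      rw [barrierGrad_self, norm_smul, norm_eLast, mul_one]; exact hm
    have h5 : (D + 2 * δ) * ‖x - c‖ ≤ 3 * 1 := by gcongr; linarith
    linarith
  have hP : ∀ x ∈ closedBall c ρ, |barrier s δ D m b c x| ≤ M := fun x hx => by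
    have h1 := abs_barrier_sub_le (b := b) (convex_closedBall c ρ) hP' hx
      (mem_closedBall_self hρ.le)
    have h2 : ‖x - c‖ ≤ 1 := by rw [← dist_eq_norm]; exact (mem_closedBall.1 hx).trans hρ1
    have h3 : (L + 3) * ‖x - c‖ ≤ (L + 3) * 1 := by gcongr
    have h4 := abs_sub_abs_le_abs_sub (barrier s δ D m b c x) (barrier s δ D m b c c)
    linarith
  refine barrier_comparison hG hU (by linarith) hs hδ hD
    (hsub.trans (ball_subset_ball one_le_two)) hP (fun x hx => (hP' x hx).trans (by linarith))
    (fun x hx => ?_) (fun x hx hx0 hpos => ?_) hk c (mem_ball_self hρ)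
  · have h1 := hkθ x (hsub (sphere_subset_closedBall hx))
    rw [dist_comm, Real.dist_eq] at h1
    have h2 := hsph x hx
    have h3 : s * (u (z₀ + t k • x) / t k - w x) ≤ θ := by
      refine (le_abs_self _).trans ?_
      rw [abs_mul, hs1, one_mul]
      exact h1.le
    linarith
  · rcases hs with rfl | rfl
    · exact hthin rfl x hx hx0
    · have := hU.nonneg x (ball_subset_ball one_le_two (hsub (ball_subset_closedBall hx))) hx0
      linarith

lemma barrier_self (s δ D m b : ℝ) (c : Eucl n) :
    barrier s δ D m b c c = m * c (Fin.last n) + b := by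
  simp [barrier]

lemma exists_small_tangential {lam Lam D : ℝ} (hlam : 0 < lam) (hLam : 0 ≤ Lam) (hD : 0 < D)
    (N : ℕ) : ∃ δ, 0 < δ ∧ δ ≤ D ∧ N * (Lam * δ) < lam * D := by
  refine ⟨min D (lam * D / (N * Lam + 1)), by positivity, min_le_left _ _, ?_⟩
  have h1 : min D (lam * D / (N * Lam + 1)) ≤ lam * D / (N * Lam + 1) := min_le_right _ _
  have h2 : 0 < min D (lam * D / (N * Lam + 1)) := by positivity
  rw [le_div_iff₀ (by positivity)] at h1
  nlinarith

/-- The profile of a one-dimensional blowup is not touched strictly by a parabola. -/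
lemma RescalingFamily.no_touching
    (hfam : RescalingFamily lam Lam M r₀ L G G₀ u z₀) (hM : 2 * L + 4 ≤ M) (ht : ∀ k, 0 < t k)
    (htlim : Tendsto t atTop (𝓝 0))
    (hconv : TendstoUniformlyOn (fun k x => u (z₀ + t k • x) / t k) w atTop (ball 0 1))
    {f : ℝ → ℝ} (hwf : ∀ x ∈ ball (0 : Eucl n) 1, w x = f (x (Fin.last n)))
    (hfL : ∀ y ∈ Set.Ioo (-1 : ℝ) 1, ∀ y' ∈ Set.Ioo (-1 : ℝ) 1, |f y - f y'| ≤ L * |y - y'|)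
    (hf0 : f 0 = 0) {s : ℝ} (hs : s = 1 ∨ s = -1) {y₀ ρ D μ : ℝ} (hρ : 0 < ρ) (hD : 0 < D)
    (hI : Set.Icc (y₀ - ρ) (y₀ + ρ) ⊆ Set.Ioo (-1) 1)
    (htouch : ∀ y ∈ Set.Icc (y₀ - ρ) (y₀ + ρ),
      s * f y ≤ s * f y₀ + μ * (y - y₀) - D / 2 * (y - y₀) ^ 2)
    (hoff : s = 1 → ρ ≤ |y₀|) : False := by
  have hs1 : |s| = 1 := by rcases hs with rfl | rfl <;> simp
  have hss : s * s = 1 := by rcases hs with rfl | rfl <;> norm_num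
  have hL0 := L.coe_nonneg
  have hl := hI (Set.left_mem_Icc.2 (by linarith))
  have hr := hI (Set.right_mem_Icc.2 (by linarith))
  have hy₀ : y₀ ∈ Set.Ioo (-1 : ℝ) 1 := hI ⟨by linarith, by linarith⟩
  have hρ1 : ρ ≤ 1 := by linarith [hl.1, hr.2]
  have hcoef := hfam.coeffs r₀ hfam.radius_pos le_rfl
  set D' := min D 1 / 2 with hD'
  have hD'0 : 0 < D' := by positivity
  have hD'D : 2 * D' ≤ D := by rw [hD']; linarith [min_le_left D 1]
  have hD'1 : 2 * D' ≤ 1 := by rw [hD']; linarith [min_le_right D 1]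
  obtain ⟨δ, hδ0, hδD, hδ⟩ := exists_small_tangential hcoef.lam_pos hcoef.Lam_nonneg hD'0 n
  set θ := δ * ρ ^ 2 / 4 with hθ
  have hρ2 : ρ ^ 2 ≤ 1 := by nlinarith
  have hθ0 : 0 < θ := by positivity
  have hθ1 : θ ≤ 1 := by rw [hθ]; nlinarith
  have hμ : |μ| ≤ L := by
    have h1 := htouch (y₀ + ρ) ⟨by linarith, le_rfl⟩
    have h2 := htouch (y₀ - ρ) ⟨le_rfl, by linarith⟩
    have h3 : |s * f (y₀ + ρ) - s * f y₀| ≤ L * ρ := by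
      rw [← mul_sub, abs_mul, hs1, one_mul]
      refine (hfL _ hr _ hy₀).trans (le_of_eq ?_)
      rw [add_sub_cancel_left, abs_of_pos hρ]
    have h4 : |s * f (y₀ - ρ) - s * f y₀| ≤ L * ρ := by
      rw [← mul_sub, abs_mul, hs1, one_mul]
      refine (hfL _ hl _ hy₀).trans (le_of_eq ?_)
      rw [sub_sub_cancel_left, abs_neg, abs_of_pos hρ]
    have h5 : 0 ≤ D / 2 * ρ ^ 2 := by positivity
    rw [abs_le]
    constructor
    · refine le_of_mul_le_mul_right ?_ hρ
      have := (abs_le.1 h3).1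
      ring_nf at h1 h5 this ⊢
      linarith
    · refine le_of_mul_le_mul_right ?_ hρ
      have := (abs_le.1 h4).1
      ring_nf at h2 h5 this ⊢
      linarith
  set c : Eucl n := y₀ • eLast n with hc
  have hclast : c (Fin.last n) = y₀ := by simp [hc, eLast]
  have hcn : ‖c‖ = |y₀| := by rw [hc, norm_smul, norm_eLast, mul_one, Real.norm_eq_abs]
  have habs : |y₀| + ρ < 1 := by
    have := hl.1
    have := hr.2
    rcases abs_cases y₀ with ⟨h, -⟩ | ⟨h, -⟩ <;> linarith
  have hsub : closedBall c ρ ⊆ ball 0 1 := fun x hx => by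
    rw [mem_closedBall, dist_eq_norm] at hx
    have := norm_le_insert' x c
    rw [mem_ball_zero_iff]
    linarith
  have hcball : c ∈ ball (0 : Eucl n) 1 := hsub (mem_closedBall_self hρ.le)
  have hfy : |f y₀| ≤ L := by
    have := hfL y₀ hy₀ 0 (by norm_num)
    rw [hf0, sub_zero, sub_zero] at this
    have h1 : |y₀| ≤ 1 := by linarith
    nlinarith
  have hbarr : ∀ x, s * barrier s δ D' (s * μ) (f y₀ - s * μ * y₀ - s * θ) c x =
      δ / 2 * ‖x - c‖ ^ 2 - (D' + δ) / 2 * (x (Fin.last n) - y₀) ^ 2 +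
        μ * (x (Fin.last n) - y₀) + s * f y₀ - θ := fun x => by
    simp only [barrier, PiLp.sub_apply, hclast]
    linear_combination (δ / 2 * ‖x - c‖ ^ 2 - (D' + δ) / 2 * (x (Fin.last n) - y₀) ^ 2 +
        μ * (x (Fin.last n) - y₀) - θ) * hss
  have hev := hfam.eventually_barrier_comparison hM ht htlim hconv hs hδ0.le (by linarith) hD'0
    (by linarith) hδ hθ0
  have hlim : Tendsto (fun k => u (z₀ + t k • c) / t k) atTop (𝓝 (w c)) :=
    hconv.tendsto_at hcball
  have hle : s * (w c - barrier s δ D' (s * μ) (f y₀ - s * μ * y₀ - s * θ) c c) ≤ 0 := by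
    refine le_of_tendsto ((hlim.sub_const _).const_mul s) ?_
    filter_upwards [hev] with k hk
    refine hk _ _ c ρ (by rwa [abs_mul, hs1, one_mul]) ?_ hρ hρ1 hsub (fun x hx => ?_)
      fun h1 x hx hx0 => ?_
    · rw [barrier_self, hclast]
      have h1 : |f y₀ - s * θ| ≤ |f y₀| + |s * θ| := abs_sub _ _
      rw [abs_mul, hs1, one_mul, abs_of_pos hθ0] at h1
      rw [show s * μ * y₀ + (f y₀ - s * μ * y₀ - s * θ) = f y₀ - s * θ by ring]
      linarith
    · rw [mul_sub, hbarr, hwf x (hsub (sphere_subset_closedBall hx))]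
      have hxc : ‖x - c‖ = ρ := by rw [← dist_eq_norm]; exact hx
      have hτ : |x (Fin.last n) - y₀| ≤ ρ := by
        have := abs_last_le (x - c)
        rwa [PiLp.sub_apply, hclast, hxc] at this
      have h1 := htouch (x (Fin.last n)) ⟨by linarith [(abs_le.1 hτ).1],
        by linarith [(abs_le.1 hτ).2]⟩
      rw [hxc]
      have h2 : 0 ≤ (x (Fin.last n) - y₀) ^ 2 := sq_nonneg _
      have h3 : 0 ≤ (D - D' - δ) * (x (Fin.last n) - y₀) ^ 2 :=
        mul_nonneg (by linarith) h2
      rw [hθ]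
      nlinarith
    · exfalso
      have h2 := abs_last_le (x - c)
      rw [PiLp.sub_apply, hclast, hx0, zero_sub, abs_neg, ← dist_eq_norm] at h2
      have := hoff h1
      have := mem_ball.1 hx
      linarith
  rw [mul_sub, hbarr, hwf c hcball, hclast] at hle
  simp at hle
  linarith

end Blowup

/-- A function on a segment that is never touched strictly from above by a concave parabola lies
below its chord. -/
lemma le_chord_of_no_touching {φ : ℝ → ℝ} {a b : ℝ} (hab : a < b)
    (hc : ContinuousOn φ (Set.Icc a b))
    (h : ∀ y₀ ρ D μ : ℝ, 0 < ρ → 0 < D → Set.Icc (y₀ - ρ) (y₀ + ρ) ⊆ Set.Icc a b →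
      (∀ y ∈ Set.Icc (y₀ - ρ) (y₀ + ρ), φ y ≤ φ y₀ + μ * (y - y₀) - D / 2 * (y - y₀) ^ 2) →
      False) {y : ℝ} (hy : y ∈ Set.Icc a b) :
    φ y ≤ φ a + (φ b - φ a) / (b - a) * (y - a) := by
  by_contra! hlt
  set σ := (φ b - φ a) / (b - a) with hσ
  have hσb : φ b = φ a + σ * (b - a) := by
    rw [hσ, div_mul_cancel₀ _ (by linarith)]; ring
  set κ := φ y - (φ a + σ * (y - a)) with hκ
  have hκ0 : 0 < κ := by linarith
  set D := κ / (b - a) ^ 2 with hD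
  have hba : 0 < b - a := by linarith
  have hD0 : 0 < D := by positivity
  set H : ℝ → ℝ := fun y => φ y - (φ a + σ * (y - a)) + D / 2 * ((y - a) * (y - b)) with hH
  have hHc : ContinuousOn H (Set.Icc a b) := by fun_prop
  obtain ⟨y₀, hy₀, hmax⟩ := isCompact_Icc.exists_isMaxOn (Set.nonempty_Icc.2 hab.le) hHc
  have hHy : 0 < H y := by
    have h1 : D * (b - a) ^ 2 = κ := by rw [hD, div_mul_cancel₀ _ (by positivity)]
    have h2 : -((y - a) * (y - b)) ≤ (b - a) ^ 2 := by nlinarith [hy.1, hy.2]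
    have h3 : D * -((y - a) * (y - b)) ≤ κ := by rw [← h1]; gcongr
    simp only [hH]
    linarith
  have hHy₀ : 0 < H y₀ := hHy.trans_le (hmax hy)
  have ha : y₀ ≠ a := by
    rintro rfl
    simp [hH] at hHy₀
  have hb : y₀ ≠ b := by
    rintro rfl
    simp only [hH, hσb] at hHy₀
    simp at hHy₀
  have ha' : a < y₀ := lt_of_le_of_ne hy₀.1 ha.symm
  have hb' : y₀ < b := lt_of_le_of_ne hy₀.2 hb
  have hsub : Set.Icc (y₀ - min (y₀ - a) (b - y₀)) (y₀ + min (y₀ - a) (b - y₀)) ⊆ Set.Icc a b :=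
    Set.Icc_subset_Icc (by linarith [min_le_left (y₀ - a) (b - y₀)])
      (by linarith [min_le_right (y₀ - a) (b - y₀)])
  refine h y₀ (min (y₀ - a) (b - y₀)) D (σ - D / 2 * (2 * y₀ - a - b))
    (lt_min (by linarith) (by linarith)) hD0 hsub fun x hx => ?_
  have : H x ≤ H y₀ := hmax (hsub hx)
  simp only [hH] at this
  nlinarith

section Blowup

variable {lam Lam M r₀ : ℝ} {L : ℝ≥0} {G : ℝ → Eucl n → ℝ → Eucl n → Eucl n}
  {G₀ : ℝ → Eucl n → ℝ → Eucl n → ℝ} {u w : Eucl n → ℝ} {z₀ : Eucl n} {t : ℕ → ℝ}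

/-- The increments of a blowup in the tangential directions are nonpositive. -/
lemma RescalingFamily.blowup_tangential_le
    (hfam : RescalingFamily lam Lam M r₀ L G G₀ u z₀) (hL : 0 < L) (hM : 2 * L ≤ M)
    (hu : LipschitzWith L u) (ht : ∀ k, 0 < t k) (htlim : Tendsto t atTop (𝓝 0))
    (hconv : TendstoUniformlyOn (fun k x => u (z₀ + t k • x) / t k) w atTop (ball 0 1))
    {e : Eucl n} (he : ‖e‖ = 1) (he0 : e (Fin.last n) = 0) {x : Eucl n} {h : ℝ} (hh : 0 < h)
    (hx : x ∈ ball (0 : Eucl n) 1) (hxe : x + h • e ∈ ball (0 : Eucl n) 1) :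
    w (x + h • e) ≤ w x := by
  refine le_of_forall_pos_le_add fun ε hε => ?_
  obtain ⟨r, hr, H⟩ := hfam.slope_small hL hM hu he he0 (S := ε / h) (by positivity)
  have h1 := (hconv.tendsto_at hxe).sub (hconv.tendsto_at hx)
  have : w (x + h • e) - w x ≤ ε := by
    refine le_of_tendsto h1 ?_
    filter_upwards [htlim.eventually (gt_mem_nhds hr)] with k hk
    have hball : ∀ y ∈ ball (0 : Eucl n) 1, z₀ + t k • y ∈ ball z₀ r := fun y hy => by
      have : ‖y‖ < 1 := by simpa using hy
      rw [mem_ball, dist_eq_norm, add_sub_cancel_left, norm_smul, Real.norm_eq_abs,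
        abs_of_pos (ht k)]
      nlinarith [ht k]
    have e1 : z₀ + t k • (x + h • e) = z₀ + t k • x + (t k * h) • e := by module
    have h2 := hball _ hxe
    rw [e1] at h2
    have h3 := H (z₀ + t k • x) (t k * h) (mul_pos (ht k) hh) (hball x hx) h2
    rw [e1, ← sub_div, div_le_iff₀ (ht k)]
    refine h3.trans (le_of_eq ?_)
    field_simp
  linarith

lemma RescalingFamily.blowup_eq_profile
    (hfam : RescalingFamily lam Lam M r₀ L G G₀ u z₀) (hL : 0 < L) (hM : 2 * L ≤ M)
    (hu : LipschitzWith L u) (ht : ∀ k, 0 < t k) (htlim : Tendsto t atTop (𝓝 0))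
    (hconv : TendstoUniformlyOn (fun k x => u (z₀ + t k • x) / t k) w atTop (ball 0 1))
    {x : Eucl n} (hx : x ∈ ball (0 : Eucl n) 1) : w x = w (x (Fin.last n) • eLast n) := by
  set y : Eucl n := x (Fin.last n) • eLast n with hy
  have hyb : y ∈ ball (0 : Eucl n) 1 := by
    rw [mem_ball_zero_iff, hy, norm_smul, norm_eLast, mul_one]
    exact (abs_last_le x).trans_lt (by simpa using hx)
  by_cases hxy : x = y
  · rw [← hxy]
  have hd : 0 < ‖x - y‖ := norm_pos_iff.2 (sub_ne_zero.2 hxy)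
  set e : Eucl n := ‖x - y‖⁻¹ • (x - y) with he
  have he1 : ‖e‖ = 1 := by rw [he, norm_smul, norm_inv, norm_norm, inv_mul_cancel₀ hd.ne']
  have he0 : e (Fin.last n) = 0 := by simp [he, hy, eLast]
  have hxe : y + ‖x - y‖ • e = x := by
    rw [he, smul_smul, mul_inv_cancel₀ hd.ne', one_smul, add_sub_cancel]
  have hye : x + ‖x - y‖ • -e = y := by
    rw [smul_neg, ← sub_eq_add_neg, sub_eq_iff_eq_add, hxe]
  have h1 := hfam.blowup_tangential_le hL hM hu ht htlim hconv he1 he0 hd hyb (by rwa [hxe])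
  have h2 := hfam.blowup_tangential_le hL hM hu ht htlim hconv (e := -e) (by rwa [norm_neg])
    (by simp [he0]) hd hx (by rwa [hye])
  rw [hxe] at h1
  rw [hye] at h2
  exact le_antisymm h1 h2

/-- A blowup is linear on each side of the thin space and concave across it. -/
lemma RescalingFamily.blowup_two_sided
    (hfam : RescalingFamily lam Lam M r₀ L G G₀ u z₀) (hL : 0 < L) (hM : 2 * L + 4 ≤ M)
    (hu : LipschitzWith L u) (hu0 : u z₀ = 0) (ht : ∀ k, 0 < t k)
    (htlim : Tendsto t atTop (𝓝 0))
    (hconv : TendstoUniformlyOn (fun k x => u (z₀ + t k • x) / t k) w atTop (ball 0 1)) :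
    ∃ α β : ℝ, α ≤ β ∧ |α| ≤ L ∧ |β| ≤ L ∧ ∀ x ∈ ball (0 : Eucl n) 1,
      (0 ≤ x (Fin.last n) → w x = α * x (Fin.last n)) ∧
        (x (Fin.last n) ≤ 0 → w x = β * x (Fin.last n)) := by
  set f : ℝ → ℝ := fun y => w (y • eLast n) with hf
  have hwf : ∀ x ∈ ball (0 : Eucl n) 1, w x = f (x (Fin.last n)) := fun x hx =>
    hfam.blowup_eq_profile hL (by linarith) hu ht htlim hconv hx
  have hmem : ∀ y ∈ Set.Ioo (-1 : ℝ) 1, y • eLast n ∈ ball (0 : Eucl n) 1 := fun y hy => by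
    rw [mem_ball_zero_iff, norm_smul, norm_eLast, mul_one]
    exact abs_lt.2 hy
  have hfL : ∀ y ∈ Set.Ioo (-1 : ℝ) 1, ∀ y' ∈ Set.Ioo (-1 : ℝ) 1,
      |f y - f y'| ≤ L * |y - y'| := fun y hy y' hy' => by
    refine le_of_tendsto ((hconv.tendsto_at (hmem y hy)).sub
      (hconv.tendsto_at (hmem y' hy'))).abs (.of_forall fun k => ?_)
    have h1 := hu.dist_le_mul (z₀ + t k • y • eLast n) (z₀ + t k • y' • eLast n)
    rw [Real.dist_eq, dist_add_left, dist_smul₀, dist_eq_norm, ← sub_smul, norm_smul, norm_eLast,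
      mul_one, Real.norm_eq_abs, Real.norm_eq_abs, abs_of_pos (ht k)] at h1
    rw [← sub_div, abs_div, abs_of_pos (ht k), div_le_iff₀ (ht k)]
    linarith
  have hf0 : f 0 = 0 := by
    have h1 := hconv.tendsto_at (hmem 0 (by norm_num))
    simp only [zero_smul, smul_zero, add_zero, hu0, zero_div] at h1
    simpa [hf] using (tendsto_nhds_unique h1 tendsto_const_nhds)
  have hfc : ContinuousOn f (Set.Ioo (-1) 1) :=
    (LipschitzOnWith.of_dist_le_mul (K := L) fun y hy y' hy' => by
      rw [Real.dist_eq, Real.dist_eq]; exact hfL y hy y' hy').continuousOn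
  have hconc : ∀ a b : ℝ, a < b → Set.Icc a b ⊆ Set.Ioo (-1 : ℝ) 1 → ∀ y ∈ Set.Icc a b,
      f a + (f b - f a) / (b - a) * (y - a) ≤ f y := fun a b hab hI y hy => by
    have := le_chord_of_no_touching (φ := fun y => -1 * f y) hab
      ((hfc.mono hI).const_smul (-1 : ℝ)) (fun y₀ ρ D μ hρ hD hsub htouch =>
        hfam.no_touching hM ht htlim hconv hwf hfL hf0 (.inr rfl) hρ hD (hsub.trans hI) htouch
          (by norm_num)) hy
    have e : (-1 * f b - -1 * f a) / (b - a) = -((f b - f a) / (b - a)) := by ring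
    rw [e] at this
    linarith
  have hconv' : ∀ a b : ℝ, a < b → Set.Icc a b ⊆ Set.Ioo (-1 : ℝ) 1 → (0 ≤ a ∨ b ≤ 0) →
      ∀ y ∈ Set.Icc a b, f y ≤ f a + (f b - f a) / (b - a) * (y - a) :=
    fun a b hab hI h0 y hy => by
    refine le_chord_of_no_touching hab (hfc.mono hI) (fun y₀ ρ D μ hρ hD hsub htouch =>
        hfam.no_touching (s := 1) hM ht htlim hconv hwf hfL hf0 (.inl rfl) hρ hD (hsub.trans hI)
          (fun y hy => by simpa only [one_mul] using htouch y hy) fun _ => ?_) hy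
    have h1 := (hsub (Set.left_mem_Icc.2 (by linarith))).1
    have h2 := (hsub (Set.right_mem_Icc.2 (by linarith))).2
    rcases h0 with h0 | h0
    · exact le_trans (by linarith) (le_abs_self y₀)
    · exact le_trans (by linarith) (neg_le_abs y₀)
  have hpos : ∀ b ∈ Set.Ioo (0 : ℝ) 1, ∀ y ∈ Set.Icc 0 b, f y = f b / b * y := fun b hb y hy => by
    have hI : Set.Icc 0 b ⊆ Set.Ioo (-1 : ℝ) 1 := Set.Icc_subset_Ioo (by norm_num) hb.2
    have h1 := hconc 0 b hb.1 hI y hy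
    have h2 := hconv' 0 b hb.1 hI (.inl le_rfl) y hy
    simp only [hf0, sub_zero, zero_add] at h1 h2
    exact le_antisymm h2 h1
  have hneg : ∀ a ∈ Set.Ioo (-1 : ℝ) 0, ∀ y ∈ Set.Icc a 0, f y = f a / a * y := fun a ha y hy => by
    have hI : Set.Icc a 0 ⊆ Set.Ioo (-1 : ℝ) 1 := Set.Icc_subset_Ioo ha.1 (by norm_num)
    have h1 := hconc a 0 ha.2 hI y hy
    have h2 := hconv' a 0 ha.2 hI (.inr le_rfl) y hy
    rw [le_antisymm h2 h1, hf0]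
    have := ha.2.ne
    field_simp
    ring
  have hpos' : ∀ y, 0 ≤ y → y < 1 → f y = 2 * f (1 / 2) * y := fun y h0 h1 => by
    rcases le_total y (1 / 2) with h | h
    · rw [hpos (1 / 2) (by norm_num) y ⟨h0, h⟩]; ring
    · have := hpos y ⟨by linarith, h1⟩ (1 / 2) ⟨by norm_num, h⟩
      rw [this]
      have : y ≠ 0 := by linarith
      field_simp
  have hneg' : ∀ y, y ≤ 0 → -1 < y → f y = -2 * f (-1 / 2) * y := fun y h0 h1 => by
    rcases le_total (-1 / 2) y with h | h
    · rw [hneg (-1 / 2) (by norm_num) y ⟨h, h0⟩]; ring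
    · have := hneg y ⟨h1, by linarith⟩ (-1 / 2) ⟨h, by norm_num⟩
      rw [this]
      have : y ≠ 0 := by linarith
      field_simp
  have habs1 : |f (1 / 2)| ≤ L * (1 / 2) := by
    have := hfL (1 / 2) (by norm_num) 0 (by norm_num)
    rwa [hf0, sub_zero, sub_zero, abs_of_pos (a := (1 / 2 : ℝ)) (by norm_num)] at this
  have habs2 : |f (-1 / 2)| ≤ L * (1 / 2) := by
    have := hfL (-1 / 2) (by norm_num) 0 (by norm_num)
    rwa [hf0, sub_zero, sub_zero, abs_of_neg (a := (-1 / 2 : ℝ)) (by norm_num),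
      show -(-1 / 2 : ℝ) = 1 / 2 by norm_num] at this
  refine ⟨2 * f (1 / 2), -2 * f (-1 / 2), ?_, ?_, ?_, fun x hx => ⟨fun h0 => ?_, fun h0 => ?_⟩⟩
  · have := hconc (-1 / 2) (1 / 2) (by norm_num)
      (Set.Icc_subset_Ioo (by norm_num) (by norm_num)) 0 (by norm_num)
    rw [hf0] at this
    norm_num at this
    linarith
  · rw [abs_mul, abs_two]; linarith
  · rw [abs_mul, abs_neg, abs_two]; linarith
  · have h1 := (le_abs_self _).trans_lt ((abs_last_le x).trans_lt (by simpa using hx))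
    rw [hwf x hx, hpos' _ h0 h1]
  · have h1 := (abs_lt.1 ((abs_last_le x).trans_lt (show ‖x‖ < 1 by simpa using hx))).1
    rw [hwf x hx, hneg' _ h0 h1]

lemma RescalingFamily.blowup_linear (hfam : RescalingFamily lam Lam M r₀ L G G₀ u z₀)
    (hL : 0 < L) (hM : 2 * L + 4 ≤ M) (hu : LipschitzWith L u) (hu0 : u z₀ = 0)
    (hz₀ : z₀ (Fin.last n) = 0)
    (hfree : ∀ r > 0, ∃ y ∈ ball z₀ r, y (Fin.last n) = 0 ∧ 0 < u y)
    (ht : ∀ k, 0 < t k) (htlim : Tendsto t atTop (𝓝 0))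
    (hconv : TendstoUniformlyOn (fun k x => u (z₀ + t k • x) / t k) w atTop (ball 0 1)) :
    ∃ a : ℝ, ∀ x ∈ ball (0 : Eucl n) 1, w x = a * x (Fin.last n) := by
  obtain ⟨α, β, hαβ, hα, hβ, hw⟩ := hfam.blowup_two_sided hL hM hu hu0 ht htlim hconv
  rcases hαβ.eq_or_lt with rfl | hlt
  · exact ⟨α, fun x hx => (le_total 0 (x (Fin.last n))).elim (hw x hx).1 (hw x hx).2⟩
  exfalso
  have hco := hfam.coeffs r₀ hfam.radius_pos le_rfl
  set D : ℝ := min ((β - α) / 2) 1 with hD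
  have hD0 : 0 < D := lt_min (by linarith) one_pos
  have hDκ : D ≤ (β - α) / 2 := min_le_left _ _
  have hD1 : D ≤ 1 := min_le_right _ _
  obtain ⟨δ, hδ0, hδD, hδ⟩ := exists_small_tangential hco.lam_pos hco.Lam_nonneg hD0 n
  have hm : |(α + β) / 2| ≤ L := by
    rw [abs_le] at hα hβ ⊢
    constructor <;> linarith
  have hev := hfam.eventually_barrier_comparison hM ht htlim hconv (.inl rfl) hδ0.le (by linarith)
    hD0 hD1 hδ (θ := δ / 32) (by positivity)
  obtain ⟨k, hk⟩ := hev.exists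
  have htk := ht k
  obtain ⟨y, hy, hy0, huy⟩ := hfree (t k / 4) (by positivity)
  set c : Eucl n := (t k)⁻¹ • (y - z₀) with hc
  have hyc : z₀ + t k • c = y := by
    rw [hc, smul_inv_smul₀ htk.ne', add_sub_cancel]
  have hc0 : c (Fin.last n) = 0 := by simp [hc, hy0, hz₀]
  have hcn : ‖c‖ < 1 / 4 := by
    rw [mem_ball, dist_eq_norm] at hy
    rw [hc, norm_smul, norm_inv, Real.norm_of_nonneg htk.le, inv_mul_lt_iff₀ htk]
    linarith
  have hsub : closedBall c (1 / 4) ⊆ ball 0 1 := fun x hx => by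
    rw [mem_closedBall, dist_eq_norm] at hx
    have := norm_le_insert' x c
    rw [mem_ball_zero_iff]
    linarith
  have hbarr : ∀ x, barrier 1 δ D ((α + β) / 2) 0 c x = δ / 2 * ‖x - c‖ ^ 2
      - (D + δ) / 2 * x (Fin.last n) ^ 2 + (α + β) / 2 * x (Fin.last n) := fun x => by
    simp only [barrier, PiLp.sub_apply, hc0]
    ring
  have hbc : barrier 1 δ D ((α + β) / 2) 0 c c = 0 := by rw [barrier_self, hc0]; ring
  have h := hk ((α + β) / 2) 0 c (1 / 4) hm (by rw [hbc, abs_zero]; positivity) (by norm_num)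
    (by norm_num) hsub (fun x hx => ?_) fun _ x _ hx0 => ?_
  · rw [hbc, hyc, sub_zero, one_mul] at h
    exact absurd h (not_le.2 (by positivity))
  · have hxc : ‖x - c‖ = 1 / 4 := by rw [← dist_eq_norm]; exact hx
    have hτ : |x (Fin.last n)| ≤ 1 / 4 := by
      have := abs_last_le (x - c)
      rwa [PiLp.sub_apply, hc0, hxc, sub_zero] at this
    rw [hbarr, hxc]
    obtain ⟨h1, h2⟩ := hw x (hsub (sphere_subset_closedBall hx))
    have hκ : 0 ≤ (β - α - D - δ) * |x (Fin.last n)| :=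
      mul_nonneg (by linarith) (abs_nonneg _)
    have hτ2 : x (Fin.last n) ^ 2 ≤ |x (Fin.last n)| := by
      rw [← sq_abs]
      nlinarith [abs_nonneg (x (Fin.last n))]
    have hsq : (D + δ) / 2 * x (Fin.last n) ^ 2 ≤ (D + δ) / 2 * |x (Fin.last n)| := by gcongr
    rcases le_total 0 (x (Fin.last n)) with h0 | h0
    · rw [h1 h0]
      rw [abs_of_nonneg h0] at hκ hsq
      linarith
    · rw [h2 h0]
      rw [abs_of_nonpos h0] at hκ hsq
      linarith
  · rw [hbarr, hx0]
    have : 0 ≤ δ / 2 * ‖x - c‖ ^ 2 := by positivity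
    linarith

end Blowup

lemma tendstoUniformlyOn_rescaling_congr {u u' w : Eucl n → ℝ} {z₀ : Eucl n} {t : ℕ → ℝ}
    (hconv : TendstoUniformlyOn (fun k x => u (z₀ + t k • x) / t k) w atTop (ball 0 1))
    (heq : Set.EqOn u u' (closedBall 0 1)) (hz₀ : z₀ ∈ ball 0 1)
    (htlim : Tendsto t atTop (𝓝 0)) :
    TendstoUniformlyOn (fun k x => u' (z₀ + t k • x) / t k) w atTop (ball 0 1) := by
  have hz : ‖z₀‖ < 1 := by simpa using hz₀
  refine hconv.congr ?_
  have := htlim.abs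
  rw [abs_zero] at this
  filter_upwards [this.eventually (gt_mem_nhds (sub_pos.2 hz))] with k hk x hx
  have hx1 : ‖x‖ < 1 := by simpa using hx
  have : z₀ + t k • x ∈ closedBall (0 : Eucl n) 1 := by
    rw [mem_closedBall_zero_iff]
    refine (norm_add_le _ _).trans ?_
    rw [norm_smul, Real.norm_eq_abs]
    nlinarith [abs_nonneg (t k), norm_nonneg x]
  simp only [heq this]

end TOP

open TOP in
/-- Corollary: flatness of blowups. All blowups of a Lipschitz
solution of the thin obstacle problem at a free boundary point are linear:
`u_∞(x) = a x_{n+1}`. -/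
theorem thin_obstacle_blowup_flat {n : ℕ}
    (F : Eucl n → ℝ → Eucl n → Eucl n) (F₀ : Eucl n → ℝ → Eucl n → ℝ)
    (g u : Eucl n → ℝ)
    (hF : H0 F F₀) (hell : H1 F)
    (hu : ThinSolution F F₀ g u)
    (z₀ : Eucl n) (hz₀ : z₀ ∈ freeBoundary u)
    (t : ℕ → ℝ) (ht : ∀ k, 0 < t k) (hmono : Antitone t)
    (htlim : Filter.Tendsto t Filter.atTop (nhds 0))
    (uInf : Eucl n → ℝ)
    (hconv : TendstoUniformlyOn (fun (k : ℕ) (x : Eucl n) => u (z₀ + t k • x) / t k)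
      uInf Filter.atTop (Metric.ball (0 : Eucl n) 1)) :
    ∃ a : ℝ, ∀ x ∈ Metric.ball (0 : Eucl n) 1, uInf x = a * x (Fin.last n) := by
  obtain ⟨C, hC⟩ := hu.1.1
  obtain ⟨u', hu', heq⟩ := (hC.weaken (le_self_add (b := 1))).extend_real
  have hball := ball_subset_closedBall (x := (0 : Eucl n)) (ε := 1)
  obtain ⟨lam, Lam, r₀, hfam⟩ := exists_rescalingFamily hF hell hu hz₀.1 hu' heq
    (M := 2 * (C + 1 : ℝ≥0) + 4) (by positivity)
  refine hfam.blowup_linear (by positivity) le_rfl hu' ?_ hz₀.1.1.2 (fun r hr => ?_) ht htlim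
    (tendstoUniformlyOn_rescaling_congr hconv heq hz₀.1.1.1 htlim)
  · rw [← heq (hball hz₀.1.1.1), hz₀.1.2]
  · obtain ⟨y, hy, hyr, huy⟩ := hz₀.2 r hr
    exact ⟨y, hyr, hy.2, by rwa [← heq (hball hy.1)]⟩
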